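/- arXiv:1910.01029 — 4 statements merged into one kernel-verified Lean document; each statement's English description precedes it below -/
import Mathlib

section
/- Let n ≥ 1 and let k be an integer with 1 ≤ k ≤ n and k having the same parity as n. Then the number of n-cycles s of [n] such that the product (1 2 ⋯ n)·s has exactly k cycles equals (2/(n(n+1))) · C(n+1, k). -/
open Equiv Finset

/-- `σ` is a single cycle on all of `Fin n` (an `n`-cycle of `[n]`);
fixed points count as 1-cycles, so this is correct also for `n = 1`. -/
def IsFullCycle {n : ℕ} (σ : Equiv.Perm (Fin n)) : Prop :=
  σ.partition.parts = {n}

instance {n : ℕ} (σ : Equiv.Perm (Fin n)) : Decidable (IsFullCycle σ) :=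
  decidable_of_iff (σ.partition.parts = {n}) Iff.rfl

/-- `z_M`: the number of permutations of `[n]` whose (full) cycle type,
fixed points included, is the multiset `M`. -/
def zNum (n : ℕ) (M : Multiset ℕ) : ℕ :=
  (univ.filter fun σ : Equiv.Perm (Fin n) => σ.partition.parts = M).card

/-- `p^{(n)}_M`: the number of ordered pairs `(c₁, c₂)` of `n`-cycles of `[n]`
whose product `c₁c₂` has cycle type `M`. -/
def pN (n : ℕ) (M : Multiset ℕ) : ℕ :=
  (univ.filter fun c : Equiv.Perm (Fin n) × Equiv.Perm (Fin n) =>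
    IsFullCycle c.1 ∧ IsFullCycle c.2 ∧ (c.1 * c.2).partition.parts = M).card

/-- `M↓(i+1)`: replace one part equal to `i+1` of `M` by a part equal to `i`. -/
def partDown (i : ℕ) (M : Multiset ℕ) : Multiset ℕ :=
  i ::ₘ M.erase (i + 1)

/-- `κ_{μ,λ}` for merging `k` parts: the number of ways of choosing `k` of the parts
of `μ` (parts of equal size being distinguished, which is accounted for by the
multiplicities in `Multiset.powersetCard`) so that replacing the chosen parts by a
single part equal to their sum yields `lam`. -/
def kappa (k : ℕ) (μ lam : Multiset ℕ) : ℕ :=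
  ((μ.powersetCard k).filter fun S => S.sum ::ₘ (μ - S) = lam).card

/-- `μ ▷_k λ`: `lam` can be obtained from `μ` by merging `k` parts into one part;
equivalently `μ` is obtained from `lam` by splitting one part into `k` parts. -/
def Splits (k : ℕ) (μ lam : Multiset ℕ) : Prop :=
  0 < kappa k μ lam

instance (k : ℕ) (μ lam : Multiset ℕ) : Decidable (Splits k μ lam) :=
  Nat.decLt _ _

/-- The position of `x` in the sequence `1, s(1), s²(1), …` (the linear order `<_s`). -/
def sIdx {n : ℕ} (s : Equiv.Perm (Fin n)) (x : Fin n) : ℕ :=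
  (List.range n).findIdx fun k =>
    decide ((s ^ k) ⟨0, Nat.lt_of_le_of_lt (Nat.zero_le x.val) x.isLt⟩ = x)

/-- The number of exceedances of the plane permutation `(s, π)`:
elements `x` with `x <_s π(x)`. -/
def excNum {n : ℕ} (s π : Equiv.Perm (Fin n)) : ℕ :=
  (univ.filter fun x : Fin n => sIdx s x < sIdx s (π x)).card

/-- `p^η_{λ,a}`: the number of plane permutations `(s, π)` on `[n]` whose diagonal
`s ∘ π⁻¹` has cycle type `η`, whose vertical `π` has cycle type `lam`, and having
exactly `a` exceedances. -/
def pEta (n : ℕ) (η lam : Multiset ℕ) (a : ℕ) : ℕ :=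
  (univ.filter fun c : Equiv.Perm (Fin n) × Equiv.Perm (Fin n) =>
    IsFullCycle c.1 ∧ (c.1 * c.2⁻¹).partition.parts = η ∧ c.2.partition.parts = lam ∧
      excNum c.1 c.2 = a).card

/-- `p^η_λ = Σ_a p^η_{λ,a}`. -/
def pEtaTot (n : ℕ) (η lam : Multiset ℕ) : ℕ :=
  (univ.filter fun c : Equiv.Perm (Fin n) × Equiv.Perm (Fin n) =>
    IsFullCycle c.1 ∧ (c.1 * c.2⁻¹).partition.parts = η ∧ c.2.partition.parts = lam).card


set_option linter.unusedSectionVars false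

namespace ZS

variable {α : Type*} [Fintype α] [DecidableEq α]

open Classical in
/-- Permutations that are a single cycle on `S` and fix everything else. -/
noncomputable def FC (S : Finset α) : Finset (Perm α) :=
  univ.filter fun σ => σ.IsCycleOn (S : Set α) ∧ ∀ x, x ∉ S → σ x = x

lemma mem_FC {S : Finset α} {σ : Perm α} :
    σ ∈ FC S ↔ σ.IsCycleOn (S : Set α) ∧ ∀ x, x ∉ S → σ x = x := by
  simp [FC]

lemma FC_apply_mem {S : Finset α} {σ : Perm α} (h : σ ∈ FC S) {x : α} : σ x ∈ S ↔ x ∈ S := by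
  have := (mem_FC.1 h).1.apply_mem_iff (x := x)
  simpa using this

lemma isCycleOn_of {S : Finset α} {g : Perm α} (hfix : ∀ x, x ∉ S → g x = x)
    (h : ∀ x ∈ S, ∀ y ∈ S, g.SameCycle x y) : g ∈ FC S := by
  refine mem_FC.2 ⟨⟨?_, fun x hx y hy => h x hx y hy⟩, hfix⟩
  have hm : ∀ x, x ∈ S → g x ∈ S := by
    intro x hx
    by_contra hc
    have h2 := hfix _ hc
    have := g.injective h2
    rw [this] at hc; exact hc hx
  refine ⟨fun x hx => hm x hx, g.injective.injOn, ?_⟩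
  intro y hy
  refine ⟨g.symm y, ?_, by simp⟩
  by_contra hc
  have h2 := hfix _ hc
  rw [Equiv.apply_symm_apply] at h2
  rw [← h2] at hc
  exact hc hy

lemma FC_insert_mem {S : Finset α} {a j : α} (ha : a ∉ S) (hj : j ∈ S) {c : Perm α}
    (hc : c ∈ FC S) : swap a j * c ∈ FC (insert a S) := by
  have hca : c a = a := (mem_FC.1 hc).2 a ha
  set g := swap a j * c with hg
  have ga : g a = j := by simp [hg, hca]
  have step : ∀ x ∈ S, g.SameCycle x (c x) := by
    intro x hx
    have hcx : c x ≠ a := fun h => ha (h ▸ (FC_apply_mem hc).2 hx)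
    by_cases h : c x = j
    · have : g x = a := by simp [hg, h]
      rw [h, ← ga, ← this]
      exact ⟨2, by simp [pow_two]⟩
    · have : g x = c x := by
        simp only [hg, Perm.mul_apply]; exact swap_apply_of_ne_of_ne hcx h
      exact ⟨1, by simpa using this⟩
  have pw : ∀ n : ℕ, ∀ x ∈ S, (c ^ n) x ∈ S ∧ g.SameCycle x ((c ^ n) x) := by
    intro n
    induction n with
    | zero => intro x hx; exact ⟨hx, Equiv.Perm.SameCycle.refl _ _⟩
    | succ n ih =>
      intro x hx
      obtain ⟨h1, h2⟩ := ih x hx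
      rw [pow_succ', Perm.mul_apply]
      exact ⟨(FC_apply_mem hc).2 h1, h2.trans (step _ h1)⟩
  have hj' : ∀ x ∈ insert a S, g.SameCycle j x := by
    intro x hx
    rcases Finset.mem_insert.1 hx with rfl | hx
    · exact Equiv.Perm.SameCycle.symm ⟨1, by simpa using ga⟩
    · obtain ⟨n, -, hn⟩ := (mem_FC.1 hc).1.exists_pow_eq hj hx
      rw [← hn]; exact (pw n j hj).2
  refine isCycleOn_of ?_ fun x hx y hy => (hj' x hx).symm.trans (hj' y hy)
  intro x hx
  simp only [Finset.mem_insert, not_or] at hx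
  have : c x = x := (mem_FC.1 hc).2 x hx.2
  simp only [hg, Perm.mul_apply, this]
  exact swap_apply_of_ne_of_ne hx.1 (fun h => hx.2 (h ▸ hj))

lemma FC_insert_rev {S : Finset α} {a : α} (ha : a ∉ S) (hS : S.Nonempty) {g : Perm α}
    (hg : g ∈ FC (insert a S)) : g a ∈ S ∧ swap a (g a) * g ∈ FC S := by
  have hga : g a ≠ a := by
    intro h
    obtain ⟨b, hb⟩ := hS
    obtain ⟨n, -, hn⟩ := (mem_FC.1 hg).1.exists_pow_eq (a := a) (b := b) (by simp) (by simp [hb])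
    rw [Perm.pow_apply_eq_self_of_apply_eq_self h] at hn
    exact ha (hn ▸ hb)
  have hgaS : g a ∈ S := by
    have := (FC_apply_mem hg (x := a)).2 (by simp)
    exact (Finset.mem_insert.1 this).resolve_left hga
  refine ⟨hgaS, ?_⟩
  set c := swap a (g a) * g with hc
  have c1 : ∀ x, x ≠ a → g x ≠ a → c x = g x := by
    intro x hx hgx
    simp only [hc, Perm.mul_apply]
    exact swap_apply_of_ne_of_ne hgx (fun h => hx (g.injective h))
  have c2 : ∀ x, g x = a → c x = g a := by
    intro x hx; simp [hc, hx]
  have pw : ∀ x ∈ S, ∀ n : ℕ, ((g ^ n) x ≠ a → c.SameCycle x ((g ^ n) x)) ∧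
      ((g ^ n) x = a → c.SameCycle x (g a)) := by
    intro x hx n
    induction n with
    | zero => exact ⟨fun _ => Equiv.Perm.SameCycle.refl _ _, fun h => absurd (by simpa using h) (fun h : x = a => ha (h ▸ hx))⟩
    | succ n ih =>
      rw [pow_succ', Perm.mul_apply]
      set y := (g ^ n) x
      by_cases hy : y = a
      · have := ih.2 hy
        rw [hy]
        exact ⟨fun _ => this, fun h => absurd h hga⟩
      · have h0 := ih.1 hy
        constructor
        · intro h
          rw [← c1 y hy h]
          exact h0.trans ⟨1, by simp⟩
        · intro h
          rw [← c2 y h]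
          exact h0.trans ⟨1, by simp⟩
  refine isCycleOn_of ?_ ?_
  · intro x hx
    by_cases hxa : x = a
    · subst hxa; simp [hc]
    · have : g x = x := (mem_FC.1 hg).2 x (by simp [hx, hxa])
      rw [c1 x hxa (by rw [this]; exact hxa), this]
  · intro x hx y hy
    obtain ⟨n, -, hn⟩ := (mem_FC.1 hg).1.exists_pow_eq (a := x) (b := y)
      (by simp [hx]) (by simp [hy])
    have := (pw x hx n).1 (by rw [hn]; exact fun h => ha (h ▸ hy))
    rwa [hn] at this

lemma FC_sum_left {S : Finset α} {a : α} (ha : a ∉ S) (hS : S.Nonempty) (φ : Perm α → ℕ) :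
    ∑ g ∈ FC (insert a S), φ g = ∑ j ∈ S, ∑ c ∈ FC S, φ (swap a j * c) := by
  rw [← Finset.sum_product']
  symm
  refine Finset.sum_bij' (fun p _ => swap a p.1 * p.2) (fun g _ => (g a, swap a (g a) * g))
    ?_ ?_ ?_ ?_ ?_
  · rintro ⟨j, c⟩ h
    rw [Finset.mem_product] at h
    exact FC_insert_mem ha h.1 h.2
  · intro g hg
    rw [Finset.mem_product]
    exact FC_insert_rev ha hS hg
  · rintro ⟨j, c⟩ h
    rw [Finset.mem_product] at h
    have : c a = a := (mem_FC.1 h.2).2 a ha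
    simp [this]
  · intro g hg
    simp
  · simp

lemma FC_sum_right {S : Finset α} {a : α} (ha : a ∉ S) (hS : S.Nonempty) (φ : Perm α → ℕ) :
    ∑ g ∈ FC (insert a S), φ g = ∑ j ∈ S, ∑ c ∈ FC S, φ (c * swap a j) := by
  rw [FC_sum_left ha hS, Finset.sum_comm, Finset.sum_comm (s := S)]
  refine Finset.sum_congr rfl fun c hc => ?_
  symm
  have hca : c a = a := (mem_FC.1 hc).2 a ha
  refine Finset.sum_bij' (fun j _ => c j) (fun j _ => c.symm j) ?_ ?_ ?_ ?_ ?_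
  · intro j hj; exact (FC_apply_mem hc).2 hj
  · intro j hj; rw [← FC_apply_mem hc]; simpa using hj
  · simp
  · simp
  · intro j hj
    rw [Equiv.mul_swap_eq_swap_mul, hca]

lemma FC_conj_mem {S : Finset α} (g : Perm α) {c : Perm α} (hc : c ∈ FC S) :
    g * c * g⁻¹ ∈ FC (S.map g.toEmbedding) := by
  rw [mem_FC] at *
  constructor
  · have := hc.1.conj (g := g)
    convert this using 1
    simp
  · intro x hx
    have : g⁻¹ x ∉ S := fun h => hx (Finset.mem_map.2 ⟨_, h, by simp⟩)
    rw [Perm.mul_apply, Perm.mul_apply, hc.2 _ this]; simp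

lemma FC_sum_conj (S : Finset α) (g : Perm α) (φ : Perm α → ℕ) :
    ∑ c ∈ FC (S.map g.toEmbedding), φ c = ∑ c ∈ FC S, φ (g * c * g⁻¹) := by
  symm
  refine Finset.sum_bij' (fun c _ => g * c * g⁻¹) (fun c _ => g⁻¹ * c * g) ?_ ?_ ?_ ?_ ?_
  · intro c hc; exact FC_conj_mem g hc
  · intro c hc
    have := FC_conj_mem g⁻¹ hc
    rw [Finset.map_map] at this
    convert this using 1
    · congr 1
      ext x
      simp
    · rw [inv_inv]
  · intro c _; group
  · intro c _; group
  · intro c _; rfl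

lemma FC_singleton (a : α) : FC ({a} : Finset α) = {1} := by
  ext σ
  rw [mem_FC, Finset.mem_singleton]
  constructor
  · rintro ⟨h1, h2⟩
    ext x
    by_cases hx : x = a
    · subst hx
      have := h1.apply_mem_iff (x := x)
      simpa using this
    · simpa using h2 x (by simpa using hx)
  · rintro rfl
    simp

lemma FC_card (S : Finset α) (hS : S.Nonempty) : (FC S).card = (S.card - 1).factorial := by
  induction hS using Finset.Nonempty.cons_induction with
  | singleton a => simp [FC_singleton]
  | cons a S ha hS ih =>
    rw [Finset.cons_eq_insert, Finset.card_eq_sum_ones, FC_sum_left ha hS]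
    simp only [ih, Finset.sum_const, smul_eq_mul,
      Finset.card_insert_of_notMem ha, Nat.add_sub_cancel]
    rw [mul_one]; exact Nat.mul_factorial_pred hS.card_pos.ne'

/-- number of factorizations `σ = ζ s` with `ζ ∈ FC U`, `s ∈ FC V`. -/
noncomputable def NN (U V : Finset α) (σ : Perm α) : ℕ :=
  ∑ ζ ∈ FC U, ∑ s ∈ FC V, if ζ * s = σ then 1 else 0

lemma NN_left {U : Finset α} (V : Finset α) {a : α} (ha : a ∉ U) (hU : U.Nonempty) (σ : Perm α) :
    NN (insert a U) V σ = ∑ y ∈ U, NN U V (swap a y * σ) := by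
  unfold NN
  rw [FC_sum_left ha hU]
  refine Finset.sum_congr rfl fun y _ => Finset.sum_congr rfl fun c _ =>
    Finset.sum_congr rfl fun s _ => ?_
  congr 1
  rw [eq_iff_iff, mul_assoc, ← eq_inv_mul_iff_mul_eq, swap_inv]

lemma NN_right (U : Finset α) {V : Finset α} {a : α} (ha : a ∉ V) (hV : V.Nonempty) (σ : Perm α) :
    NN U (insert a V) σ = ∑ z ∈ V, NN U V (σ * swap a z) := by
  unfold NN
  rw [Finset.sum_comm (s := V)]
  refine Finset.sum_congr rfl fun c _ => ?_
  rw [FC_sum_right ha hV]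
  refine Finset.sum_congr rfl fun y _ => Finset.sum_congr rfl fun s _ => ?_
  congr 1
  rw [eq_iff_iff, ← mul_assoc, ← eq_mul_inv_iff_mul_eq, swap_inv]

lemma NN_zero {U V : Finset α} {a : α} (hU : a ∉ U) (hV : a ∉ V) {σ : Perm α} (h : σ a ≠ a) :
    NN U V σ = 0 := by
  unfold NN
  refine Finset.sum_eq_zero fun c hc => Finset.sum_eq_zero fun s hs => if_neg ?_
  rintro rfl
  apply h
  rw [Perm.mul_apply, (mem_FC.1 hs).2 a hV, (mem_FC.1 hc).2 a hU]

lemma NN_left' {U V : Finset α} {a : α} (ha : a ∉ U) (hV : a ∉ V) (hU : U.Nonempty) (σ : Perm α) :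
    NN (insert a U) V σ = if σ a ∈ U then NN U V (swap a (σ a) * σ) else 0 := by
  rw [NN_left V ha hU]
  rw [← Finset.sum_ite_eq U (σ a) (fun y => NN U V (swap a y * σ))]
  refine Finset.sum_congr rfl fun y hy => ?_
  split_ifs with h
  · rfl
  · apply NN_zero ha hV
    intro h2
    apply h
    rw [Perm.mul_apply, swap_apply_eq_iff, swap_apply_left] at h2
    exact h2

lemma NN_both {U V : Finset α} {a : α} (ha : a ∉ U) (hV : a ∉ V) (hU : U.Nonempty)
    (hV' : V.Nonempty) (σ : Perm α) :
    NN (insert a U) (insert a V) σ =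
      ∑ z ∈ V, if σ z ∈ U then NN U V (swap a (σ z) * (σ * swap a z)) else 0 := by
  rw [NN_right _ hV hV']
  refine Finset.sum_congr rfl fun z _ => ?_
  rw [NN_left' ha hV hU]
  simp

lemma NN_conj (U V : Finset α) (g σ : Perm α) :
    NN (U.map g.toEmbedding) (V.map g.toEmbedding) (g * σ * g⁻¹) = NN U V σ := by
  unfold NN
  rw [FC_sum_conj]
  refine Finset.sum_congr rfl fun c _ => ?_
  rw [FC_sum_conj]
  refine Finset.sum_congr rfl fun s _ => ?_
  congr 1
  rw [eq_iff_iff]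
  constructor
  · intro h
    have : g * (c * s) * g⁻¹ = g * σ * g⁻¹ := by rw [← h]; group
    exact mul_left_cancel (mul_right_cancel this)
  · rintro rfl; group

lemma key_alg {σ : Perm α} {a u z : α} (hu : σ a = u) (hua : u ≠ a) (hza : z ≠ a)
    (hz : σ z ≠ a) :
    swap u z * (swap u (σ z) * (swap a u * σ * swap u z)) * (swap u z)⁻¹ =
      swap z u * (swap a (σ z) * (σ * swap a z)) := by
  have huz : u ≠ σ z := fun h => hza (σ.injective (hu.trans h)).symm
  have h1 : σ * swap a z = swap u (σ z) * σ := by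
    rw [mul_swap_eq_swap_mul, hu]
  have h2 : swap u (σ z) * swap a u = swap a (σ z) * swap u (σ z) := by
    rw [mul_swap_eq_swap_mul, swap_apply_left, swap_apply_of_ne_of_ne hua.symm hz.symm]
  rw [h1, swap_inv, swap_comm z u, ← mul_assoc (swap a (σ z)), ← h2]
  simp [mul_assoc]

lemma NN_singleton (u : α) : NN ({u} : Finset α) {u} 1 = 1 := by
  unfold NN
  rw [FC_singleton, Finset.sum_singleton, Finset.sum_singleton, mul_one, if_pos rfl]

lemma NN_pair {a u : α} (h : a ≠ u) : NN ({a, u} : Finset α) {u} (swap a u) = 1 := by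
  rw [NN_left' (by simpa using h) (by simpa using h) (by simp)]
  simp [NN_singleton]

lemma erase_map (S : Finset α) {u z : α} (hu : u ∈ S) (hz : z ∈ S) :
    (S.erase u).map (swap u z).toEmbedding = S.erase z := by
  ext x
  simp only [Finset.mem_map_equiv, symm_swap, Finset.mem_erase]
  by_cases h1 : x = u
  · subst h1
    simp [hu, hz]
    exact eq_comm.not
  · by_cases h2 : x = z
    · subst h2; simp
    · rw [swap_apply_of_ne_of_ne h1 h2]; simp [h1, h2]

theorem A_const (m : ℕ) : ∀ (T : Finset α), T.card = m → ∀ σ : Perm α,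
    (∀ x, x ∉ T → σ x = x) → Perm.sign σ = -1 →
    ∑ f ∈ T, NN T (T.erase f) σ = 2 * (m - 2).factorial := by
  induction m with
  | zero =>
    intro T hT σ hσ hs
    exfalso
    rw [Finset.card_eq_zero] at hT; subst hT
    have : σ = 1 := by ext x; simp [hσ]
    subst this
    simp at hs
  | succ m ih =>
    intro T hT σ hσ hs
    obtain ⟨a, hau⟩ : ∃ a, σ a ≠ a := by
      by_contra hc
      push Not at hc
      have : σ = 1 := by ext x; simp [hc]
      subst this
      simp at hs
    have haT : a ∈ T := by by_contra h; exact hau (hσ a h)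
    obtain ⟨S, haS, rfl⟩ : ∃ S, a ∉ S ∧ T = insert a S :=
      ⟨T.erase a, by simp, (Finset.insert_erase haT).symm⟩
    have hST : ∀ x, σ x ∈ insert a S ↔ x ∈ insert a S := by
      have h1 : ∀ x, σ x ∈ insert a S → x ∈ insert a S := by
        intro x hx
        by_contra h
        rw [hσ x h] at hx; exact h hx
      intro x
      refine ⟨h1 x, fun hx => ?_⟩
      by_contra h
      have h3 := σ.injective (hσ _ h)
      rw [h3] at h; exact h hx
    have hcard : S.card = m := by
      rw [Finset.card_insert_of_notMem haS] at hT; omega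
    obtain ⟨u, hu⟩ : ∃ u, σ a = u := ⟨_, rfl⟩
    have hua : u ≠ a := hu ▸ hau
    have huS : u ∈ S := by
      have := (hST a).2 (by simp)
      rw [hu] at this
      exact (Finset.mem_insert.1 this).resolve_left hua
    obtain ⟨w, hw⟩ : ∃ w, σ w = a := σ.surjective a
    have hwa : w ≠ a := by rintro rfl; exact hau hw
    have hwS : w ∈ S := by
      have := (hST w).1 (by rw [hw]; simp)
      exact (Finset.mem_insert.1 this).resolve_left hwa
    have hSne : S.Nonempty := ⟨u, huS⟩
    have hzS : ∀ z ∈ S, (σ z ∈ S ↔ z ≠ w) := by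
      intro z hz
      constructor
      · rintro h rfl
        rw [hw] at h; exact haS h
      · intro h
        have h2 := (hST z).2 (by simp [hz])
        refine (Finset.mem_insert.1 h2).resolve_left fun h3 => h (σ.injective (h3.trans hw.symm))
    by_cases hm : m = 1
    · -- base case
      subst hm
      obtain ⟨v, rfl⟩ := Finset.card_eq_one.1 hcard
      simp only [Finset.mem_singleton] at huS hwS
      subst huS; subst hwS
      have hsw : σ = swap a w := by
        ext x
        by_cases h1 : x = a
        · subst h1; simp [hu]
        · by_cases h2 : x = w
          · subst h2; simp [hw]
          · rw [swap_apply_of_ne_of_ne h1 h2, hσ x (by simp [h1, h2])]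
      rw [Finset.sum_pair hua.symm, hsw]
      have e1 : ({a, w} : Finset α).erase a = {w} := by
        ext x; simp; rintro rfl; exact hua
      have e2 : ({a, w} : Finset α).erase w = {a} := by
        ext x; simp; constructor
        · rintro ⟨h, h'⟩; tauto
        · rintro rfl; exact ⟨hua.symm, Or.inl rfl⟩
      rw [e1, e2, NN_pair hua.symm, Finset.pair_comm, swap_comm, NN_pair hua]
      simp
    · have hm2 : 2 ≤ m := by
        have := hSne.card_pos; omega
      have hne : ∀ f, f ∈ S → (S.erase f).Nonempty := by
        intro f hf
        rw [← Finset.card_pos, Finset.card_erase_of_mem hf]; omega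
      have hex : ∀ f, f ∈ S → f ≠ a := fun f hf h => haS (h ▸ hf)
      let τ : α → Perm α := fun z => swap a (σ z) * (σ * swap a z)
      -- the f = a term
      rw [Finset.sum_insert haS, Finset.erase_insert haS, NN_left' haS haS hSne, hu, if_pos huS]
      -- the other terms
      have hother : ∑ f ∈ S, NN (insert a S) ((insert a S).erase f) σ =
          ∑ z ∈ S.erase w, ∑ f ∈ S.erase z, NN S (S.erase f) (τ z) := by
        have h1 : ∀ f ∈ S, NN (insert a S) ((insert a S).erase f) σ =
            ∑ z ∈ S, if z ≠ w ∧ f ≠ z then NN S (S.erase f) (τ z) else 0 := by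
          intro f hf
          rw [Finset.erase_insert_of_ne (hex f hf).symm,
            NN_both haS (by simp [haS]) hSne (hne f hf)]
          rw [← Finset.sum_subset (Finset.erase_subset f S)]
          · refine Finset.sum_congr rfl fun z hz => ?_
            have hz' := Finset.mem_erase.1 hz
            simp only [hzS z hz'.2, hz'.1.symm, ne_eq, not_false_eq_true, and_true]
            rfl
          · intro x hx hx'
            have : f = x := by
              by_contra h; exact hx' (Finset.mem_erase.2 ⟨fun h' => h h'.symm, hx⟩)
            simp [this]
        rw [Finset.sum_congr rfl h1, Finset.sum_comm,
          ← Finset.sum_subset (Finset.erase_subset w S)]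
        · refine Finset.sum_congr rfl fun z hz => ?_
          have hz' := Finset.mem_erase.1 hz
          rw [← Finset.sum_subset (Finset.erase_subset z S)]
          · refine Finset.sum_congr rfl fun f hf => ?_
            have hf' := Finset.mem_erase.1 hf
            rw [if_pos ⟨hz'.1, hf'.1⟩]
          · intro x hx hx'
            have : x = z := by
              by_contra h; exact hx' (Finset.mem_erase.2 ⟨h, hx⟩)
            simp [this]
        · intro x hx hx'
          have : x = w := by
            by_contra h; exact hx' (Finset.mem_erase.2 ⟨h, hx⟩)
          simp [this]
      have hih : ∀ z ∈ S.erase w, ∑ f ∈ S.erase z, NN S (S.erase f) (τ z) +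
          NN S (S.erase z) (τ z) = 2 * (m - 2).factorial := by
        intro z hz
        obtain ⟨hzw, hz⟩ := Finset.mem_erase.1 hz
        have hza := hex z hz
        have hσza : σ z ≠ a := fun h => hex _ ((hzS z hz).2 hzw) h
        rw [Finset.sum_erase_add _ _ hz]
        apply ih S hcard
        · intro x hx
          by_cases hxa : x = a
          · subst hxa; simp [τ]
          · have hxz : x ≠ z := fun h => hx (h ▸ hz)
            have : σ x = x := hσ x (by simp [hx, hxa])
            have hxσ : x ≠ σ z := fun h => hx (h ▸ (hzS z hz).2 hzw)
            simp only [τ, Perm.mul_apply]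
            rw [swap_apply_of_ne_of_ne hxa hxz, this, swap_apply_of_ne_of_ne hxa hxσ]
        · simp [τ, Perm.sign_mul, Perm.sign_swap hza.symm, Perm.sign_swap hσza.symm, hs]
      have hstar : NN S S (swap a u * σ) = ∑ z ∈ S.erase w, NN S (S.erase z) (τ z) := by
        have hL : NN S S (swap a u * σ) = ∑ z ∈ S, if z ≠ w ∧ z ≠ u then
            NN (S.erase z) (S.erase z) (swap z u * τ z) else 0 := by
          have := NN_both (a := u) (Finset.notMem_erase u S) (Finset.notMem_erase u S)
            (hne u huS) (hne u huS) (swap a u * σ)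
          rw [Finset.insert_erase huS] at this
          rw [this, ← Finset.sum_subset (Finset.erase_subset u S)]
          · refine Finset.sum_congr rfl fun z hz => ?_
            obtain ⟨hzu, hz⟩ := Finset.mem_erase.1 hz
            by_cases hzw : z = w
            · subst hzw; simp [hw]
            · have hσS := (hzS z hz).2 hzw
              have hσa := hex _ hσS
              have hσu : σ z ≠ u := fun h => hex z hz (σ.injective (h.trans hu.symm))
              have e : (swap a u * σ) z = σ z := by
                rw [Perm.mul_apply, swap_apply_of_ne_of_ne hσa hσu]
              rw [e, if_pos (Finset.mem_erase.2 ⟨hσu, hσS⟩), if_pos ⟨hzw, hzu⟩,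
                ← NN_conj _ _ (swap u z), erase_map S huS hz,
                key_alg hu hua (hex z hz) hσa]
          · intro x hx hx'
            have : x = u := by
              by_contra h; exact hx' (Finset.mem_erase.2 ⟨h, hx⟩)
            simp [this]
        rw [hL, ← Finset.sum_subset (Finset.erase_subset w S)]
        · refine Finset.sum_congr rfl fun z hz => ?_
          obtain ⟨hzw, hz⟩ := Finset.mem_erase.1 hz
          have hσS := (hzS z hz).2 hzw
          have hσu : u ≠ σ z := fun h => hex z hz (σ.injective (h.symm.trans hu.symm))
          have e : τ z z = u := by
            simp only [τ, Perm.mul_apply, swap_apply_right, hu]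
            exact swap_apply_of_ne_of_ne hua hσu
          have := NN_left' (a := z) (Finset.notMem_erase z S) (Finset.notMem_erase z S)
            (hne z hz) (τ z)
          rw [Finset.insert_erase hz] at this
          rw [this, e]
          by_cases hzu : z = u
          · simp [hzu]
          · rw [if_pos ⟨hzw, hzu⟩, if_pos (Finset.mem_erase.2 ⟨fun h => hzu h.symm, huS⟩)]
        · intro x hx hx'
          have : x = w := by
            by_contra h; exact hx' (Finset.mem_erase.2 ⟨h, hx⟩)
          simp [this]
      rw [hother, hstar, add_comm, ← Finset.sum_add_distrib, Finset.sum_congr rfl hih,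
        Finset.sum_const, Finset.card_erase_of_mem hwS, hcard, smul_eq_mul]
      obtain ⟨r, rfl⟩ : ∃ r, m = r + 2 := ⟨m - 2, by omega⟩
      have : r + 2 + 1 - 2 = r + 1 := by omega
      rw [this, Nat.factorial_succ]
      simp only [Nat.add_sub_cancel]
      have : r + 2 - 1 = r + 1 := by omega
      rw [this]; ring

/-- number of cycles, fixed points included -/
def cyc (σ : Perm α) : ℕ := σ.partition.parts.card

lemma cyc_eq (σ : Perm α) :
    cyc σ + σ.support.card = σ.cycleType.card + Fintype.card α := by
  have := σ.support.card_le_univ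
  unfold cyc
  rw [Perm.parts_partition, Multiset.card_add, Multiset.card_replicate]
  omega

lemma cyc_conj (g σ : Perm α) : cyc (g * σ * g⁻¹) = cyc σ := by
  unfold cyc
  have : σ.partition = (g * σ * g⁻¹).partition :=
    Perm.partition_eq_of_isConj.1 (isConj_iff.2 ⟨g, rfl⟩)
  rw [← this]

lemma FC_of_isCycle {c : Perm α} (hc : c.IsCycle) : c ∈ FC c.support := by
  refine mem_FC.2 ⟨?_, fun x hx => by simpa using hx⟩
  convert hc.isCycleOn using 1
  ext x; simp

lemma FC_isCycle {S : Finset α} {c : Perm α} (hS : S.Nontrivial) (hc : c ∈ FC S) :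
    c.IsCycle ∧ c.support = S := by
  have h := mem_FC.1 hc
  have hS' : (S : Set α).Nontrivial := hS
  constructor
  · refine Perm.isCycle_iff_exists_isCycleOn.2 ⟨S, hS', h.1, ?_⟩
    intro x hx
    by_contra hxS
    exact hx (h.2 x hxS)
  · ext x
    rw [Perm.mem_support]
    constructor
    · intro hx; by_contra hxS; exact hx (h.2 x hxS)
    · intro hx; exact h.1.apply_ne hS' hx

lemma cyc_merge {π : Perm α} {a y : α} (ha : π a = a) (hy : y ≠ a) :
    cyc (swap a y * π) + 1 = cyc π := by
  by_cases hπy : π y = y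
  · have hd : Perm.Disjoint (swap a y) π := by
      intro x
      by_cases h1 : x = a
      · subst h1; right; exact ha
      · by_cases h2 : x = y
        · subst h2; right; exact hπy
        · left; exact swap_apply_of_ne_of_ne h1 h2
    have e1 := cyc_eq (swap a y * π)
    have e2 := cyc_eq π
    rw [hd.cycleType_mul, hd.card_support_mul, Perm.card_support_swap hy.symm,
      Multiset.card_add, (Perm.isCycle_swap hy.symm).cycleType, Multiset.card_singleton] at e1
    omega
  · have hc := Perm.isCycle_cycleOf π hπy
    set c := π.cycleOf y with hcdef
    have hmem : c ∈ π.cycleFactorsFinset := by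
      rw [hcdef, Perm.cycleOf_mem_cycleFactorsFinset_iff, Perm.mem_support]; exact hπy
    have hd := Perm.disjoint_mul_inv_of_mem_cycleFactorsFinset hmem
    set r := π * c⁻¹ with hr
    have hac : a ∉ c.support := by
      intro h
      have := Perm.mem_cycleFactorsFinset_support_le hmem h
      rw [Perm.mem_support] at this; exact this ha
    have hca : c a = a := by simpa using hac
    have hra : r a = a := by
      have : c⁻¹ a = a := by rw [Perm.inv_eq_iff_eq, hca]
      rw [hr, Perm.mul_apply, this, ha]
    have hys : y ∈ c.support := by
      rw [Perm.mem_support, hcdef, Perm.cycleOf_apply_self]; exact hπy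
    have hg := FC_insert_mem hac hys (FC_of_isCycle hc)
    have hnt : (insert a c.support).Nontrivial :=
      ⟨a, by simp, y, by simp only [Finset.coe_insert]; exact Or.inr hys, hy.symm⟩
    obtain ⟨g1, g2⟩ := FC_isCycle hnt hg
    have hπ : π = c * r := by rw [hd.symm.commute.eq, hr]; simp
    have hd2 : Perm.Disjoint (swap a y * c) r := by
      rw [Perm.disjoint_iff_disjoint_support, g2, Finset.disjoint_insert_left]
      exact ⟨by simpa using hra, Perm.disjoint_iff_disjoint_support.1 hd.symm⟩
    have e1 := cyc_eq (swap a y * π)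
    have e2 := cyc_eq π
    rw [hπ, ← mul_assoc] at e1
    rw [hπ] at e2
    rw [hd2.cycleType_mul, hd2.card_support_mul, g1.cycleType, g2,
      Finset.card_insert_of_notMem hac, Multiset.card_add, Multiset.card_singleton] at e1
    rw [hd.symm.cycleType_mul, hd.symm.card_support_mul, hc.cycleType, Multiset.card_add,
      Multiset.card_singleton] at e2
    rw [hπ, ← mul_assoc]
    omega

lemma sign_eq (σ : Perm α) (h : (cyc σ + Fintype.card α) % 2 = 1) : Perm.sign σ = -1 := by
  rw [Perm.sign_of_cycleType, Perm.sum_cycleType]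
  have := cyc_eq σ
  have h2 := σ.support.card_le_univ
  apply Odd.neg_one_pow
  rw [Nat.odd_iff]
  omega

lemma mem_FC_univ {n : ℕ} (hn : 1 ≤ n) (σ : Perm (Fin n)) :
    σ ∈ FC (univ : Finset (Fin n)) ↔ IsFullCycle σ := by
  rcases Nat.lt_or_ge n 2 with h | h
  · have : n = 1 := by omega
    subst this
    have h1 : σ = 1 := Subsingleton.elim _ _
    subst h1
    refine iff_of_true (mem_FC.2 ⟨Perm.isCycleOn_of_subsingleton _ _, by simp⟩) ?_
    unfold IsFullCycle
    rw [Perm.parts_partition]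
    simp
  · unfold IsFullCycle
    constructor
    · intro hσ
      have hnt : (univ : Finset (Fin n)).Nontrivial := by
        rw [← Finset.one_lt_card_iff_nontrivial]; simp; omega
      obtain ⟨h1, h2⟩ := FC_isCycle hnt hσ
      rw [Perm.parts_partition, h1.cycleType, h2]
      simp
    · intro hσ
      have h1 : σ.cycleType = {n} := by
        rw [← Perm.filter_parts_partition_eq_cycleType, hσ]
        simp [Multiset.filter_singleton, h]
      have h2 : σ.IsCycle := by rw [← Perm.card_cycleType_eq_one, h1]; simp
      have h3 : σ.support.card = n := by rw [← Perm.sum_cycleType, h1]; simp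
      have h4 : σ.support = univ := by
        rw [← Finset.card_eq_iff_eq_univ]; simpa using h3
      rw [← h4]; exact FC_of_isCycle h2

lemma finRotate_full {n : ℕ} (hn : 1 ≤ n) : IsFullCycle (finRotate n) := by
  rcases Nat.lt_or_ge n 2 with h | h
  · have : n = 1 := by omega
    subst this
    have h1 : finRotate 1 = 1 := Subsingleton.elim _ _
    rw [h1]
    unfold IsFullCycle
    rw [Perm.parts_partition]
    simp
  · unfold IsFullCycle
    rw [Perm.parts_partition, cycleType_finRotate_of_le h, support_finRotate_of_le h]
    simp

/-- The embedding of `S_n` into `S_{n+1}` fixing the last point. -/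
def ext {n : ℕ} (c : Perm (Fin n)) : Perm (Fin (n + 1)) :=
  c.extendDomain (finSuccAboveEquiv (Fin.last n))

lemma cyc_ext {n : ℕ} (c : Perm (Fin n)) : cyc (ext c) = cyc c + 1 := by
  have e1 := cyc_eq (ext c)
  have e2 := cyc_eq c
  rw [← Perm.sum_cycleType] at e1 e2
  simp only [ext, Perm.cycleType_extendDomain, Fintype.card_fin] at *
  omega

lemma ext_mul {n : ℕ} (c d : Perm (Fin n)) : ext c * ext d = ext (c * d) :=
  Perm.extendDomain_mul _ _ _

lemma ext_inj {n : ℕ} : Function.Injective (ext (n := n)) :=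
  Perm.extendDomainHom_injective _

lemma ext_last {n : ℕ} (c : Perm (Fin n)) : ext c (Fin.last n) = Fin.last n :=
  Perm.extendDomain_apply_not_subtype _ _ (by simp)

lemma FC_ext {n : ℕ} (hn : 1 ≤ n) :
    FC ((univ : Finset (Fin (n + 1))).erase (Fin.last n)) =
      (FC (univ : Finset (Fin n))).image ext := by
  symm
  apply Finset.eq_of_subset_of_card_le
  · intro σ hσ
    obtain ⟨c, hc, rfl⟩ := Finset.mem_image.1 hσ
    refine mem_FC.2 ⟨?_, ?_⟩
    · have := (mem_FC.1 hc).1.extendDomain (finSuccAboveEquiv (Fin.last n))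
      have key : (((univ : Finset (Fin (n + 1))).erase (Fin.last n) : Finset _) : Set (Fin (n + 1)))
          = ((↑) ∘ (finSuccAboveEquiv (Fin.last n)) '' ((univ : Finset (Fin n)) : Set (Fin n))) := by
        refine Set.ext fun x => ?_
        constructor
        · intro hx
          have hx : x ≠ Fin.last n := by simpa using hx
          exact ⟨(finSuccAboveEquiv (Fin.last n)).symm ⟨x, hx⟩, by simp, by
            rw [Function.comp_apply, Equiv.apply_symm_apply]⟩
        · rintro ⟨y, -, rfl⟩
          have := (finSuccAboveEquiv (Fin.last n) y).2
          simpa using this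
      rw [key]; exact this
    · intro x hx
      have : x = Fin.last n := by simpa using hx
      rw [this, ext_last]
  · rw [Finset.card_image_of_injective _ ext_inj, FC_card, FC_card]
    · simp
    · exact ⟨⟨0, hn⟩, by simp⟩
    · exact ⟨Fin.castSucc ⟨0, hn⟩, Finset.mem_erase.2 ⟨(Fin.castSucc_lt_last _).ne, Finset.mem_univ _⟩⟩

/-- weighted count of pairs -/
noncomputable def MM (U V : Finset α) (k : ℕ) : ℕ :=
  ∑ ζ ∈ FC U, ∑ s ∈ FC V, if cyc (ζ * s) = k then 1 else 0

lemma sum_NN (U V : Finset α) (k : ℕ) :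
    ∑ σ : Perm α with cyc σ = k, NN U V σ = MM U V k := by
  unfold NN MM
  rw [Finset.sum_comm]
  refine Finset.sum_congr rfl fun ζ _ => ?_
  rw [Finset.sum_comm]
  refine Finset.sum_congr rfl fun s _ => ?_
  rw [Finset.sum_ite_eq]
  simp

lemma MM_conj (U V : Finset α) (g : Perm α) (k : ℕ) :
    MM (U.map g.toEmbedding) (V.map g.toEmbedding) k = MM U V k := by
  unfold MM
  rw [FC_sum_conj]
  refine Finset.sum_congr rfl fun c _ => ?_
  rw [FC_sum_conj]
  refine Finset.sum_congr rfl fun s _ => ?_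
  have : g * c * g⁻¹ * (g * s * g⁻¹) = g * (c * s) * g⁻¹ := by group
  rw [this, cyc_conj]

lemma MM_erase (f a : α) (k : ℕ) : MM univ (univ.erase f) k = MM univ (univ.erase a) k := by
  have h := MM_conj univ (univ.erase a) (swap a f) k
  rw [erase_map univ (Finset.mem_univ a) (Finset.mem_univ f)] at h
  have hm : (univ : Finset α).map (swap a f).toEmbedding = univ := by ext x; simp
  rwa [hm] at h

lemma MM_total (n k : ℕ) (hpar : k % 2 = n % 2) :
    (n + 1) * MM (univ : Finset (Fin (n + 1))) (univ.erase (Fin.last n)) k =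
      (univ.filter fun σ : Perm (Fin (n + 1)) => cyc σ = k).card * (2 * (n - 1).factorial) := by
  have h : ∑ σ : Perm (Fin (n + 1)) with cyc σ = k, ∑ f : Fin (n + 1),
      NN univ (univ.erase f) σ =
      (univ.filter fun σ : Perm (Fin (n + 1)) => cyc σ = k).card * (2 * (n - 1).factorial) := by
    rw [Finset.sum_const_nat]
    intro σ hσ
    have hσ : cyc σ = k := by simpa using hσ
    have := A_const (n + 1) (univ : Finset (Fin (n + 1))) (by simp) σ (by simp)
      (sign_eq σ (by rw [hσ, Fintype.card_fin]; omega))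
    rw [this]; rfl
  rw [← h, Finset.sum_comm]
  simp only [sum_NN]
  rw [Finset.sum_congr rfl fun f _ => MM_erase f (Fin.last n) k]
  simp

lemma MM_step (n k : ℕ) (hn : 1 ≤ n) :
    MM (univ : Finset (Fin (n + 1))) (univ.erase (Fin.last n)) k =
      n * MM (univ : Finset (Fin n)) univ k := by
  have hne : ((univ : Finset (Fin (n + 1))).erase (Fin.last n)).Nonempty :=
    ⟨Fin.castSucc ⟨0, hn⟩, Finset.mem_erase.2 ⟨(Fin.castSucc_lt_last _).ne, Finset.mem_univ _⟩⟩
  unfold MM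
  have h := FC_sum_left (Finset.notMem_erase (Fin.last n) univ) hne
    (fun ζ => ∑ s ∈ FC (univ.erase (Fin.last n)), if cyc (ζ * s) = k then 1 else 0)
  rw [Finset.insert_erase (Finset.mem_univ _)] at h
  rw [h, Finset.sum_const_nat (m := ∑ ζ ∈ FC (univ : Finset (Fin n)), ∑ s ∈ FC univ,
    if cyc (ζ * s) = k then 1 else 0)]
  · simp
  · intro y hy
    have hy : y ≠ Fin.last n := (Finset.mem_erase.1 hy).1
    rw [FC_ext hn, Finset.sum_image ext_inj.injOn]
    refine Finset.sum_congr rfl fun c _ => ?_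
    rw [Finset.sum_image ext_inj.injOn]
    refine Finset.sum_congr rfl fun s _ => ?_
    rw [mul_assoc, ext_mul]
    have h1 := cyc_merge (ext_last (c * s)) hy
    rw [cyc_ext] at h1
    have h2 : cyc (swap (Fin.last n) y * ext (c * s)) = cyc (c * s) := by omega
    rw [h2]

lemma MM_last (n k : ℕ) (hn : 1 ≤ n) :
    MM (univ : Finset (Fin n)) univ k = (n - 1).factorial *
      (univ.filter fun s : Perm (Fin n) => IsFullCycle s ∧ cyc (finRotate n * s) = k).card := by
  unfold MM
  have hne : (univ : Finset (Fin n)).Nonempty := ⟨⟨0, hn⟩, by simp⟩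
  have hc := FC_card _ hne
  rw [Finset.card_fin] at hc
  rw [← hc]
  apply Finset.sum_const_nat
  intro c hcm
  have h1 : (finRotate n).partition = c.partition := by
    apply Nat.Partition.ext
    have h2 := finRotate_full hn
    have h3 := (mem_FC_univ hn c).1 hcm
    unfold IsFullCycle at h2 h3
    rw [h2, h3]
  obtain ⟨g, hg⟩ := isConj_iff.1 (Perm.partition_eq_of_isConj.2 h1)
  have hm : (univ : Finset (Fin n)).map g.toEmbedding = univ := by ext x; simp
  have := FC_sum_conj (univ : Finset (Fin n)) g (fun s => if cyc (c * s) = k then 1 else 0)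
  rw [hm] at this
  rw [this, Finset.card_filter, ← Finset.sum_subset (Finset.subset_univ (FC univ))]
  · refine Finset.sum_congr rfl fun s hs => ?_
    have e : c * (g * s * g⁻¹) = g * (finRotate n * s) * g⁻¹ := by rw [← hg]; group
    rw [e, cyc_conj]
    simp [(mem_FC_univ hn s).1 hs]
  · intro s _ hs
    rw [mem_FC_univ hn] at hs
    simp [hs]

end ZS

/-- the Zagier–Stanley formula for `(1 2 ⋯ n)·s`. -/
theorem stmt1 (n k : ℕ) (hn : 1 ≤ n) (hk1 : 1 ≤ k) (hkn : k ≤ n) (hpar : k % 2 = n % 2) :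
    ((univ.filter fun s : Equiv.Perm (Fin n) =>
        IsFullCycle s ∧ (finRotate n * s).partition.parts.card = k).card : ℚ)
      = 2 / ((n : ℚ) * ((n : ℚ) + 1)) *
          ((univ.filter fun σ : Equiv.Perm (Fin (n + 1)) =>
            σ.partition.parts.card = k).card : ℚ) := by
  have h1 := ZS.MM_total n k hpar
  rw [ZS.MM_step n k hn, ZS.MM_last n k hn] at h1
  unfold ZS.cyc at h1
  have hf : ((n - 1).factorial : ℚ) ≠ 0 := by exact_mod_cast Nat.factorial_ne_zero _
  have hn0 : (n : ℚ) ≠ 0 := by exact_mod_cast (by omega : n ≠ 0)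
  have hn1 : (n : ℚ) + 1 ≠ 0 := by positivity
  have h2 := congrArg (Nat.cast (R := ℚ)) h1
  push_cast at h2
  rw [div_mul_eq_mul_div, eq_div_iff (mul_ne_zero hn0 hn1)]
  apply mul_left_cancel₀ hf
  linear_combination h2
end

section
/- Let n ≥ 1 and let k be an integer with 1 ≤ k ≤ n and k having the same parity as n. Then the number of ordered pairs (c₁,c₂) of n-cycles of [n] such that the product c₁c₂ has exactly k cycles equals (2(n−1)!/(n(n+1))) · C(n+1, k). -/
open Equiv Finset

namespace ZS
set_option linter.unusedSectionVars false
set_option linter.unusedVariables false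

variable {α : Type*} [DecidableEq α] [Fintype α]

/-- number of cycles, fixed points included -/
def ncyc (g : Equiv.Perm α) : ℕ := g.partition.parts.card

theorem ncyc_eq (g : Equiv.Perm α) :
    ncyc g = g.cycleType.card + (Fintype.card α - g.support.card) := by
  simp [ncyc, Equiv.Perm.parts_partition]

/-- remove `p` from its cycle -/
def del (p : α) (g : Equiv.Perm α) : Equiv.Perm α := Equiv.swap p (g p) * g

theorem del_apply_self (p : α) (g : Equiv.Perm α) : del p g p = p := by simp [del]

theorem ncyc_del (p : α) (g : Equiv.Perm α) (h : g p ≠ p) : ncyc (del p g) = ncyc g + 1 := by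
  obtain ⟨c, r, hg, hdis, hc, hcp⟩ : ∃ c r : Equiv.Perm α, g = c * r ∧ c.Disjoint r ∧ c.IsCycle ∧
      c p = g p := by
    refine ⟨g.cycleOf p, g * (g.cycleOf p)⁻¹, ?_, ?_, Equiv.Perm.isCycle_cycleOf g h,
      Equiv.Perm.cycleOf_apply_self g p⟩
    · have := (Equiv.Perm.disjoint_mul_inv_of_mem_cycleFactorsFinset
        (Equiv.Perm.cycleOf_mem_cycleFactorsFinset_iff.2 (Equiv.Perm.mem_support.2 h))).commute.eq
      rw [← this]; simp
    · exact (Equiv.Perm.disjoint_mul_inv_of_mem_cycleFactorsFinset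
        (Equiv.Perm.cycleOf_mem_cycleFactorsFinset_iff.2 (Equiv.Perm.mem_support.2 h))).symm
  have hcp' : c p ≠ p := by rw [hcp]; exact h
  have hdel : del p g = (Equiv.swap p (c p) * c) * r := by
    rw [del, ← hcp, mul_assoc, ← hg]
  have hsg : g.support.card = c.support.card + r.support.card := by
    rw [hg]; exact hdis.card_support_mul
  have htg : g.cycleType = c.cycleType + r.cycleType := by
    rw [hg]; exact hdis.cycleType_mul
  have hle : g.support.card ≤ Fintype.card α := Finset.card_le_univ _
  rw [ncyc_eq, ncyc_eq, hsg, htg, hc.cycleType]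
  by_cases h2 : c (c p) = p
  · have hcs : c = Equiv.swap p (c p) := hc.eq_swap_of_apply_apply_eq_self hcp' h2
    have h1 : Equiv.swap p (c p) * c = 1 := by
      nth_rewrite 2 [hcs]; simp
    have h3 : c.support.card = 2 := by rw [hcs]; exact Equiv.Perm.card_support_swap hcp'.symm
    rw [hdel, h1, one_mul]
    simp only [Multiset.card_add, Multiset.card_singleton]
    omega
  · have hc2 := hc.swap_mul hcp' h2
    have hs := Equiv.Perm.support_swap_mul_eq c p h2
    have hd2 : (Equiv.swap p (c p) * c).Disjoint r := by
      rw [Equiv.Perm.disjoint_iff_disjoint_support] at hdis ⊢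
      rw [hs]
      exact Finset.disjoint_of_subset_left Finset.sdiff_subset hdis
    have h3 : (Equiv.swap p (c p) * c).support.card + 1 = c.support.card := by
      rw [hs, Finset.sdiff_singleton_eq_erase]
      exact Finset.card_erase_add_one (Equiv.Perm.mem_support.2 hcp')
    rw [hdel, hd2.cycleType_mul, hd2.card_support_mul, hc2.cycleType]
    simp only [Multiset.card_add, Multiset.card_singleton]
    omega

/-- `g` is a full cycle on `S`, identity elsewhere. -/
def Full (S : Finset α) (g : Equiv.Perm α) : Prop :=
  (∀ x, x ∉ S → g x = x) ∧ ncyc g + S.card = Fintype.card α + 1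

theorem Full.ne {S : Finset α} {g : Equiv.Perm α} (h : Full S g) {q : α} (hq : q ∈ S)
    (hS : 2 ≤ S.card) : g q ≠ q := by
  intro hf
  obtain ⟨h1, h2⟩ := h
  have hsub : g.support ⊆ S.erase q := by
    intro x hx
    rw [Equiv.Perm.mem_support] at hx
    refine Finset.mem_erase.2 ⟨?_, ?_⟩
    · rintro rfl; exact hx hf
    · by_contra hh; exact hx (h1 x hh)
  have hc := Finset.card_le_card hsub
  have he := Finset.card_erase_add_one hq
  rw [ncyc_eq] at h2
  have hle : S.card ≤ Fintype.card α := Finset.card_le_univ _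
  by_cases h0 : g = 1
  · subst h0; simp at h2; omega
  · have : 0 < g.cycleType.card := by
      rw [Equiv.Perm.card_cycleType_pos]; exact h0
    omega

theorem mapsTo_of_fix {S : Finset α} {g : Equiv.Perm α} (h : ∀ x, x ∉ S → g x = x) {x : α}
    (hx : x ∈ S) : g x ∈ S := by
  by_contra hh
  have := h _ hh
  have := g.injective this
  rw [this] at hh; exact hh hx

theorem full_iff {S : Finset α} (g : Equiv.Perm α) {q : α} (hq : q ∈ S) (hS : 2 ≤ S.card) :
    Full S g ↔ g q ∈ S.erase q ∧ Full (S.erase q) (del q g) := by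
  have he := Finset.card_erase_add_one hq
  constructor
  · intro h
    have hne := h.ne hq hS
    have hm := mapsTo_of_fix h.1 hq
    refine ⟨Finset.mem_erase.2 ⟨hne, hm⟩, ?_, ?_⟩
    · intro x hx
      by_cases hxq : x = q
      · rw [hxq]; exact del_apply_self _ _
      · have hxS : x ∉ S := fun hh => hx (Finset.mem_erase.2 ⟨hxq, hh⟩)
        simp only [del, Equiv.Perm.mul_apply, h.1 x hxS]
        apply Equiv.swap_apply_of_ne_of_ne hxq
        rintro rfl; exact hxS hm
    · rw [ncyc_del _ _ hne]; have := h.2; omega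
  · rintro ⟨hm, h⟩
    rw [Finset.mem_erase] at hm
    refine ⟨?_, ?_⟩
    · intro x hx
      have := h.1 x (fun hh => hx (Finset.mem_of_mem_erase hh))
      simp only [del, Equiv.Perm.mul_apply] at this
      have h2 := (Equiv.swap_apply_eq_iff).1 this
      rw [h2]
      apply Equiv.swap_apply_of_ne_of_ne
      · rintro rfl; exact hx hq
      · rintro rfl; exact hx hm.2
    · have := h.2; rw [ncyc_del _ _ hm.1] at this; omega

open Classical in
/-- number of `c` with `c` and `σ c` both full cycles on `S` -/
noncomputable def A (S : Finset α) (σ : Equiv.Perm α) : ℕ :=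
  (Finset.univ.filter fun c : Equiv.Perm α => Full S c ∧ Full S (σ * c)).card

theorem A_inv (S : Finset α) (σ : Equiv.Perm α) : A S σ⁻¹ = A S σ := by
  classical
  unfold A
  refine Finset.card_nbij' (fun c => σ⁻¹ * c) (fun c => σ * c) ?_ ?_ ?_ ?_
  · intro c hc; simp at hc ⊢; exact hc.symm
  · intro c hc; simp at hc ⊢; exact hc.symm
  · intro c hc; simp
  · intro c hc; simp

theorem ncyc_conj (g t : Equiv.Perm α) : ncyc (t * g * t⁻¹) = ncyc g := by
  rw [ncyc_eq, ncyc_eq, Equiv.Perm.cycleType_conj, Equiv.Perm.card_support_conj]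

theorem full_conj {S : Finset α} {g : Equiv.Perm α} (t : Equiv.Perm α) (h : Full S g) :
    Full (S.map t.toEmbedding) (t * g * t⁻¹) := by
  refine ⟨?_, ?_⟩
  · intro x hx
    have : t⁻¹ x ∉ S := by
      intro hh; apply hx; rw [Finset.mem_map]; exact ⟨_, hh, by simp⟩
    rw [Equiv.Perm.mul_apply, Equiv.Perm.mul_apply, h.1 _ this]; simp
  · rw [ncyc_conj, Finset.card_map]; exact h.2

theorem full_conj_iff {S : Finset α} {g : Equiv.Perm α} (t : Equiv.Perm α) :
    Full (S.map t.toEmbedding) (t * g * t⁻¹) ↔ Full S g := by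
  refine ⟨fun h => ?_, full_conj t⟩
  have := full_conj t⁻¹ h
  have h2 : (S.map t.toEmbedding).map (t⁻¹ : Equiv.Perm α).toEmbedding = S := by
    rw [Finset.map_map]; ext x; simp [Finset.mem_map]
  rw [h2] at this
  simpa [mul_assoc] using this

theorem A_conj (S : Finset α) (σ t : Equiv.Perm α) :
    A (S.map t.toEmbedding) (t * σ * t⁻¹) = A S σ := by
  classical
  unfold A
  refine Finset.card_nbij' (fun c => t⁻¹ * c * t) (fun c => t * c * t⁻¹) ?_ ?_ ?_ ?_
  · intro c hc
    simp only [Finset.coe_filter, Finset.mem_univ, true_and, Set.mem_ofPred_eq] at hc ⊢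
    rw [← full_conj_iff (S := S) t, ← full_conj_iff (S := S) t]
    simpa [mul_assoc] using hc
  · intro c hc
    simp only [Finset.coe_filter, Finset.mem_univ, true_and, Set.mem_ofPred_eq] at hc ⊢
    rw [← full_conj_iff (S := S) t, ← full_conj_iff (S := S) t] at hc
    simpa [mul_assoc] using hc
  · intro c hc; simp [mul_assoc]
  · intro c hc; simp [mul_assoc]

theorem A_rec {S : Finset α} {σ : Equiv.Perm α} (hσ : ∀ x, x ∉ S → σ x = x) {q : α} (hq : q ∈ S)
    (hS : 2 ≤ S.card) :
    A S σ = ∑ d ∈ S.erase q, if σ d ≠ q then A (S.erase q) (del q (σ * Equiv.swap q d)) else 0 := by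
  classical
  unfold A
  rw [Finset.card_eq_sum_card_fiberwise (f := fun c : Equiv.Perm α => c q) (t := S.erase q)]
  · refine Finset.sum_congr rfl fun d hd => ?_
    have hdd : ∀ c : Equiv.Perm α, c q = d → del q c = Equiv.swap q d * c := by
      rintro c rfl; rfl
    split_ifs with h
    · refine Finset.card_nbij' (fun c => Equiv.swap q d * c) (fun c => Equiv.swap q d * c) ?_ ?_ ?_ ?_
      · intro c hc
        simp only [Finset.coe_filter, Finset.mem_univ, true_and, Set.mem_ofPred_eq,
          Finset.mem_filter] at hc ⊢
        obtain ⟨⟨h1, h2⟩, h3⟩ := hc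
        rw [full_iff _ hq hS] at h1 h2
        rw [hdd c h3] at h1
        refine ⟨h1.2, ?_⟩
        have := h2.2
        simpa [del, h3, mul_assoc] using this
      · intro c hc
        simp only [Finset.coe_filter, Finset.mem_univ, true_and, Set.mem_ofPred_eq,
          Finset.mem_filter] at hc ⊢
        obtain ⟨h1, h2⟩ := hc
        have hcq : c q = q := h1.1 q (by simp)
        have h3 : (Equiv.swap q d * c) q = d := by simp [hcq]
        refine ⟨⟨?_, ?_⟩, h3⟩
        · rw [full_iff _ hq hS, hdd _ h3, h3]
          exact ⟨hd, by simpa using h1⟩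
        · rw [full_iff _ hq hS]
          refine ⟨?_, ?_⟩
          · simp only [Equiv.Perm.mul_apply] at h3 ⊢
            rw [h3]
            exact Finset.mem_erase.2 ⟨h, mapsTo_of_fix hσ (Finset.mem_of_mem_erase hd)⟩
          · simpa [del, hcq, mul_assoc] using h2
      · intro c hc; simp
      · intro c hc; simp
    · push Not at h
      rw [Finset.card_eq_zero, Finset.filter_eq_empty_iff]
      intro c hc h3
      simp only [Finset.mem_univ, true_and, Finset.mem_filter] at hc
      apply hc.2.ne hq hS
      simp [h3, h]
  · intro c hc
    simp only [Finset.coe_filter, Finset.mem_univ, true_and, Set.mem_ofPred_eq] at hc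
    exact ((full_iff _ hq hS).1 hc.1).1

/-- sum over deletions -/
noncomputable def B (S : Finset α) (σ : Equiv.Perm α) : ℕ :=
  ∑ p ∈ S, if σ p ≠ p then A (S.erase p) (del p σ) else 0

theorem del_fix {S : Finset α} {σ : Equiv.Perm α} (hσ : ∀ x, x ∉ S → σ x = x) {q : α}
    (hq : q ∈ S) : ∀ x, x ∉ S.erase q → del q σ x = x := by
  intro x hx
  by_cases hxq : x = q
  · rw [hxq]; exact del_apply_self _ _
  · have hxS : x ∉ S := fun hh => hx (Finset.mem_erase.2 ⟨hxq, hh⟩)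
    simp only [del, Equiv.Perm.mul_apply, hσ x hxS]
    apply Equiv.swap_apply_of_ne_of_ne hxq
    rintro rfl; exact hxS (mapsTo_of_fix hσ hq)

theorem swap_fix {S : Finset α} {σ : Equiv.Perm α} (hσ : ∀ x, x ∉ S → σ x = x) {q d : α}
    (hq : q ∈ S) (hd : d ∈ S) : ∀ x, x ∉ S → (σ * Equiv.swap q d) x = x := by
  intro x hx
  rw [Equiv.Perm.mul_apply, Equiv.swap_apply_of_ne_of_ne, hσ x hx]
  · rintro rfl; exact hx hq
  · rintro rfl; exact hx hd

theorem comm_aux (σ : Equiv.Perm α) {p q d : α} (hpq : p ≠ q) (hpd : p ≠ d) (hdq : d ≠ q)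
    (hp : σ p ≠ q) (hd : σ d ≠ q) :
    del q (del p σ * Equiv.swap q d) = del p (del q (σ * Equiv.swap q d)) := by
  ext x
  have hi := σ.injective
  have := @hi p q
  have := @hi p d
  have := @hi d q
  have := @hi x q
  have := @hi x d
  have := @hi x p
  simp only [del, Equiv.Perm.mul_apply, Equiv.swap_apply_def]
  grind

theorem ncond_aux (σ : Equiv.Perm α) {p q d : α} (hpq : p ≠ q) (hpd : p ≠ d) (hdq : d ≠ q)
    (hp : σ p ≠ q) :
    del q (σ * Equiv.swap q d) p = p ↔ σ p = p := by
  have hi := σ.injective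
  have := @hi p q
  have := @hi p d
  have := @hi d q
  simp only [del, Equiv.Perm.mul_apply, Equiv.swap_apply_def]
  grind

theorem dcond_aux (σ : Equiv.Perm α) {p q d : α} (hpq : p ≠ q) (hp : σ p ≠ q) :
    del p σ d = q ↔ σ d = q := by
  have hi := σ.injective
  have := @hi p q
  have := @hi p d
  have := @hi d q
  simp only [del, Equiv.Perm.mul_apply, Equiv.swap_apply_def]
  grind

theorem del_inv (a : α) (g : Equiv.Perm α) : (del a g)⁻¹ = del a g⁻¹ := by
  have h := Equiv.swap_mul_eq_mul_swap g a (g a)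
  have h2 : g⁻¹ (g a) = a := by simp
  rw [h2] at h
  rw [del, h, mul_inv_rev, Equiv.swap_inv, Equiv.swap_comm, del]

theorem del_conj (p : α) (g t : Equiv.Perm α) :
    t * del p g * t⁻¹ = del (t p) (t * g * t⁻¹) := by
  have h : (t * g * t⁻¹) (t p) = t (g p) := by simp
  rw [del, del, h, Equiv.swap_apply_apply]
  simp [mul_assoc]

theorem psi_aux (σ : Equiv.Perm α) {q d a : α} (ha : σ a = q) (haq : a ≠ q) (hdq : d ≠ q) (hda : d ≠ a) :
    del q (σ * Equiv.swap q d) = del q σ * Equiv.swap a d := by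
  ext x
  have hi := σ.injective
  have := @hi a q
  have := @hi a d
  have := @hi d q
  have := @hi x q
  have := @hi x d
  have := @hi x a
  simp only [del, Equiv.Perm.mul_apply, Equiv.swap_apply_def]
  grind

theorem map_swap_erase {S : Finset α} {a d : α} (ha : a ∈ S) (hd : d ∈ S) :
    (S.erase a).map (Equiv.swap a d).toEmbedding = S.erase d := by
  ext x
  simp only [Finset.mem_map_equiv, Finset.mem_erase, Equiv.symm_swap, Equiv.swap_apply_def]
  grind

theorem A_dterm {S : Finset α} (ρ : Equiv.Perm α) {a d : α} (ha : a ∈ S) (hd : d ∈ S) :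
    A (S.erase d) (del d (ρ * Equiv.swap a d)) = A (S.erase a) (del a (ρ⁻¹ * Equiv.swap a d)) := by
  rw [← A_inv (S.erase a), del_inv, ← map_swap_erase ha hd, ← A_conj (S.erase a) _ (Equiv.swap a d),
    del_conj]
  congr 1
  simp [mul_assoc]

theorem A_aterm {S : Finset α} (σ : Equiv.Perm α) {a q : α} (ha : a ∈ S) (hq : q ∈ S)
    (h : σ a = q) :
    A (S.erase a) (del a σ) = A (S.erase q) (del q σ) := by
  rw [← map_swap_erase ha hq, ← A_conj (S.erase a) _ (Equiv.swap a q)]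
  congr 1
  have h2 : del q σ = (del q σ⁻¹)⁻¹ := by rw [del_inv, inv_inv]
  have h3 : σ⁻¹ q = a := by rw [← h]; simp
  rw [h2, del, del, h3, h, mul_inv_rev, inv_inv, Equiv.swap_inv, Equiv.swap_comm q a]
  simp

theorem B_step {S : Finset α} {σ : Equiv.Perm α} (hσ : ∀ x, x ∉ S → σ x = x) {q a : α}
    (hq : q ∈ S) (ha : a ∈ S) (haq : a ≠ q) (h : σ a = q) (hS : 3 ≤ S.card) :
    B S σ = ∑ d ∈ (S.erase q).erase a, B (S.erase q) (del q (σ * Equiv.swap q d)) := by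
  classical
  have haS : a ∈ S.erase q := Finset.mem_erase.2 ⟨haq, ha⟩
  have hqne : σ q ≠ q := by
    intro hh; exact haq (σ.injective (h.trans hh.symm))
  have hane : σ a ≠ a := by rw [h]; exact haq.symm
  have hρ : ∀ x, x ∉ S.erase q → del q σ x = x := del_fix hσ hq
  have hρi : ∀ x, x ∉ S.erase q → (del q σ)⁻¹ x = x := by
    intro x hx; rw [Equiv.Perm.inv_eq_iff_eq]; exact (hρ x hx).symm
  have hc1 : 2 ≤ (S.erase q).card := by rw [Finset.card_erase_of_mem hq]; omega
  -- left side
  have hL : B S σ = A (S.erase q) (del q σ) + (A (S.erase q) (del q σ) +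
      ∑ p ∈ (S.erase q).erase a, if σ p ≠ p then A (S.erase p) (del p σ) else 0) := by
    rw [B, ← Finset.add_sum_erase _ _ hq, ← Finset.add_sum_erase _ _ haS, if_pos hqne, if_pos hane,
      A_aterm σ ha hq h]
  have hR : ∀ d ∈ (S.erase q).erase a, B (S.erase q) (del q (σ * Equiv.swap q d)) =
      (if del q σ d ≠ a then A ((S.erase q).erase a) (del a (del q σ * Equiv.swap a d)) else 0) +
      ((if (del q σ)⁻¹ d ≠ a then A ((S.erase q).erase a) (del a ((del q σ)⁻¹ * Equiv.swap a d))
        else 0) +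
      ∑ p ∈ ((S.erase q).erase a).erase d, if σ p ≠ p then
        A ((S.erase p).erase q) (del q (del p σ * Equiv.swap q d)) else 0) := by
    intro d hd
    have hd' := hd
    simp only [Finset.mem_erase] at hd'
    obtain ⟨hda, hdq, hdS⟩ := hd'
    rw [B, ← Finset.add_sum_erase _ _ haS, ← Finset.add_sum_erase _ _ hd]
    have hpsi := psi_aux σ h haq hdq hda
    congr 1
    · rw [hpsi]; simp
    congr 1
    · rw [hpsi, A_dterm (del q σ) haS (Finset.mem_of_mem_erase hd)]
      have : (del q σ * Equiv.swap a d) d ≠ d ↔ (del q σ)⁻¹ d ≠ a := by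
        rw [Ne, Ne, Equiv.Perm.inv_eq_iff_eq]; simp [eq_comm]
      simp only [this]
    · refine Finset.sum_congr rfl fun p hp => ?_
      simp only [Finset.mem_erase] at hp
      obtain ⟨hpd, hpa, hpq, hpS⟩ := hp
      have hp1 : σ p ≠ q := by rw [← h]; exact fun hh => hpa (σ.injective hh)
      have hd1 : σ d ≠ q := by rw [← h]; exact fun hh => hda (σ.injective hh)
      rw [comm_aux σ hpq hpd hdq hp1 hd1, Finset.erase_right_comm]
      simp only [Ne, ncond_aux σ hpq hpd hdq hp1]
  rw [hL, Finset.sum_congr rfl hR, Finset.sum_add_distrib, Finset.sum_add_distrib,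
    ← A_rec hρ haS hc1, ← A_rec hρi haS hc1, A_inv]
  congr 2
  rw [Finset.sum_comm' (s := (S.erase q).erase a) (t := fun d => ((S.erase q).erase a).erase d)
    (t' := (S.erase q).erase a) (s' := fun d => ((S.erase q).erase a).erase d)]
  · refine Finset.sum_congr rfl fun p hp => ?_
    simp only [Finset.mem_erase] at hp
    obtain ⟨hpa, hpq, hpS⟩ := hp
    have hp1 : σ p ≠ q := by rw [← h]; exact fun hh => hpa (σ.injective hh)
    split_ifs with hpp
    · have hqp : q ∈ S.erase p := Finset.mem_erase.2 ⟨hpq.symm, hq⟩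
      have hap : a ∈ (S.erase p).erase q := by simp [Finset.mem_erase, haq, hpa.symm, ha, Ne.symm hpa]
      rw [A_rec (del_fix hσ hpS) hqp (by rw [Finset.card_erase_of_mem hpS]; omega),
        ← Finset.add_sum_erase _ _ hap, if_neg (by rw [not_not, dcond_aux σ hpq hp1]; exact h),
        zero_add]
      have hset : ((S.erase p).erase q).erase a = ((S.erase q).erase a).erase p := by
        ext x; simp only [Finset.mem_erase]; tauto
      rw [hset]
      refine Finset.sum_congr rfl fun d hd => ?_
      simp only [Finset.mem_erase] at hd
      rw [if_pos]
      rw [Ne, dcond_aux σ hpq hp1, ← h]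
      exact fun hh => hd.2.1 (σ.injective hh)
    · simp
  · intro x y; simp only [Finset.mem_erase]; tauto

theorem A_singleton (x : α) : A {x} (1 : Equiv.Perm α) = 1 := by
  classical
  unfold A
  rw [Finset.card_eq_one]
  refine ⟨1, ?_⟩
  ext c
  simp only [Finset.mem_filter, Finset.mem_univ, true_and, Finset.mem_singleton, one_mul, and_self]
  constructor
  · intro hc
    ext y
    by_cases hy : y = x
    · subst hy
      have := mapsTo_of_fix hc.1 (Finset.mem_singleton_self y)
      simpa using this
    · exact hc.1 y (by simpa using hy)
  · rintro rfl
    exact ⟨by simp, by simp [ncyc_eq]⟩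

theorem B_odd (n : ℕ) : ∀ (S : Finset α) (σ : Equiv.Perm α), S.card = n + 2 →
    (∀ x, x ∉ S → σ x = x) → Equiv.Perm.sign σ = -1 → B S σ = 2 * n.factorial := by
  induction n with
  | zero =>
    intro S σ hS hσ hs
    obtain ⟨x, y, hxy, rfl⟩ := Finset.card_eq_two.1 hS
    have hσe : σ = Equiv.swap x y := by
      have hx := mapsTo_of_fix hσ (x := x) (by simp)
      have hy := mapsTo_of_fix hσ (x := y) (by simp)
      simp only [Finset.mem_insert, Finset.mem_singleton] at hx hy
      have hinj : σ x = σ y → x = y := fun hh => σ.injective hh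
      have hx1 : σ x = y := by
        by_contra hne
        have hx2 : σ x = x := by tauto
        have hy2 : σ y = y := by grind
        have : σ = 1 := by
          ext z
          by_cases hz : z = x
          · rw [hz]; exact hx2
          by_cases hz' : z = y
          · rw [hz']; exact hy2
          · exact hσ z (by simp [hz, hz'])
        rw [this] at hs
        simp at hs
      have hy1 : σ y = x := by grind
      ext z
      by_cases hz : z = x
      · rw [hz]; simp [hx1]
      by_cases hz' : z = y
      · rw [hz']; simp [hy1]
      · rw [hσ z (by simp [hz, hz']), Equiv.swap_apply_of_ne_of_ne hz hz']
    subst hσe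
    have e1 : ({x, y} : Finset α).erase x = {y} := by ext z; simp; grind
    have e2 : ({x, y} : Finset α).erase y = {x} := by ext z; simp; grind
    rw [B, Finset.sum_pair hxy, e1, e2]
    simp [del, Equiv.swap_comm y x, A_singleton, hxy, hxy.symm]
  | succ n ih =>
    intro S σ hS hσ hs
    obtain ⟨a, ha⟩ : ∃ a, σ a ≠ a := by
      by_contra! hh
      have : σ = 1 := by ext z; exact hh z
      rw [this] at hs
      simp at hs
    have haS : a ∈ S := by by_contra hh; exact ha (hσ a hh)
    have hqS := mapsTo_of_fix hσ haS
    have hc1 : (S.erase (σ a)).card = n + 2 := by rw [Finset.card_erase_of_mem hqS]; omega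
    have haq : a ∈ S.erase (σ a) := Finset.mem_erase.2 ⟨ha.symm, haS⟩
    rw [B_step hσ hqS haS ha.symm rfl (by omega)]
    rw [Finset.sum_congr rfl (g := fun _ => 2 * n.factorial)]
    · rw [Finset.sum_const, Finset.card_erase_of_mem haq, hc1, Nat.factorial_succ, smul_eq_mul]
      simp only [Nat.add_succ_sub_one]
      ring
    · intro d hd
      simp only [Finset.mem_erase] at hd
      obtain ⟨hda, hdq, hdS⟩ := hd
      apply ih _ _ hc1 (del_fix (swap_fix hσ hqS hdS) hqS)
      have h1 : σ d ≠ σ a := fun hh => hda (σ.injective hh)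
      rw [del, Equiv.Perm.sign_mul, Equiv.Perm.sign_mul, hs, Equiv.Perm.sign_swap hdq.symm,
        Equiv.Perm.mul_apply, Equiv.swap_apply_left, Equiv.Perm.sign_swap h1.symm]
      simp


/-- extend a permutation of `Fin n` to `Fin (n+1)`, fixing `p` -/
def ex {n : ℕ} (p : Fin (n + 1)) (c : Equiv.Perm (Fin n)) : Equiv.Perm (Fin (n + 1)) :=
  c.extendDomain (finSuccAboveEquiv p)

theorem ex_mul {n : ℕ} (p : Fin (n + 1)) (c d : Equiv.Perm (Fin n)) :
    ex p (c * d) = ex p c * ex p d := (Equiv.Perm.extendDomain_mul _ _ _).symm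

theorem ex_inj {n : ℕ} (p : Fin (n + 1)) : Function.Injective (ex p) :=
  Equiv.Perm.extendDomainHom_injective (finSuccAboveEquiv p)

theorem ex_self {n : ℕ} (p : Fin (n + 1)) (c : Equiv.Perm (Fin n)) : ex p c p = p :=
  Equiv.Perm.extendDomain_apply_not_subtype _ _ (by simp)

theorem ex_surj {n : ℕ} (p : Fin (n + 1)) (g : Equiv.Perm (Fin (n + 1))) (hg : g p = p) :
    ∃ c, ex p c = g := by
  have h : ∀ x, g x ≠ p ↔ x ≠ p := by
    intro x
    constructor
    · rintro hh rfl; exact hh hg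
    · intro hh h2; exact hh (g.injective (h2.trans hg.symm))
  refine ⟨(finSuccAboveEquiv p).permCongr.symm (g.subtypePerm h), ?_⟩
  ext x
  by_cases hx : x = p
  · subst hx; rw [ex_self, hg]
  · rw [ex, Equiv.Perm.extendDomain_apply_subtype (p := fun x => x ≠ p) _ _ hx]
    simp

theorem ncyc_ex {n : ℕ} (p : Fin (n + 1)) (c : Equiv.Perm (Fin n)) :
    ncyc (ex p c) = ncyc c + 1 := by
  have h : c.support.card ≤ n := by simpa using Finset.card_le_univ c.support
  rw [ncyc_eq, ncyc_eq, ex, Equiv.Perm.cycleType_extendDomain,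
    Equiv.Perm.card_support_extend_domain]
  simp only [Fintype.card_fin]
  omega

theorem full_ex {n : ℕ} (p : Fin (n + 1)) (c : Equiv.Perm (Fin n)) :
    Full (Finset.univ.erase p) (ex p c) ↔ ncyc c = 1 := by
  rw [Full, ncyc_ex, Finset.card_erase_of_mem (Finset.mem_univ p)]
  simp only [Finset.card_univ, Fintype.card_fin]
  constructor
  · rintro ⟨_, h⟩; omega
  · intro h
    refine ⟨?_, by omega⟩
    intro x hx
    have : x = p := by simpa using hx
    rw [this]; exact ex_self p c

theorem isFullCycle_iff {n : ℕ} (c : Equiv.Perm (Fin n)) :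
    IsFullCycle c ↔ ncyc c = 1 := by
  rw [IsFullCycle, ncyc, Multiset.card_eq_one]
  have hs := c.partition.parts_sum
  simp only [Fintype.card_fin] at hs
  constructor
  · intro h; exact ⟨n, h⟩
  · rintro ⟨a, ha⟩
    rw [ha] at hs ⊢
    simp at hs
    rw [hs]

theorem ncyc_inv (g : Equiv.Perm α) : ncyc g⁻¹ = ncyc g := by
  rw [ncyc_eq, ncyc_eq, Equiv.Perm.cycleType_inv, Equiv.Perm.support_inv]

/-- number of pairs -/
def N (n k : ℕ) : ℕ :=
  (Finset.univ.filter fun c : Equiv.Perm (Fin n) × Equiv.Perm (Fin n) =>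
    ncyc c.1 = 1 ∧ ncyc c.2 = 1 ∧ ncyc (c.1 * c.2) = k).card

theorem sum_A (n k : ℕ) (p : Fin (n + 1)) :
    ∑ τ ∈ Finset.univ.filter (fun τ : Equiv.Perm (Fin (n + 1)) => τ p = p ∧ ncyc τ = k + 1),
      A (Finset.univ.erase p) τ = N n k := by
  classical
  unfold A N
  rw [← Finset.card_sigma]
  symm
  refine Finset.card_bij (fun c _ => ⟨ex p (c.1 * c.2), ex p c.2⁻¹⟩) ?_ ?_ ?_
  · rintro ⟨c, d⟩ h
    simp only [Finset.mem_filter, Finset.mem_univ, true_and, Finset.mem_sigma] at h ⊢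
    rw [← ex_mul, full_ex, full_ex, ncyc_ex, ncyc_inv, ex_self]
    simpa using ⟨h.2.2, h.2.1, h.1⟩
  · rintro ⟨c, d⟩ h ⟨c', d'⟩ h' heq
    simp only [Sigma.mk.injEq, heq_eq_eq] at heq
    have h1 := ex_inj p heq.1
    have h2 := inv_injective (ex_inj p heq.2)
    subst h2
    simpa using h1
  · rintro ⟨τ, c⟩ h
    simp only [Finset.mem_filter, Finset.mem_univ, true_and, Finset.mem_sigma] at h
    obtain ⟨⟨h1, h2⟩, h3, h4⟩ := h
    obtain ⟨τ, rfl⟩ := ex_surj p τ h1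
    obtain ⟨c, rfl⟩ := ex_surj p c (h3.1 p (by simp))
    rw [← ex_mul] at h4
    rw [full_ex] at h3 h4
    rw [ncyc_ex] at h2
    refine ⟨(τ * c, c⁻¹), ?_, ?_⟩
    · simp only [Finset.mem_filter, Finset.mem_univ, true_and]
      rw [ncyc_inv]
      refine ⟨h4, h3, ?_⟩
      simpa using h2
    · simp

theorem sum_del (n k : ℕ) (p : Fin (n + 1)) :
    ∑ σ ∈ Finset.univ.filter (fun σ : Equiv.Perm (Fin (n + 1)) => ncyc σ = k),
      (if σ p ≠ p then A (Finset.univ.erase p) (del p σ) else 0) = n * N n k := by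
  classical
  rw [← Finset.sum_filter, ← sum_A n k p]
  have h0 : ∀ m : ℕ, n * m = (Finset.univ.erase p).card * m := by simp
  rw [h0, ← smul_eq_mul, ← Finset.sum_const, ← Finset.sum_product']
  refine Finset.sum_nbij' (fun σ => (σ p, del p σ)) (fun x => Equiv.swap p x.1 * x.2) ?_ ?_ ?_ ?_ ?_
  · intro σ h
    simp only [Finset.mem_filter, Finset.mem_univ, true_and, Finset.mem_product,
      Finset.mem_erase, and_true] at h ⊢
    exact ⟨h.2, del_apply_self _ _, by rw [ncyc_del _ _ h.2, h.1]⟩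
  · rintro ⟨e, τ⟩ h
    simp only [Finset.mem_filter, Finset.mem_univ, true_and, Finset.mem_product,
      Finset.mem_erase, and_true] at h ⊢
    obtain ⟨he, h1, h2⟩ := h
    have h3 : (Equiv.swap p e * τ) p = e := by simp [h1]
    have h4 : del p (Equiv.swap p e * τ) = τ := by rw [del, h3]; simp
    have h5 := ncyc_del p (Equiv.swap p e * τ) (by rw [h3]; exact he)
    rw [h4] at h5
    exact ⟨by omega, by rw [h3]; exact he⟩
  · intro σ h; simp [del]
  · rintro ⟨e, τ⟩ h
    simp only [Finset.mem_filter, Finset.mem_univ, true_and, Finset.mem_product,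
      Finset.mem_erase, and_true] at h ⊢
    simp [del, h.2.1]
  · intro σ h; rfl

theorem sign_odd {n k : ℕ} (hpar : k % 2 = n % 2) (σ : Equiv.Perm (Fin (n + 1)))
    (h : ncyc σ = k) : Equiv.Perm.sign σ = -1 := by
  have hle : σ.support.card ≤ n + 1 := by simpa using Finset.card_le_univ σ.support
  rw [ncyc_eq, Fintype.card_fin] at h
  rw [Equiv.Perm.sign_of_cycleType, Equiv.Perm.sum_cycleType]
  apply Odd.neg_one_pow
  rw [Nat.odd_iff]
  omega

theorem main (n k : ℕ) (hn : 1 ≤ n) (hpar : k % 2 = n % 2) :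
    (n + 1) * (n * N n k) = 2 * (n - 1).factorial *
      (Finset.univ.filter fun σ : Equiv.Perm (Fin (n + 1)) => ncyc σ = k).card := by
  have h1 : ∑ σ ∈ Finset.univ.filter (fun σ : Equiv.Perm (Fin (n + 1)) => ncyc σ = k),
      B Finset.univ σ = (n + 1) * (n * N n k) := by
    unfold B
    rw [Finset.sum_comm, Finset.sum_congr rfl (fun p _ => sum_del n k p)]
    simp
  rw [← h1, Finset.sum_congr rfl (g := fun _ => 2 * (n - 1).factorial)]
  · rw [Finset.sum_const, smul_eq_mul, mul_comm]
  · intro σ hσ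
    simp only [Finset.mem_filter, Finset.mem_univ, true_and] at hσ
    apply B_odd (n - 1) _ _ _ _ (sign_odd hpar σ hσ)
    · simp; omega
    · intro x hx; exact absurd (Finset.mem_univ x) hx

end ZS

/-- pairs of `n`-cycles whose product has `k` cycles. -/
theorem stmt2 (n k : ℕ) (hn : 1 ≤ n) (hk1 : 1 ≤ k) (hkn : k ≤ n) (hpar : k % 2 = n % 2) :
    ((univ.filter fun c : Equiv.Perm (Fin n) × Equiv.Perm (Fin n) =>
        IsFullCycle c.1 ∧ IsFullCycle c.2 ∧ (c.1 * c.2).partition.parts.card = k).card : ℚ)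
      = 2 * (Nat.factorial (n - 1) : ℚ) / ((n : ℚ) * ((n : ℚ) + 1)) *
          ((univ.filter fun σ : Equiv.Perm (Fin (n + 1)) =>
            σ.partition.parts.card = k).card : ℚ) := by
  have h := ZS.main n k hn hpar
  have hN : (univ.filter fun c : Equiv.Perm (Fin n) × Equiv.Perm (Fin n) =>
        IsFullCycle c.1 ∧ IsFullCycle c.2 ∧ (c.1 * c.2).partition.parts.card = k).card
      = ZS.N n k := by
    unfold ZS.N
    congr 1
    ext c
    simp only [mem_filter, mem_univ, true_and, ZS.isFullCycle_iff]
    rfl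
  rw [hN]
  have h' : ((n : ℚ) + 1) * (n * ZS.N n k) = 2 * (n - 1).factorial *
      ((univ.filter fun σ : Equiv.Perm (Fin (n + 1)) => σ.partition.parts.card = k).card : ℚ) := by
    exact_mod_cast h
  have hn0 : (n : ℚ) ≠ 0 := by positivity
  have hn1 : (n : ℚ) + 1 ≠ 0 := by positivity
  rw [div_mul_eq_mul_div, eq_div_iff (mul_ne_zero hn0 hn1), ← h']
  ring
end

section
/- Let n ≥ 1 and let a, b ≥ 0 be integers with a + 2b = n and b even. Then for any fixed permutation γ of [n] of cycle-type 1^a 2^b (i.e., γ is an involution with exactly a fixed points and b transpositions), the number of ordered pairs (c₁,c₂) of n-cycles of [n] with c₁c₂ = γ equals (n−1)!/(n + 1 − a − b) = (n−1)!/(b+1). -/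
open Equiv Finset

/-- `π` has no nontrivial invariant set. -/
def Tr {α : Type*} (π : Perm α) : Prop :=
  ∀ U : Set α, (∀ x, π x ∈ U ↔ x ∈ U) → U = ∅ ∨ U = Set.univ

/-- sign of `π` restricted to `S` (zero if `S` is not invariant). -/
def ee {α : Type*} [Fintype α] [DecidableEq α] (S : Finset α) (π : Perm α) : ℤ :=
  ∑ σ : Perm α, if (∀ x, σ x = if x ∈ S then π x else x) then ((Perm.sign σ : ℤˣ) : ℤ) else 0

section
variable {α : Type*} [Fintype α] [DecidableEq α]

theorem ee_eq (S : Finset α) (π σ : Perm α) (h : ∀ x, σ x = if x ∈ S then π x else x) :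
    ee S π = ((Perm.sign σ : ℤˣ) : ℤ) := by
  unfold ee
  rw [Finset.sum_eq_single σ]
  · rw [if_pos h]
  · intro τ _ hτ
    rw [if_neg]
    intro h'
    apply hτ
    ext x
    rw [h x, h' x]
  · simp

theorem ee_ne (S : Finset α) (π : Perm α) (h : ee S π ≠ 0) : ∀ w, π w ∈ S ↔ w ∈ S := by
  unfold ee at h
  obtain ⟨σ, -, hσ⟩ := Finset.exists_ne_zero_of_sum_ne_zero h
  have h1 : ∀ x, σ x = if x ∈ S then π x else x := by
    by_contra hc
    exact hσ (if_neg hc)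
  intro w
  constructor
  · intro hw
    obtain ⟨v, hv⟩ := σ.surjective (π w)
    by_cases hvS : v ∈ S
    · have := h1 v
      rw [if_pos hvS, hv] at this
      have := π.injective this
      rwa [this]
    · have := h1 v
      rw [if_neg hvS, hv] at this
      rw [this] at hw
      exact absurd hw hvS
  · intro hw
    by_contra hc
    have h2 := h1 (π w)
    rw [if_neg hc] at h2
    have h3 := h1 w
    rw [if_pos hw] at h3
    have := σ.injective (h2.trans h3.symm)
    rw [this] at hc
    exact hc hw

/-- the pointed matrix -/
def MM {R : Type*} [CommRing R] (z : α) (u v : R) (π : Perm α) : Matrix α α R :=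
  fun i j => (if i = j then (if j = z then 1 else u) else 0) +
    (if i = π j then (if j = z then 0 else v) else 0)

theorem det_MM {R : Type*} [CommRing R] (z : α) (u v : R) (π : Perm α) :
    (MM z u v π).det = ∑ S : Finset α, if z ∈ S then 0 else
      (ee S π : R) * (v ^ S.card * u ^ (Fintype.card α - 1 - S.card)) := by
  rw [Matrix.det_apply']
  have key : ∀ σ : Perm α, ∏ i, MM z u v π (σ i) i = ∑ S : Finset α,
      if z ∈ S then 0 else if (∀ x, σ x = if x ∈ S then π x else x) then
        v ^ S.card * u ^ (Fintype.card α - 1 - S.card) else 0 := by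
    intro σ
    simp only [MM]
    rw [Fintype.prod_congr _ _ (fun i => add_comm _ _)]
    rw [Finset.prod_add]
    rw [Finset.powerset_univ]
    refine Finset.sum_congr rfl fun S _ => ?_
    by_cases hz : z ∈ S
    · rw [if_pos hz, Finset.prod_eq_zero hz, zero_mul]
      simp
    rw [if_neg hz]
    by_cases h : ∀ x, σ x = if x ∈ S then π x else x
    · rw [if_pos h]
      congr 1
      · rw [Finset.prod_congr rfl (g := fun _ => v), Finset.prod_const]
        intro x hx
        rw [if_pos, if_neg]
        · rintro rfl; exact hz hx
        · rw [h x, if_pos hx]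
      · have hz' : z ∈ univ \ S := by simp [hz]
        rw [← Finset.mul_prod_erase _ _ hz']
        rw [if_pos (by rw [h z, if_neg hz]), if_pos rfl, one_mul]
        rw [Finset.prod_congr rfl (g := fun _ => u), Finset.prod_const,
          Finset.card_erase_of_mem hz', Finset.card_sdiff_of_subset (Finset.subset_univ _)]
        · congr 1
          simp only [Finset.card_univ]; omega
        · intro x hx
          simp only [Finset.mem_erase, Finset.mem_sdiff, Finset.mem_univ, true_and] at hx
          rw [if_pos (by rw [h x, if_neg hx.2]), if_neg hx.1]
    · rw [if_neg h]
      push Not at h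
      obtain ⟨x, hx⟩ := h
      by_cases hxS : x ∈ S
      · rw [if_pos hxS] at hx
        rw [Finset.prod_eq_zero hxS, zero_mul]
        rw [if_neg hx]
      · rw [if_neg hxS] at hx
        rw [mul_comm, Finset.prod_eq_zero (i := x), zero_mul]
        · simp [hxS]
        · rw [if_neg hx]
  simp_rw [key, Finset.mul_sum]
  rw [Finset.sum_comm]
  refine Finset.sum_congr rfl fun S _ => ?_
  by_cases hz : z ∈ S
  · simp [hz]
  · simp only [if_neg hz, ee]
    push_cast
    rw [Finset.sum_mul]
    refine Finset.sum_congr rfl fun σ _ => ?_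
    split_ifs <;> simp

theorem indicator (z : α) (π : Perm α) [Decidable (Tr π)] :
    (∑ S : Finset α, if z ∈ S then 0 else (-1) ^ S.card * ee S π) = if Tr π then 1 else 0 := by
  classical
  by_cases h : Tr π
  · rw [if_pos h, Finset.sum_eq_single ∅]
    · have : ee (∅ : Finset α) π = 1 := by rw [ee_eq ∅ π 1 (by simp)]; simp
      simp [this]
    · intro S _ hS
      split_ifs with hz
      · rfl
      · by_cases he : ee S π = 0
        · rw [he, mul_zero]
        · exfalso
          rcases h (S : Set α) (by simpa using ee_ne S π he) with h1 | h1
          · exact hS (by simpa using h1)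
          · apply hz
            have : z ∈ (S : Set α) := by rw [h1]; trivial
            simpa using this
    · simp
  · rw [if_neg h]
    have := det_MM (R := ℤ) z 1 (-1) π
    simp only [one_pow, mul_one, Int.cast_id] at this
    simp_rw [mul_comm ((-1 : ℤ) ^ _)]
    rw [← this]
    unfold Tr at h
    push Not at h
    obtain ⟨U, hU, hne, hnu⟩ := h
    have : ∃ U : Set α, (∀ x, π x ∈ U ↔ x ∈ U) ∧ U.Nonempty ∧ z ∉ U := by
      by_cases hz : z ∈ U
      · refine ⟨Uᶜ, fun x => by simp [hU x], ?_, by simpa using hz⟩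
        rwa [Set.nonempty_compl]
      · exact ⟨U, hU, hne, hz⟩
    obtain ⟨U, hU, ⟨w, hw⟩, hz⟩ := this
    rw [← Matrix.exists_vecMul_eq_zero_iff]
    refine ⟨fun i => if i ∈ U then 1 else 0, ?_, ?_⟩
    · intro hc
      have := congrFun hc w
      simp [hw] at this
    · ext j
      simp only [Matrix.vecMul, dotProduct, MM, mul_add, Finset.sum_add_distrib]
      simp only [mul_ite, mul_zero, Finset.sum_ite_eq', Finset.mem_univ, if_true]
      by_cases hj : j = z
      · subst hj; simp [hz]
      · simp [hj, hU j]

theorem Tr_cycle (π : Perm α) (h2 : 2 ≤ Fintype.card α) :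
    Tr π ↔ π.cycleType = {Fintype.card α} := by
  constructor
  · intro h
    have hne : Nonempty α := Fintype.card_pos_iff.1 (by omega)
    obtain ⟨x⟩ := hne
    have hU : ∀ y, π.SameCycle x y := by
      rcases h {y | π.SameCycle x y} (by intro y; simp) with h1 | h1
      · have : x ∈ ({y | π.SameCycle x y} : Set α) := Perm.SameCycle.refl _ _
        rw [h1] at this; exact this.elim
      · intro y
        have : y ∈ ({y | π.SameCycle x y} : Set α) := by rw [h1]; trivial
        exact this
    have hall : ∀ y, π y ≠ y := by
      intro y hy
      have : ∀ w, w = y := by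
        intro w
        have := (hU y).symm.trans (hU w)
        obtain ⟨i, hi⟩ := this
        rw [Perm.zpow_apply_eq_self_of_apply_eq_self hy] at hi
        exact hi.symm
      have := Fintype.card_le_one_iff.2 (fun a b => (this a).trans (this b).symm)
      omega
    have hc : π.IsCycle := ⟨x, hall x, fun y _ => hU y⟩
    rw [hc.cycleType]
    have : π.support = univ := by ext y; simp [hall y]
    rw [this, Finset.card_univ]
  · intro h
    have hc : π.IsCycle := by rw [← Perm.card_cycleType_eq_one, h]; simp
    have hs : π.support = univ := by
      rw [← Finset.card_eq_iff_eq_univ]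
      rw [hc.cycleType] at h
      simpa using h
    intro U hU
    by_cases hn : U = ∅
    · exact Or.inl hn
    right
    obtain ⟨x, hx⟩ := Set.nonempty_iff_ne_empty.2 hn
    ext y
    simp only [Set.mem_univ, iff_true]
    have hm : ∀ w, π w ≠ w := fun w => by
      have : w ∈ π.support := by rw [hs]; simp
      simpa using this
    obtain ⟨i, hi⟩ := hc.exists_pow_eq (hm x) (hm y)
    rw [← hi]
    clear hi
    induction i with
    | zero => simpa using hx
    | succ k ih => rw [pow_succ', Perm.mul_apply, hU]; exact ih

theorem Tr_subsingleton (π : Perm α) (h2 : ¬ 2 ≤ Fintype.card α) : Tr π ∧ π = 1 := by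
  have : Subsingleton α := Fintype.card_le_one_iff_subsingleton.1 (by omega)
  refine ⟨fun U _ => Set.Subsingleton.eq_empty_or_singleton ?_ |>.imp id ?_,
    Subsingleton.elim _ _⟩
  · exact Set.subsingleton_of_subsingleton
  · rintro ⟨x, rfl⟩
    ext y; simp [Subsingleton.elim y x]

open Classical in
theorem card_Tr : ((univ : Finset (Perm α)).filter fun π => Tr π).card
    = Nat.factorial (Fintype.card α - 1) := by
  by_cases h2 : 2 ≤ Fintype.card α
  · have := Perm.card_of_cycleType_singleton (α := α) h2 le_rfl
    rw [Nat.choose_self, mul_one] at this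
    rw [← this]
    congr 1
    ext π
    simp [Tr_cycle π h2]
  · have hs : Subsingleton α := Fintype.card_le_one_iff_subsingleton.1 (by omega)
    have : ((univ : Finset (Perm α)).filter fun π => Tr π) = {1} := by
      ext π
      have h1 := (Tr_subsingleton π h2).1
      have h3 := (Tr_subsingleton π h2).2
      simp only [Finset.mem_filter, Finset.mem_univ, true_and, Finset.mem_singleton]
      exact ⟨fun _ => h3, fun _ => h1⟩
    rw [this]
    have : Fintype.card α - 1 = 0 := by omega
    simp [this]

theorem sign_Tr (π : Perm α) (h : Tr π) :
    ((Perm.sign π : ℤˣ) : ℤ) = (-1) ^ (Fintype.card α - 1) := by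
  by_cases h2 : 2 ≤ Fintype.card α
  · have := (Tr_cycle π h2).1 h
    rw [Perm.sign_of_cycleType, this]
    obtain ⟨m, hm⟩ : ∃ m, Fintype.card α = m + 1 := ⟨Fintype.card α - 1, by omega⟩
    rw [hm]
    simp [pow_succ]
  · rw [(Tr_subsingleton π h2).2]
    have : Fintype.card α - 1 = 0 := by omega
    simp [this]

end

section
variable {α : Type*} [Fintype α] [DecidableEq α]

theorem Tr_conj (c τ : Perm α) (h : Tr c) : Tr (τ * c * τ⁻¹) := by
  intro U hU
  rcases h (τ ⁻¹' U) (by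
    intro x
    have := hU (τ x)
    simpa using this) with h1 | h1
  · left
    have := Set.preimage_eq_empty_iff.1 h1
    rw [Equiv.range_eq_univ] at this
    simpa using this
  · right
    ext y
    have : τ⁻¹ y ∈ τ ⁻¹' U := by rw [h1]; trivial
    simpa using this

open Classical in
/-- the weighted sum over full cycles -/
noncomputable def EE (S : Finset α) (γ : Perm α) : ℤ :=
  ∑ c : Perm α, if Tr c then ee S (c * γ) else 0

theorem EE_empty (γ : Perm α) :
    EE (∅ : Finset α) γ = (Nat.factorial (Fintype.card α - 1) : ℤ) := by
  classical
  have : ∀ π : Perm α, ee (∅ : Finset α) π = 1 := fun π => by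
    rw [ee_eq ∅ π 1 (by simp)]; simp
  unfold EE
  simp only [this]
  rw [← card_Tr (α := α), Finset.sum_boole]

theorem EE_inv (S : Finset α) (γ : Perm α) (h : ∀ w, γ w ∈ S ↔ w ∈ S) (h1 : S ≠ ∅)
    (h2 : S ≠ univ) : EE S γ = 0 := by
  classical
  unfold EE
  refine Finset.sum_eq_zero fun c _ => ?_
  split_ifs with hc
  · by_contra he
    have h3 := ee_ne _ _ he
    rcases hc (S : Set α) (by
      intro x
      have h4 := h3 (γ⁻¹ x)
      have h5 := h (γ⁻¹ x)
      simp only [Perm.mul_apply, show γ (γ⁻¹ x) = x from by simp] at h4 h5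
      simp only [Finset.mem_coe]
      rw [h4, h5]) with h4 | h4
    · exact h1 (by simpa using h4)
    · exact h2 (by simpa using h4)
  · rfl

theorem EE_two (S : Finset α) (γ : Perm α) (x y : α) (hxy : x ≠ y) (hx : x ∈ S) (hy : y ∈ S)
    (hx' : γ⁻¹ x ∉ S) (hy' : γ⁻¹ y ∉ S) : EE S γ = 0 := by
  classical
  have key : ∀ c : Perm α, ee S (swap x y * c * (swap x y)⁻¹ * γ) = - ee S (c * γ) := by
    intro c
    have hfix : ∀ w ∈ S, (swap x y)⁻¹ (γ w) = γ w := by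
      intro w hw
      rw [swap_inv, swap_apply_of_ne_of_ne]
      · rintro rfl; simp at hx'; exact hx' hw
      · rintro rfl; simp at hy'; exact hy' hw
    unfold ee
    rw [← Finset.sum_neg_distrib]
    refine Fintype.sum_equiv (Equiv.mulLeft (swap x y)) _ _ ?_
    intro σ
    have : (∀ w, σ w = if w ∈ S then (swap x y * c * (swap x y)⁻¹ * γ) w else w) ↔
       (∀ w, (Equiv.mulLeft (swap x y) σ) w = if w ∈ S then (c * γ) w else w) := by
      refine forall_congr' fun w => ?_
      simp only [Equiv.coe_mulLeft, Perm.mul_apply]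
      by_cases hw : w ∈ S
      · rw [if_pos hw, if_pos hw, hfix w hw]
        constructor
        · intro h; rw [h, swap_apply_self]
        · intro h; rw [← h, swap_apply_self]
      · rw [if_neg hw, if_neg hw]
        have : swap x y w = w := swap_apply_of_ne_of_ne (by rintro rfl; exact hw hx)
          (by rintro rfl; exact hw hy)
        constructor
        · intro h; rw [h, this]
        · intro h; exact (swap x y).injective (h.trans this.symm)
    simp only [this]
    split_ifs
    · simp [Perm.sign_swap hxy]
    · simp
  have : EE S γ = - EE S γ := by
    conv_lhs => unfold EE
    unfold EE
    rw [← Finset.sum_neg_distrib]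
    refine (Fintype.sum_equiv (MulAut.conj (swap x y)).toEquiv _ _ ?_).symm
    intro c
    have h1 : Tr c ↔ Tr (swap x y * c * (swap x y)⁻¹) := by
      refine ⟨Tr_conj _ _, fun h => ?_⟩
      have := Tr_conj _ (swap x y)⁻¹ h
      simpa [mul_assoc] using this
    simp only [MulEquiv.toEquiv_eq_coe, EquivLike.coe_coe, MulAut.conj_apply, ← h1]
    split_ifs
    · rw [key]
    · simp
  omega

theorem Tr_split (S : Finset α) (f : Perm {a // a ∈ S}) (g : Perm {a // ¬ a ∈ S}) (x y : α)
    (hx : x ∈ S) (hy : y ∉ S) :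
    Tr (Perm.subtypeCongr f g * swap x y) ↔ Tr f ∧ Tr g := by
  classical
  set c' := Perm.subtypeCongr f g with hc'
  have hf : ∀ w : {a // a ∈ S}, c' w = f w := fun w => Perm.subtypeCongr.left_apply_subtype _ _ _
  have hg : ∀ w : {a // ¬ a ∈ S}, c' w = g w :=
    fun w => Perm.subtypeCongr.right_apply_subtype _ _ _
  have hpS : ∀ w, c' w ∈ S ↔ w ∈ S := by
    intro w
    by_cases hw : w ∈ S
    · have := hf ⟨w, hw⟩
      simp only at this
      rw [this]; simp [hw]
    · have := hg ⟨w, hw⟩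
      simp only at this
      rw [this]
      simp only [hw, iff_false]
      exact (g ⟨w, hw⟩).2
  constructor
  · intro h
    -- invariant sets avoiding x and y are empty
    have h0 : ∀ U : Set α, (∀ w, c' w ∈ U ↔ w ∈ U) → x ∉ U → y ∉ U → U = ∅ := by
      intro U hU hxU hyU
      rcases h U (by
        intro w
        rw [Perm.mul_apply, hU]
        by_cases h1 : w = x
        · subst h1; simp [hxU, hyU]
        by_cases h2 : w = y
        · subst h2; simp [hxU, hyU]
        rw [swap_apply_of_ne_of_ne h1 h2]) with h1 | h1
      · exact h1
      · exfalso; apply hxU; rw [h1]; trivial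
    constructor
    · have main : ∀ V : Set {a // a ∈ S}, (∀ w, f w ∈ V ↔ w ∈ V) → ⟨x, hx⟩ ∉ V → V = ∅ := by
        intro V hV hxV
        have := h0 (Subtype.val '' V) (by
          intro w
          by_cases hw : w ∈ S
          · have h1 := hf ⟨w, hw⟩
            simp only at h1
            rw [h1, Subtype.val_injective.mem_set_image, hV]
            exact (Subtype.val_injective.mem_set_image (a := ⟨w, hw⟩)).symm
          · have := (hpS w).not.2 hw
            simp [hw, this]) (by simpa [hx] using hxV) (by simp [hy])
        simpa using this
      intro V hV
      by_cases hxV : (⟨x, hx⟩ : {a // a ∈ S}) ∈ V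
      · right
        have := main Vᶜ (by intro w; simp [hV w]) (by simpa using hxV)
        simpa using this
      · left; exact main V hV hxV
    · have main : ∀ V : Set {a // ¬ a ∈ S}, (∀ w, g w ∈ V ↔ w ∈ V) → ⟨y, hy⟩ ∉ V → V = ∅ := by
        intro V hV hxV
        have := h0 (Subtype.val '' V) (by
          intro w
          by_cases hw : w ∈ S
          · have := (hpS w).2 hw
            simp [hw, this]
          · have h1 := hg ⟨w, hw⟩
            simp only at h1
            rw [h1, Subtype.val_injective.mem_set_image, hV]
            exact (Subtype.val_injective.mem_set_image (a := ⟨w, hw⟩)).symm)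
            (by simp [hx]) (by simpa [hy] using hxV)
        simpa using this
      intro V hV
      by_cases hxV : (⟨y, hy⟩ : {a // ¬ a ∈ S}) ∈ V
      · right
        have := main Vᶜ (by intro w; simp [hV w]) (by simpa using hxV)
        simpa using this
      · left; exact main V hV hxV
  · rintro ⟨h1, h2⟩
    -- key: x ∈ U iff y ∈ U
    have key : ∀ U : Set α, (∀ w, (c' * swap x y) w ∈ U ↔ w ∈ U) → x ∈ U → y ∈ U := by
      intro U hU hxU
      by_contra hyU
      have hcard : ((univ.filter fun w => w ∈ S ∧ w ∈ U).erase x).card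
          = (univ.filter fun w => w ∈ S ∧ w ∈ U).card := by
        refine Finset.card_bij (fun w _ => c' w) ?_ ?_ ?_
        · intro w hw
          simp only [Finset.mem_erase, Finset.mem_filter, Finset.mem_univ, true_and] at hw ⊢
          refine ⟨(hpS w).2 hw.2.1, ?_⟩
          have := hU w
          rw [Perm.mul_apply, swap_apply_of_ne_of_ne hw.1 (by rintro rfl; exact hy hw.2.1)] at this
          exact this.2 hw.2.2
        · intro w _ w' _ h; exact c'.injective h
        · intro w hw
          simp only [Finset.mem_filter, Finset.mem_univ, true_and] at hw
          obtain ⟨v, rfl⟩ := c'.surjective w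
          refine ⟨v, ?_, rfl⟩
          simp only [Finset.mem_erase, Finset.mem_filter, Finset.mem_univ, true_and]
          have hvS := (hpS v).1 hw.1
          have hvx : v ≠ x := by
            rintro rfl
            have := hU y
            rw [Perm.mul_apply, swap_apply_right] at this
            exact hyU (this.1 hw.2)
          refine ⟨hvx, hvS, ?_⟩
          have := hU v
          rw [Perm.mul_apply, swap_apply_of_ne_of_ne hvx (by rintro rfl; exact hy hvS)] at this
          exact this.1 hw.2
      have hxm : x ∈ (univ.filter fun w => w ∈ S ∧ w ∈ U) := by simp [hx, hxU]
      have := Finset.card_erase_lt_of_mem hxm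
      omega
    intro U hU
    have hiff : x ∈ U ↔ y ∈ U := by
      refine ⟨key U hU, fun hyU => ?_⟩
      by_contra hxU
      exact key Uᶜ (by intro w; simp only [Set.mem_compl_iff, hU w]) hxU hyU
    have hU' : ∀ w, c' w ∈ U ↔ w ∈ U := by
      intro w
      have := hU (swap x y w)
      rw [Perm.mul_apply, swap_apply_self] at this
      rw [this]
      by_cases h1 : w = x
      · subst h1; simp [hiff]
      by_cases h2 : w = y
      · subst h2; simp [hiff]
      rw [swap_apply_of_ne_of_ne h1 h2]
    have a1 := h1 (Subtype.val ⁻¹' U) (by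
      intro w; simp only [Set.mem_preimage]; rw [← hf, hU'])
    have a2 := h2 (Subtype.val ⁻¹' U) (by
      intro w; simp only [Set.mem_preimage]; rw [← hg, hU'])
    by_cases hxU : x ∈ U
    · right
      have hyU := hiff.1 hxU
      have b1 : (Subtype.val ⁻¹' U : Set {a // a ∈ S}) = Set.univ := by
        refine a1.resolve_left fun h => ?_
        have : (⟨x, hx⟩ : {a // a ∈ S}) ∈ (Subtype.val ⁻¹' U : Set {a // a ∈ S}) := hxU
        rw [h] at this; exact this
      have b2 : (Subtype.val ⁻¹' U : Set {a // ¬ a ∈ S}) = Set.univ := by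
        refine a2.resolve_left fun h => ?_
        have : (⟨y, hy⟩ : {a // ¬ a ∈ S}) ∈ (Subtype.val ⁻¹' U : Set {a // ¬ a ∈ S}) := hyU
        rw [h] at this; exact this
      ext w
      simp only [Set.mem_univ, iff_true]
      by_cases hw : w ∈ S
      · have : (⟨w, hw⟩ : {a // a ∈ S}) ∈ (Subtype.val ⁻¹' U : Set {a // a ∈ S}) := by
          rw [b1]; trivial
        exact this
      · have : (⟨w, hw⟩ : {a // ¬ a ∈ S}) ∈ (Subtype.val ⁻¹' U : Set {a // ¬ a ∈ S}) := by
          rw [b2]; trivial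
        exact this
    · left
      have hyU := hiff.not.1 hxU
      have b1 : (Subtype.val ⁻¹' U : Set {a // a ∈ S}) = ∅ := by
        refine a1.resolve_right fun h => hxU ?_
        have : (⟨x, hx⟩ : {a // a ∈ S}) ∈ (Subtype.val ⁻¹' U : Set {a // a ∈ S}) := by
          rw [h]; trivial
        exact this
      have b2 : (Subtype.val ⁻¹' U : Set {a // ¬ a ∈ S}) = ∅ := by
        refine a2.resolve_right fun h => hyU ?_
        have : (⟨y, hy⟩ : {a // ¬ a ∈ S}) ∈ (Subtype.val ⁻¹' U : Set {a // ¬ a ∈ S}) := by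
          rw [h]; trivial
        exact this
      ext w
      simp only [Set.mem_empty_iff_false, iff_false]
      intro hwU
      by_cases hw : w ∈ S
      · have : (⟨w, hw⟩ : {a // a ∈ S}) ∈ (Subtype.val ⁻¹' U : Set {a // a ∈ S}) := hwU
        rw [b1] at this; exact this
      · have : (⟨w, hw⟩ : {a // ¬ a ∈ S}) ∈ (Subtype.val ⁻¹' U : Set {a // ¬ a ∈ S}) := hwU
        rw [b2] at this; exact this

theorem EE_one (S : Finset α) (γ : Perm α) (hγ : ∀ w, γ (γ w) = w) (x : α) (hx : x ∈ S)
    (hx' : γ x ∉ S) (hr : ∀ w ∈ S, w ≠ x → γ w ∈ S) :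
    EE S γ = (-1) ^ (S.card - 1) * (Nat.factorial (S.card - 1) : ℤ) *
      (Nat.factorial (Fintype.card α - S.card - 1) : ℤ) * ee (S.erase x) γ := by
  classical
  set y := γ x with hy
  have hre : ∀ w ∈ S.erase x, γ w ∈ S.erase x := by
    intro w hw
    rw [Finset.mem_erase] at hw ⊢
    refine ⟨?_, hr w hw.2 hw.1⟩
    intro h
    apply hx'
    rw [hy, ← h, hγ]; exact hw.2
  have hinv : Function.Involutive (fun w => if w ∈ S.erase x then γ w else w) := by
    intro w
    by_cases hw : w ∈ S.erase x
    · simp only [if_pos hw, if_pos (hre w hw), hγ]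
    · simp only [if_neg hw]
  set σ₁ : Perm α := hinv.toPerm with hσ₁
  have hσ₁a : ∀ w, σ₁ w = if w ∈ S.erase x then γ w else w := fun w => rfl
  have he₁ : ee (S.erase x) γ = ((Perm.sign σ₁ : ℤˣ) : ℤ) := ee_eq _ _ _ hσ₁a
  have hρ : ∀ w ∈ S, swap x y (γ w) = σ₁ w := by
    intro w hw
    rw [hσ₁a]
    by_cases hwx : w = x
    · subst hwx; simp [← hy]
    · have hw' : w ∈ S.erase x := Finset.mem_erase.2 ⟨hwx, hw⟩
      rw [if_pos hw', swap_apply_of_ne_of_ne]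
      · exact (Finset.mem_erase.1 (hre w hw')).1
      · intro h; apply hx'; rw [← h]; exact hr w hw hwx
  have hσ₁S : ∀ w, σ₁ w ∈ S ↔ w ∈ S := by
    intro w
    rw [hσ₁a]
    split_ifs with h
    · exact ⟨fun _ => (Finset.mem_erase.1 h).2, fun _ => (Finset.mem_erase.1 (hre w h)).2⟩
    · rfl
  have step1 : EE S γ = ∑ c : Perm α, if Tr (c * swap x y) then ee S (c * swap x y * γ) else 0 := by
    unfold EE
    refine (Fintype.sum_equiv (Equiv.mulRight (swap x y)) _ _ ?_).symm
    intro c; rfl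
  have step2 : (∑ p : Perm {a // a ∈ S} × Perm {a // ¬ a ∈ S},
      if Tr p.1 ∧ Tr p.2 then (-1) ^ (S.card - 1) * ee (S.erase x) γ else 0) =
      ∑ c : Perm α, if Tr (c * swap x y) then ee S (c * swap x y * γ) else 0 := by
    refine Fintype.sum_of_injective (Perm.subtypeCongrHom (fun a => a ∈ S))
      (Perm.subtypeCongrHom_injective _) _ _ ?_ ?_
    · intro c hc
      split_ifs with hT
      · by_contra he
        apply hc
        have h1 := ee_ne _ _ he
        have hcS' : ∀ w ∈ S, c w ∈ S := by
          intro w hw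
          obtain ⟨v, rfl⟩ := σ₁.surjective w
          have hv := (hσ₁S v).1 hw
          rw [← hρ v hv]
          have := (h1 v).2 hv
          simpa using this
        have hcS : ∀ w, c w ∈ S ↔ w ∈ S := by
          have himg : S.image c = S := by
            apply Finset.eq_of_subset_of_card_le
            · intro w hw
              obtain ⟨v, hv, rfl⟩ := Finset.mem_image.1 hw
              exact hcS' v hv
            · rw [Finset.card_image_of_injective _ c.injective]
          intro w
          refine ⟨fun h => ?_, hcS' w⟩
          rw [← himg] at h
          obtain ⟨v, hv, hvw⟩ := Finset.mem_image.1 h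
          rwa [← c.injective hvw]
        refine ⟨(c.subtypePerm hcS, c.subtypePerm (fun w => (hcS w).not)), ?_⟩
        ext w
        change Perm.subtypeCongr _ _ w = _
        by_cases hw : w ∈ S
        · rw [Perm.subtypeCongr.left_apply _ _ hw]; rfl
        · rw [Perm.subtypeCongr.right_apply _ _ hw]; rfl
      · rfl
    · rintro ⟨f, g⟩
      change _ = if Tr (Perm.subtypeCongr f g * swap x y) then
        ee S (Perm.subtypeCongr f g * swap x y * γ) else 0
      simp only [Tr_split S f g x y hx hx']
      split_ifs with hT
      · rw [ee_eq S _ (Perm.subtypeCongr f 1 * σ₁)]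
        · rw [Perm.sign_mul, Perm.sign_subtypeCongr, he₁]
          have := sign_Tr f hT.1
          rw [Fintype.card_coe] at this
          simp only [Perm.sign_one, mul_one, Units.val_mul]
          rw [← this]
          congr!
        · intro w
          simp only [Perm.mul_apply]
          by_cases hw : w ∈ S
          · rw [if_pos hw, hρ w hw]
            have := (hσ₁S w).2 hw
            rw [Perm.subtypeCongr.left_apply _ _ this, Perm.subtypeCongr.left_apply _ _ this]
          · rw [if_neg hw]
            have h2 : σ₁ w = w := by
              rw [hσ₁a, if_neg]; intro h; exact hw (Finset.mem_erase.1 h).2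
            rw [h2, Perm.subtypeCongr.right_apply _ _ hw]; rfl
      · rfl
  rw [step1, ← step2, ← Finset.sum_filter, Finset.sum_const]
  have hcount : ((univ : Finset (Perm {a // a ∈ S} × Perm {a // ¬ a ∈ S})).filter
      fun p => Tr p.1 ∧ Tr p.2).card =
      Nat.factorial (S.card - 1) * Nat.factorial (Fintype.card α - S.card - 1) := by
    rw [← Finset.univ_product_univ, Finset.filter_product, Finset.card_product, card_Tr, card_Tr]
    rw [Fintype.card_coe, Fintype.card_subtype_compl, Fintype.card_coe]
  rw [hcount]
  simp only [nsmul_eq_mul]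
  push_cast
  ring

open Classical in
theorem main_count [Nonempty α] (γ : Perm α) (hγ : ∀ w, γ (γ w) = w) :
    (Fintype.card α : ℤ) * ∑ c : Perm α, (if Tr c ∧ Tr (c * γ) then 1 else 0)
    = Nat.factorial (Fintype.card α) - ∑ x : α, if γ x = x then 0 else
      ∑ S : Finset α, if x ∈ S then 0 else
        (Nat.factorial S.card : ℤ) * Nat.factorial (Fintype.card α - 1 - S.card) * ee S γ := by
  have hpos : 0 < Fintype.card α := Fintype.card_pos
  have e1 : (Fintype.card α : ℤ) * ∑ c : Perm α, (if Tr c ∧ Tr (c * γ) then (1 : ℤ) else 0)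
      = ∑ S : Finset α, ((Fintype.card α : ℤ) - S.card) * (-1) ^ S.card * EE S γ := by
    have : ∀ z : α, (∑ c : Perm α, (if Tr c ∧ Tr (c * γ) then (1 : ℤ) else 0)) =
        ∑ S : Finset α, (if z ∈ S then 0 else 1) * ((-1) ^ S.card * EE S γ) := by
      intro z
      unfold EE
      simp_rw [Finset.mul_sum]
      rw [Finset.sum_comm]
      refine Finset.sum_congr rfl fun c _ => ?_
      by_cases hc : Tr c
      · simp only [hc, true_and, if_true]
        rw [← indicator z]
        refine Finset.sum_congr rfl fun S _ => ?_
        split_ifs <;> simp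
      · simp [hc]
    rw [← nsmul_eq_mul, ← Finset.card_univ, ← Finset.sum_const]
    rw [Finset.sum_congr rfl (fun z _ => this z), Finset.sum_comm]
    refine Finset.sum_congr rfl fun S _ => ?_
    rw [← Finset.sum_mul, mul_assoc]
    congr 1
    have h1 : ∀ z, (if z ∈ S then (0 : ℤ) else 1) = 1 - if z ∈ S then 1 else 0 := by
      intro z; split_ifs <;> simp
    simp_rw [h1]
    rw [Finset.sum_sub_distrib]
    simp
  have e2 : ∀ S : Finset α, ((Fintype.card α : ℤ) - S.card) * (-1) ^ S.card * EE S γ =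
      (if S = ∅ then (Nat.factorial (Fintype.card α) : ℤ) else 0) -
      ∑ x : α, if x ∈ S ∧ γ x ≠ x then (Nat.factorial (S.card - 1) : ℤ) *
        Nat.factorial (Fintype.card α - S.card) * ee (S.erase x) γ else 0 := by
    intro S
    have hz : ∀ w x, x ∈ S → γ x ∉ S → w ≠ x → ee (S.erase w) γ = 0 := by
      intro w x hx hx' hwx
      by_contra he
      have := (ee_ne _ _ he x).2 (Finset.mem_erase.2 ⟨hwx.symm, hx⟩)
      exact hx' (Finset.mem_erase.1 this).2
    by_cases hS : ∃ x ∈ S, γ x ∉ S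
    · obtain ⟨x, hx, hx'⟩ := hS
      have hSne : S ≠ ∅ := by rintro rfl; simp at hx
      rw [if_neg hSne]
      have hginv : ∀ w, γ⁻¹ w = γ w := by
        intro w; rw [Perm.inv_eq_iff_eq, hγ]
      by_cases hS2 : ∃ y ∈ S, γ y ∉ S ∧ y ≠ x
      · obtain ⟨y, hy, hy', hyx⟩ := hS2
        rw [EE_two S γ x y hyx.symm hx hy (by rwa [hginv]) (by rwa [hginv])]
        rw [Finset.sum_eq_zero]
        · simp
        · intro w _
          split_ifs
          · by_cases hwx : w = x
            · rw [hz w y hy hy' (by rw [hwx]; exact hyx.symm), mul_zero]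
            · rw [hz w x hx hx' hwx, mul_zero]
          · rfl
      · push Not at hS2
        rw [EE_one S γ hγ x hx hx' (by
          intro w hw hwx
          by_contra hc
          exact hwx (hS2 w hw hc))]
        rw [Finset.sum_eq_single x]
        · rw [if_pos ⟨hx, by rintro h; rw [h] at hx'; exact hx' hx⟩]
          have hlt : S.card < Fintype.card α := by
            rw [← Finset.card_univ]
            exact Finset.card_lt_card (Finset.ssubset_univ_iff.2 (by
              rintro rfl; simp at hx'))
          obtain ⟨m, hm⟩ : ∃ m, Fintype.card α = S.card + m + 1 :=
            ⟨Fintype.card α - S.card - 1, by omega⟩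
          obtain ⟨k, hk⟩ : ∃ k, S.card = k + 1 :=
            ⟨S.card - 1, by have := Finset.card_pos.2 ⟨x, hx⟩; omega⟩
          have a1 : Fintype.card α - S.card - 1 = m := by omega
          have a2 : Fintype.card α - S.card = m + 1 := by omega
          have a3 : S.card - 1 = k := by omega
          rw [a1, a2, a3, hm, hk, Nat.factorial_succ m]
          push_cast
          have : ((-1 : ℤ) ^ k) * (-1) ^ k = 1 := by
            rw [← mul_pow]; simp
          rw [pow_succ]
          linear_combination (-((m : ℤ) + 1) * k.factorial * m.factorial
            * ee (S.erase x) γ) * this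
        · intro w _ hwx
          split_ifs
          · rw [hz w x hx hx' hwx, mul_zero]
          · rfl
        · simp
    · push Not at hS
      have hSi : ∀ w, γ w ∈ S ↔ w ∈ S := by
        intro w
        refine ⟨fun h => ?_, hS w⟩
        have := hS _ h
        rwa [hγ] at this
      rw [Finset.sum_eq_zero]
      · by_cases h0 : S = ∅
        · subst h0
          rw [if_pos rfl, EE_empty]
          obtain ⟨m, hm⟩ : ∃ m, Fintype.card α = m + 1 := ⟨Fintype.card α - 1, by omega⟩
          rw [hm, Nat.factorial_succ]
          simp
        · rw [if_neg h0]
          by_cases h1 : S = univ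
          · subst h1; simp
          · rw [EE_inv S γ hSi h0 h1]; simp
      · intro w _
        split_ifs with h
        · have : ee (S.erase w) γ = 0 := by
            by_contra he
            have := (ee_ne _ _ he (γ w)).2 (Finset.mem_erase.2 ⟨h.2, hS w h.1⟩)
            rw [hγ] at this
            exact absurd this (Finset.notMem_erase _ _)
          rw [this, mul_zero]
        · rfl
  rw [e1, Finset.sum_congr rfl (fun S _ => e2 S), Finset.sum_sub_distrib]
  congr 1
  · simp
  · rw [Finset.sum_comm]
    refine Finset.sum_congr rfl fun x _ => ?_
    by_cases hx : γ x = x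
    · simp [hx]
    · simp only [hx, if_false, ne_eq, not_false_eq_true, and_true]
      rw [← Finset.sum_filter, Finset.sum_congr rfl (fun S _ => (ite_not (x ∈ S) _ _).symm), ← Finset.sum_filter]
      refine Finset.sum_bij' (fun S _ => S.erase x) (fun S _ => insert x S) ?_ ?_ ?_ ?_ ?_
      · intro S hS; simp
      · intro S hS; simp
      · intro S hS
        exact Finset.insert_erase (by simpa using hS)
      · intro S hS
        exact Finset.erase_insert (by simpa using hS)
      · intro S hS
        have hxS : x ∈ S := by simpa using hS
        rw [Finset.card_erase_of_mem hxS]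
        have := Finset.card_pos.2 ⟨x, hxS⟩
        congr 4
        omega

end

section

theorem beta_nat (k m : ℕ) : (∫ t in (0 : ℝ)..1, t ^ k * (1 - t) ^ m) =
    (k.factorial : ℝ) * m.factorial / (k + m + 1).factorial := by
  induction m generalizing k with
  | zero =>
    simp only [pow_zero, mul_one, integral_pow, Nat.factorial_zero, add_zero, Nat.factorial_succ]
    have := Nat.factorial_ne_zero k
    push_cast
    field_simp
    simp
  | succ m ih =>
    have h := intervalIntegral.integral_mul_deriv_eq_deriv_mul (a := (0 : ℝ)) (b := 1)
      (u := fun t => (1 - t) ^ (m + 1)) (v := fun t => t ^ (k + 1) / (k + 1))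
      (u' := fun t => -((m + 1) * (1 - t) ^ m)) (v' := fun t => t ^ k)
      (by
        intro t _
        have := ((hasDerivAt_id' t).const_sub 1).fun_pow (m + 1)
        convert this using 1
        simp)
      (by
        intro t _
        have := (hasDerivAt_pow (k + 1) t).div_const ((k : ℝ) + 1)
        convert this using 1
        have : (k : ℝ) + 1 ≠ 0 := by positivity
        push_cast
        field_simp)
      (by apply Continuous.intervalIntegrable; fun_prop)
      (by apply Continuous.intervalIntegrable; fun_prop)
    have e1 : (∫ t in (0 : ℝ)..1, t ^ k * (1 - t) ^ (m + 1)) =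
        ∫ t in (0 : ℝ)..1, (1 - t) ^ (m + 1) * t ^ k := by
      congr 1; ext t; ring
    have e2 : (∫ t in (0 : ℝ)..1, -(((m : ℝ) + 1) * (1 - t) ^ m) * (t ^ (k + 1) / (k + 1))) =
        -(((m : ℝ) + 1) / (k + 1)) * ∫ t in (0 : ℝ)..1, t ^ (k + 1) * (1 - t) ^ m := by
      rw [← intervalIntegral.integral_const_mul]
      congr 1; ext t; ring
    rw [e1, h, e2, ih]
    have h3 : k + 1 + m + 1 = k + (m + 1) + 1 := by ring
    rw [h3, Nat.factorial_succ k, Nat.factorial_succ m]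
    have := Nat.factorial_ne_zero (k + (m + 1) + 1)
    have : (k : ℝ) + 1 ≠ 0 := by positivity
    push_cast
    field_simp
    simp

theorem int_val (b : ℕ) (hb : Even b) (hb1 : 1 ≤ b) :
    (∫ t in (0 : ℝ)..1, (1 - t) * (1 - 2 * t) ^ (b - 1)) = 1 / (2 * (b + 1)) := by
  obtain ⟨c, rfl⟩ : ∃ c, b = c + 1 := ⟨b - 1, by omega⟩
  simp only [Nat.add_sub_cancel]
  have hc : (c : ℝ) + 1 ≠ 0 := by positivity
  have hc2 : (c : ℝ) + 1 + 1 ≠ 0 := by positivity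
  have := intervalIntegral.integral_eq_sub_of_hasDerivAt (a := (0 : ℝ)) (b := 1)
    (f := fun t => -(1/4) * ((1 - 2 * t) ^ (c + 1) / (c + 1) + (1 - 2 * t) ^ (c + 2) / (c + 1 + 1)))
    (f' := fun t => (1 - t) * (1 - 2 * t) ^ c)
    (by
      intro t _
      have h0 := ((hasDerivAt_id' t).const_mul 2).const_sub 1
      have h1 := (h0.fun_pow (c + 1)).div_const ((c : ℝ) + 1)
      have h2 := (h0.fun_pow (c + 2)).div_const ((c : ℝ) + 1 + 1)
      have h3 := (h1.fun_add h2).const_mul (-(1/4))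
      refine HasDerivAt.congr_deriv h3 ?_
      simp only [Nat.add_sub_cancel, show c + 2 - 1 = c + 1 from rfl]
      push_cast
      field_simp
      ring)
    (by apply Continuous.intervalIntegrable; fun_prop)
  rw [this]
  have h1 : ((1 : ℝ) - 2 * 1) ^ (c + 1) = 1 := by
    have : (1 : ℝ) - 2 * 1 = -1 := by norm_num
    rw [this, hb.neg_one_pow]
  have h2 : ((1 : ℝ) - 2 * 1) ^ (c + 2) = -1 := by
    rw [pow_succ, h1]; norm_num
  rw [h1, h2]
  push_cast
  field_simp
  norm_num
  ring

/-- model involution -/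
def gm (a b : ℕ) : Perm (Fin a ⊕ (Fin 2 × Fin b)) :=
  Equiv.sumCongr (Equiv.refl _) (Equiv.prodCongr (swap 0 1) (Equiv.refl _))

theorem gm_inv (a b : ℕ) (w) : gm a b (gm a b w) = w := by
  rcases w with w | ⟨i, k⟩ <;> simp [gm]

theorem gm_fix (a b : ℕ) (w : Fin a) : gm a b (Sum.inl w) = Sum.inl w := by simp [gm]

theorem gm_nfix (a b : ℕ) (w : Fin 2 × Fin b) : gm a b (Sum.inr w) ≠ Sum.inr w := by
  rcases w with ⟨i, k⟩
  fin_cases i <;> simp [gm]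

theorem inv_cycleType {α : Type*} [Fintype α] [DecidableEq α] (δ : Perm α) (b : ℕ)
    (hδ : ∀ w, δ (δ w) = w) (hs : δ.support.card = 2 * b) :
    δ.cycleType = Multiset.replicate b 2 := by
  have h2 : ∀ x ∈ δ.cycleType, x = 2 := by
    intro x hx
    have h1 := Perm.dvd_of_mem_cycleType hx
    have h3 : orderOf δ ∣ 2 := by
      apply orderOf_dvd_of_pow_eq_one
      ext w
      simp [pow_two, hδ]
    have h4 := Perm.two_le_of_mem_cycleType hx
    have h5 := Nat.le_of_dvd (by norm_num) (h1.trans h3)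
    omega
  have h6 := Multiset.eq_replicate_card.2 h2
  have h7 := Perm.sum_cycleType δ
  rw [hs, h6] at h7
  simp at h7
  rw [h6]
  congr 1
  omega

theorem det_gm {R : Type*} [CommRing R] (a b : ℕ) (i : Fin 2) (k : Fin b) (u v : R) :
    (MM (Sum.inr (i, k)) u v (gm a b)).det = (u + v) ^ a * (u * (u * u - v * v) ^ (b - 1)) := by
  have hM : MM (Sum.inr (i, k)) u v (gm a b) = Matrix.fromBlocks
      (Matrix.diagonal fun _ => u + v) 0 0
      (Matrix.blockDiagonal fun l : Fin b => Matrix.of fun p q : Fin 2 =>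
        (if p = q then (if q = i ∧ l = k then 1 else u) else
          (if q = i ∧ l = k then 0 else v))) := by
    ext p q
    rcases p with p | ⟨p, l⟩ <;> rcases q with q | ⟨q, l'⟩
    · simp [MM, gm, Matrix.diagonal_apply]
      split_ifs <;> simp
    · simp [MM, gm]
    · simp [MM, gm]
    · simp only [MM, gm, Matrix.fromBlocks_apply₂₂, Matrix.blockDiagonal_apply, Matrix.of_apply]
      fin_cases p <;> fin_cases q <;> by_cases hl : l = l' <;> simp [hl]
  rw [hM, Matrix.det_fromBlocks_zero₂₁, Matrix.det_blockDiagonal, Matrix.det_diagonal]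
  congr 1
  · simp
  · rw [← Finset.mul_prod_erase _ _ (Finset.mem_univ k)]
    congr 1
    · rw [Matrix.det_fin_two]
      fin_cases i <;> simp
    · rw [Finset.prod_congr rfl (g := fun _ => u * u - v * v), Finset.prod_const]
      · simp
      · intro l hl
        have hl' : l ≠ k := (Finset.mem_erase.1 hl).1
        rw [Matrix.det_fin_two]
        simp [hl']

theorem det_transport {R : Type*} [CommRing R] {α β : Type*} [Fintype α] [DecidableEq α]
    [Fintype β] [DecidableEq β] (e : α ≃ β) (γ : Perm α) (δ : Perm β)
    (h : ∀ x, e (γ x) = δ (e x)) (x : α) (u v : R) :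
    (MM x u v γ).det = (MM (e x) u v δ).det := by
  rw [← Matrix.det_submatrix_equiv_self e (MM (e x) u v δ)]
  congr 1
  ext i j
  simp [MM, ← h]

theorem exists_model {n a b : ℕ} (hab : a + 2 * b = n) (γ : Perm (Fin n))
    (hγ : γ.cycleType = Multiset.replicate b 2) :
    ∃ e : Fin n ≃ Fin a ⊕ (Fin 2 × Fin b), ∀ x, e (γ x) = gm a b (e x) := by
  have e0 : Fin n ≃ Fin a ⊕ (Fin 2 × Fin b) := Fintype.equivOfCardEq (by simp [hab])
  have h1 : IsConj γ (e0.symm.permCongr (gm a b)) := by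
    rw [Perm.isConj_iff_cycleType_eq, hγ, inv_cycleType _ b]
    · intro w; simp [gm_inv]
    · have h8 : (e0.symm.permCongr (gm a b)).support =
          univ.map (Function.Embedding.inr.trans e0.symm.toEmbedding) := by
        ext w
        obtain ⟨v, rfl⟩ := e0.symm.surjective w
        rcases v with v | v
        · simp [gm_fix]
        · simp [gm_nfix]
      rw [h8, Finset.card_map]
      simp
  obtain ⟨c, hc⟩ := isConj_iff.1 h1
  refine ⟨c.trans e0, fun x => ?_⟩
  have := Equiv.congr_fun hc (c x)
  simp at this
  simp [this]

theorem full_iff_Tr {n : ℕ} (hn : 1 ≤ n) (σ : Perm (Fin n)) : IsFullCycle σ ↔ Tr σ := by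
  unfold IsFullCycle
  by_cases h2 : 2 ≤ n
  · have hT := Tr_cycle σ (by simpa using h2)
    rw [show ({Fintype.card (Fin n)} : Multiset ℕ) = {n} by rw [Fintype.card_fin]] at hT
    rw [hT]
    constructor
    · intro h
      rw [← Perm.filter_parts_partition_eq_cycleType, h]
      simp [h2]
    · intro h
      rw [Perm.parts_partition, h]
      have h3 := Perm.sum_cycleType σ
      rw [h] at h3
      simp at h3
      simp [← h3]
  · have h1 : n = 1 := by omega
    subst h1
    have := Tr_subsingleton σ (by simp)
    simp only [this.1, iff_true]
    rw [this.2, Perm.parts_partition]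
    simp

theorem core (n a b : ℕ) (hn : 1 ≤ n) (hab : a + 2 * b = n) (hb : Even b)
    (γ : Equiv.Perm (Fin n))
    (hγ : γ.partition.parts = Multiset.replicate a 1 + Multiset.replicate b 2) :
    ((univ.filter fun c : Equiv.Perm (Fin n) × Equiv.Perm (Fin n) =>
        IsFullCycle c.1 ∧ IsFullCycle c.2 ∧ c.1 * c.2 = γ).card : ℝ) * (b + 1)
      = (Nat.factorial (n - 1) : ℝ) := by
  classical
  have hct : γ.cycleType = Multiset.replicate b 2 := by
    rw [← Perm.filter_parts_partition_eq_cycleType, hγ, Multiset.filter_add,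
      Multiset.filter_eq_nil.2, Multiset.filter_eq_self.2, zero_add]
    · intro x hx; rw [Multiset.eq_of_mem_replicate hx]
    · intro x hx; rw [Multiset.eq_of_mem_replicate hx]; norm_num
  obtain ⟨e, he⟩ := exists_model hab γ hct
  have hinv : ∀ w, γ (γ w) = w := by
    intro w
    apply e.injective
    rw [he, he, gm_inv]
  have : Nonempty (Fin n) := ⟨⟨0, hn⟩⟩
  have hmain := main_count γ hinv
  have hTinv : ∀ c : Perm (Fin n), Tr c → Tr c⁻¹ := by
    intro c hc U hU
    refine hc U fun x => ?_
    have := hU (c x)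
    simp at this
    exact this.symm
  -- count of pairs
  have hN : ((univ.filter fun c : Equiv.Perm (Fin n) × Equiv.Perm (Fin n) =>
        IsFullCycle c.1 ∧ IsFullCycle c.2 ∧ c.1 * c.2 = γ).card : ℤ) =
      ∑ c : Perm (Fin n), (if Tr c ∧ Tr (c * γ) then 1 else 0) := by
    rw [Finset.sum_boole]
    norm_cast
    refine Finset.card_bij' (fun p _ => p.1⁻¹) (fun c _ => (c⁻¹, c * γ)) ?_ ?_ ?_ ?_
    · rintro ⟨c, d⟩ h
      simp only [Finset.mem_filter, Finset.mem_univ, true_and, full_iff_Tr hn] at h ⊢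
      refine ⟨hTinv _ h.1, ?_⟩
      rw [← h.2.2]
      simpa using h.2.1
    · intro c h
      simp only [Finset.mem_filter, Finset.mem_univ, true_and, full_iff_Tr hn] at h ⊢
      exact ⟨hTinv _ h.1, h.2, by simp⟩
    · rintro ⟨c, d⟩ h
      simp only [Finset.mem_filter, Finset.mem_univ, true_and] at h
      simp [← h.2.2]
    · intro c h; simp
  rw [← hN, Fintype.card_fin] at hmain
  set N := (univ.filter fun c : Equiv.Perm (Fin n) × Equiv.Perm (Fin n) =>
        IsFullCycle c.1 ∧ IsFullCycle c.2 ∧ c.1 * c.2 = γ).card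
  have hinner : ∀ x : Fin n, γ x ≠ x →
      ((∑ S : Finset (Fin n), if x ∈ S then 0 else
        (Nat.factorial S.card : ℤ) * Nat.factorial (n - 1 - S.card) * ee S γ : ℤ) : ℝ)
      = n.factorial * (∫ t in (0 : ℝ)..1, (1 - t) * (1 - 2 * t) ^ (b - 1)) := by
    intro x hx
    have hdet : ∀ t : ℝ, (1 - t) * (1 - 2 * t) ^ (b - 1) =
        ∑ S : Finset (Fin n), if x ∈ S then 0 else
          (ee S γ : ℝ) * (t ^ S.card * (1 - t) ^ (n - 1 - S.card)) := by
      intro t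
      have h1 := det_MM x (1 - t) t γ
      rw [Fintype.card_fin] at h1
      rw [← h1, det_transport e γ (gm a b) he]
      rcases hex : e x with w | ⟨i, k⟩
      · exfalso
        apply hx
        apply e.injective
        rw [he, hex, gm_fix]
      · rw [det_gm]
        have h3 : (1 - t) * (1 - t) - t * t = 1 - 2 * t := by ring
        rw [h3]; simp
    simp_rw [hdet]
    rw [intervalIntegral.integral_finsetSum]
    · rw [Finset.mul_sum]
      push_cast
      refine Finset.sum_congr rfl fun S _ => ?_
      split_ifs with hxS
      · simp
      · rw [intervalIntegral.integral_const_mul, beta_nat]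
        have hlt : S.card < n := by
          have := Finset.card_lt_card (Finset.ssubset_univ_iff.2 (show S ≠ univ by
            rintro rfl; simp at hxS))
          simpa using this
        have : S.card + (n - 1 - S.card) + 1 = n := by omega
        rw [this]
        have := Nat.factorial_ne_zero n
        field_simp
    · intro S _
      apply Continuous.intervalIntegrable
      split_ifs <;> fun_prop
  have hsum : (((∑ x : Fin n, if γ x = x then 0 else
      ∑ S : Finset (Fin n), if x ∈ S then 0 else
        (Nat.factorial S.card : ℤ) * Nat.factorial (n - 1 - S.card) * ee S γ) : ℤ) : ℝ)
      = n.factorial * (b / (b + 1)) := by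
    rw [Int.cast_sum]
    have hc : (univ.filter fun x => ¬ γ x = x).card = 2 * b := by
      have := Perm.sum_cycleType γ
      rw [hct] at this
      simp at this
      rw [mul_comm, this]
      rfl
    rw [Finset.sum_congr rfl (g := fun x => if ¬ γ x = x then
      n.factorial * (∫ t in (0 : ℝ)..1, (1 - t) * (1 - 2 * t) ^ (b - 1)) else 0)]
    · rw [← Finset.sum_filter, Finset.sum_const, hc]
      by_cases hb0 : b = 0
      · subst hb0; simp
      · rw [int_val b hb (by omega)]
        have : (b : ℝ) + 1 ≠ 0 := by positivity
        simp only [nsmul_eq_mul]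
        push_cast
        field_simp
    · intro x _
      by_cases hx : γ x = x
      · simp [hx]
      · rw [if_neg hx, if_pos hx, hinner x hx]
  have hfin : ((n : ℝ) * N) = n.factorial - n.factorial * (b / (b + 1)) := by
    rw [← hsum]
    exact_mod_cast hmain
  obtain ⟨m, rfl⟩ : ∃ m, n = m + 1 := ⟨n - 1, by omega⟩
  rw [Nat.factorial_succ] at hfin
  push_cast at hfin
  have h1 : (b : ℝ) + 1 ≠ 0 := by positivity
  have h2 : (m : ℝ) + 1 ≠ 0 := by positivity
  field_simp at hfin
  simp only [Nat.add_sub_cancel]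
  linear_combination hfin

end

theorem stmt13 (n a b : ℕ) (hn : 1 ≤ n) (hab : a + 2 * b = n) (hb : Even b)
    (γ : Equiv.Perm (Fin n))
    (hγ : γ.partition.parts = Multiset.replicate a 1 + Multiset.replicate b 2) :
    ((univ.filter fun c : Equiv.Perm (Fin n) × Equiv.Perm (Fin n) =>
        IsFullCycle c.1 ∧ IsFullCycle c.2 ∧ c.1 * c.2 = γ).card : ℚ)
      = (Nat.factorial (n - 1) : ℚ) / ((n : ℚ) + 1 - a - b)
    ∧ ((univ.filter fun c : Equiv.Perm (Fin n) × Equiv.Perm (Fin n) =>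
        IsFullCycle c.1 ∧ IsFullCycle c.2 ∧ c.1 * c.2 = γ).card : ℚ)
      = (Nat.factorial (n - 1) : ℚ) / ((b : ℚ) + 1) := by
  have h := core n a b hn hab hb γ hγ
  have h' : ((univ.filter fun c : Equiv.Perm (Fin n) × Equiv.Perm (Fin n) =>
        IsFullCycle c.1 ∧ IsFullCycle c.2 ∧ c.1 * c.2 = γ).card : ℚ) * (b + 1)
      = (Nat.factorial (n - 1) : ℚ) := by exact_mod_cast h
  have h1 : (b : ℚ) + 1 ≠ 0 := by positivity
  have h2 : ((n : ℚ) + 1 - a - b) = b + 1 := by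
    rw [← hab]; push_cast; ring
  rw [h2]
  have h3 := (eq_div_iff h1).2 h'
  exact ⟨h3, h3⟩
end

section
/- Let n ≥ 1 and let a, b be nonnegative integers with a + 2b = n + 1, b ≥ 1 and b odd. Then ((n+1)/2) · (a+1) · p^{(n)}_{1^{a+1} 2^{b−1}} = (n−1)! · z_{1^a 2^b}, where 1^a 2^b is the partition of n+1 with a parts equal to 1 and b parts equal to 2, and 1^{a+1} 2^{b−1} is the partition of n with a+1 parts equal to 1 and b−1 parts equal to 2. -/
open Equiv Finset

namespace St15
open Equiv.Perm

set_option linter.unusedSectionVars false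

variable {α : Type*} [Fintype α] [DecidableEq α]

/-- `S` is stable under `σ`. -/
def Stab (σ : Perm α) (S : Finset α) : Prop := ∀ x ∈ S, σ x ∈ S

lemma Stab.iff {σ : Perm α} {S : Finset α} (h : Stab σ S) (x : α) : σ x ∈ S ↔ x ∈ S := by
  have h1 : S.map σ.toEmbedding = S := by
    apply Finset.eq_of_subset_of_card_le
    · intro y hy
      obtain ⟨x, hx, rfl⟩ := Finset.mem_map.1 hy
      exact h x hx
    · simp
  constructor
  · intro hx
    rw [← h1] at hx
    obtain ⟨y, hy, e⟩ := Finset.mem_map.1 hx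
    have : y = x := σ.injective e
    exact this ▸ hy
  · exact h x

lemma Stab.mul {σ τ : Perm α} {S : Finset α} (h : Stab σ S) (h' : Stab τ S) : Stab (σ * τ) S :=
  fun x hx => h _ (h' x hx)

lemma Stab.inv {σ : Perm α} {S : Finset α} (h : Stab σ S) : Stab σ⁻¹ S := by
  intro x hx
  rw [← h.iff]; simpa using hx

lemma Stab.compl {σ : Perm α} {S : Finset α} (h : Stab σ S) : Stab σ Sᶜ := by
  intro x hx
  rw [mem_compl, h.iff]; simpa using hx

lemma Stab.union {σ : Perm α} {S T : Finset α} (h : Stab σ S) (h' : Stab σ T) :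
    Stab σ (S ∪ T) := by
  intro x hx
  rw [mem_union] at hx ⊢
  exact hx.imp (h x) (h' x)

lemma Stab.inter {σ : Perm α} {S T : Finset α} (h : Stab σ S) (h' : Stab σ T) :
    Stab σ (S ∩ T) := by
  intro x hx
  rw [mem_inter] at hx ⊢
  exact hx.imp (h x) (h' x)

lemma Stab.sdiff {σ : Perm α} {S T : Finset α} (h : Stab σ S) (h' : Stab σ T) :
    Stab σ (S \ T) := by
  intro x hx
  rw [mem_sdiff] at hx ⊢
  exact ⟨h x hx.1, by rw [h'.iff]; exact hx.2⟩

open Classical in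
/-- sign of the restriction of `σ` to a stable set `S`, `0` if `S` is not stable. -/
noncomputable def eps (σ : Perm α) (S : Finset α) : ℤ :=
  if h : Stab σ S then (sign (σ.subtypePerm (p := fun x => x ∈ S) h.iff) : ℤ) else 0

lemma eps_of_not {σ : Perm α} {S : Finset α} (h : ¬ Stab σ S) : eps σ S = 0 := by
  simp [eps, h]

lemma stab_of_eps {σ : Perm α} {S : Finset α} (h : eps σ S ≠ 0) : Stab σ S := by
  by_contra h'
  exact h (eps_of_not h')

/-- the extension of the restriction -/
noncomputable def res (σ : Perm α) (S : Finset α) (h : Stab σ S) : Perm α :=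
  ofSubtype (σ.subtypePerm (p := fun x => x ∈ S) h.iff)

lemma res_mem {σ : Perm α} {S : Finset α} (h : Stab σ S) {x : α} (hx : x ∈ S) :
    res σ S h x = σ x := by
  unfold res
  rw [ofSubtype_apply_of_mem _ hx]; rfl

lemma res_not_mem {σ : Perm α} {S : Finset α} (h : Stab σ S) {x : α} (hx : x ∉ S) :
    res σ S h x = x := by
  unfold res
  rw [ofSubtype_apply_of_not_mem _ hx]

lemma eps_res {σ : Perm α} {S : Finset α} (h : Stab σ S) : eps σ S = sign (res σ S h) := by
  unfold res eps
  rw [dif_pos h, sign_ofSubtype]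

lemma eps_eq {σ : Perm α} {S : Finset α} (h : Stab σ S) (ρ : Perm α) (h1 : ∀ x ∈ S, ρ x = σ x)
    (h2 : ∀ x, x ∉ S → ρ x = x) : eps σ S = sign ρ := by
  rw [eps_res h]
  congr 2
  ext x
  by_cases hx : x ∈ S
  · rw [res_mem h hx, h1 x hx]
  · rw [res_not_mem h hx, h2 x hx]

lemma stab_congr {σ τ : Perm α} {S : Finset α} (h : ∀ x ∈ S, σ x = τ x) :
    Stab σ S ↔ Stab τ S := by
  constructor <;> intro h' x hx
  · rw [← h x hx]; exact h' x hx
  · rw [h x hx]; exact h' x hx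

lemma eps_congr {σ τ : Perm α} {S : Finset α} (h : ∀ x ∈ S, σ x = τ x) : eps σ S = eps τ S := by
  by_cases h1 : Stab σ S
  · have h2 := (stab_congr h).1 h1
    rw [eps_res h2]
    apply eps_eq h1
    · intro x hx; rw [res_mem h2 hx, h x hx]
    · intro x hx; exact res_not_mem h2 hx
  · rw [eps_of_not h1, eps_of_not (fun h2 => h1 ((stab_congr h).2 h2))]

lemma eps_mul {σ τ : Perm α} {S : Finset α} (h : Stab τ S) :
    eps (σ * τ) S = eps σ S * eps τ S := by
  by_cases h1 : Stab σ S
  · rw [eps_res h, eps_res h1, ← Units.val_mul, ← Perm.sign_mul]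
    apply eps_eq (h1.mul h)
    · intro x hx
      rw [mul_apply, res_mem h hx, res_mem h1 (h x hx)]; rfl
    · intro x hx
      rw [mul_apply, res_not_mem h hx, res_not_mem h1 hx]
  · rw [eps_of_not h1, zero_mul]
    apply eps_of_not
    intro h2
    apply h1
    have := h2.mul h.inv
    simpa using this

lemma eps_mul_left {σ τ : Perm α} {S : Finset α} (h : Stab σ S) :
    eps (σ * τ) S = eps σ S * eps τ S := by
  by_cases h1 : Stab τ S
  · exact eps_mul h1
  · rw [eps_of_not h1, mul_zero]
    apply eps_of_not
    intro h2
    apply h1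
    have := h.inv.mul h2
    simpa using this

lemma eps_union {σ : Perm α} {S T : Finset α} (hS : Stab σ S) (hT : Stab σ T)
    (hd : Disjoint S T) : eps σ (S ∪ T) = eps σ S * eps σ T := by
  rw [eps_res hS, eps_res hT, ← Units.val_mul, ← Perm.sign_mul]
  apply eps_eq (hS.union hT)
  · intro x hx
    rw [mul_apply]
    rcases mem_union.1 hx with hx | hx
    · rw [res_not_mem hT (Finset.disjoint_left.1 hd hx), res_mem hS hx]
    · rw [res_mem hT hx, res_not_mem hS (Finset.disjoint_right.1 hd (hT x hx))]
  · intro x hx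
    rw [mem_union, not_or] at hx
    rw [mul_apply, res_not_mem hT hx.2, res_not_mem hS hx.1]

lemma eps_univ (σ : Perm α) : eps σ univ = sign σ :=
  eps_eq (fun _ _ => mem_univ _) _ (fun _ _ => rfl) (fun x hx => absurd (mem_univ x) hx)

lemma eps_swap {i j : α} {S : Finset α} (hi : i ∈ S) (hj : j ∈ S) (hij : i ≠ j) :
    eps (swap i j) S = -1 := by
  have h : ∀ x, x ≠ i → x ≠ j → swap i j x = x := fun x h1 h2 => swap_apply_of_ne_of_ne h1 h2
  rw [eps_eq (σ := swap i j) (S := S) ?_ (swap i j) (fun _ _ => rfl) ?_]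
  · simp [sign_swap hij]
  · intro x hx
    rw [swap_apply_def]; split_ifs <;> assumption
  · intro x hx
    exact h x (fun e => hx (e ▸ hi)) (fun e => hx (e ▸ hj))

lemma eps_singleton {σ : Perm α} {i : α} (h : σ i = i) : eps σ {i} = 1 := by
  rw [eps_eq (σ := σ) (S := {i}) ?_ 1 ?_ ?_]
  · simp
  · intro x hx; simp_all
  · intro x hx; simp_all
  · intro x hx; simp

lemma eps_empty (σ : Perm α) : eps σ ∅ = 1 := by
  rw [eps_eq (σ := σ) (S := ∅) ?_ 1 ?_ ?_]
  · simp
  · intro x hx; simp_all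
  · intro x hx; simp_all
  · intro x hx; simp

/-- `σ` acts on `S` as a single cycle -/
def FullOn (σ : Perm α) (S : Finset α) : Prop :=
  Stab σ S ∧ ∀ A ⊆ S, A.Nonempty → Stab σ A → A = S

lemma FullOn.sameCycle {σ : Perm α} {S : Finset α} (h : FullOn σ S) {x y : α} (hx : x ∈ S)
    (hy : y ∈ S) : SameCycle σ x y := by
  classical
  have := h.2 (S.filter fun y => SameCycle σ x y) (filter_subset _ _) ⟨x, by simp [hx, SameCycle.refl]⟩ (by
    intro z hz
    rw [mem_filter] at hz ⊢
    exact ⟨h.1 z hz.1, hz.2.apply_right⟩)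
  rw [← this, mem_filter] at hy
  exact hy.2

lemma Stab.zpow {σ : Perm α} {S : Finset α} (h : Stab σ S) (k : ℤ) : Stab (σ ^ k) S := by
  intro x hx
  have h1 : ∀ (τ : Perm α), Stab τ S → ∀ m : ℕ, Stab (τ ^ m) S := by
    intro τ ht m
    induction m with
    | zero => intro x hx; simpa using hx
    | succ m ih => rw [pow_succ]; exact ih.mul ht
  cases k with
  | ofNat k => exact h1 σ h k x hx
  | negSucc k => rw [zpow_negSucc]; exact (h1 σ h _).inv x hx

lemma fullOn_of {σ : Perm α} {S : Finset α} (hs : Stab σ S)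
    (h : ∀ x ∈ S, ∀ y ∈ S, SameCycle σ x y) : FullOn σ S := by
  refine ⟨hs, fun A hA ⟨x, hx⟩ hst => Finset.Subset.antisymm hA ?_⟩
  intro y hy
  obtain ⟨k, rfl⟩ := h x (hA hx) y hy
  exact hst.zpow k x hx

lemma FullOn.eps {σ : Perm α} {S : Finset α} (h : FullOn σ S) (hne : S.Nonempty) :
    eps σ S = (-1) ^ (S.card + 1) := by
  obtain ⟨x, hx⟩ := hne
  by_cases hS : S = {x}
  · subst hS
    rw [eps_singleton]
    · simp
    · simpa using h.1 x hx
  have hfix : ∀ y ∈ S, σ y ≠ y := by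
    intro y hy e
    have h2 := h.2 {y} (by simpa using hy) ⟨y, by simp⟩ (by intro z hz; simp_all)
    rw [← h2] at hx
    apply hS
    rw [← h2]
    simp at hx
    simp [hx]
  have hc : IsCycle (res σ S h.1) := by
    refine ⟨x, by rw [res_mem _ hx]; exact hfix x hx, fun y hy => ?_⟩
    have hyS : y ∈ S := by
      by_contra hyS
      exact hy (res_not_mem _ hyS)
    have hf : FullOn (res σ S h.1) S := by
      have hst : ∀ A ⊆ S, Stab (res σ S h.1) A → Stab σ A := by
        intro A hA hs z hz
        rw [← res_mem h.1 (hA hz)]; exact hs z hz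
      refine ⟨?_, fun A hA hne hs => h.2 A hA hne (hst A hA hs)⟩
      intro z hz; rw [res_mem h.1 hz]; exact h.1 z hz
    exact hf.sameCycle hx hyS
  have hsupp : (res σ S h.1).support = S := by
    ext y
    rw [mem_support]
    constructor
    · intro hy
      by_contra hyS
      exact hy (res_not_mem _ hyS)
    · intro hy
      rw [res_mem _ hy]; exact hfix y hy
  rw [eps_res h.1, hc.sign, hsupp, pow_succ]
  simp


lemma exists_fullOn {σ : Perm α} (C : Finset α) (hC : Stab σ C) (hne : C.Nonempty) :
    ∃ B ⊆ C, B.Nonempty ∧ FullOn σ B := by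
  induction C using Finset.strongInduction with
  | H C ih =>
    by_cases h : FullOn σ C
    · exact ⟨C, Finset.Subset.refl _, hne, h⟩
    · have : ∃ A ⊆ C, A.Nonempty ∧ Stab σ A ∧ A ≠ C := by
        by_contra hcon
        push Not at hcon
        exact h ⟨hC, fun A h1 h2 h3 => hcon A h1 h2 h3⟩
      obtain ⟨A, h1, h2, h3, h4⟩ := this
      obtain ⟨B, hB, hB'⟩ := ih A (Finset.ssubset_iff_subset_ne.2 ⟨h1, h4⟩) h3 h2
      exact ⟨B, hB.trans h1, hB'⟩

lemma sum_toggle {σ : Perm α} {B : Finset α} (hB : FullOn σ B) (hne : B.Nonempty) (x : α)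
    (hx : x ∉ B) :
    ∑ S : Finset α, (if x ∈ S then (-1 : ℤ) ^ (S.card + 1) * eps σ S else 0) = 0 := by
  have key : ∀ S : Finset α, Stab σ S → Disjoint S B →
      (-1 : ℤ) ^ ((S ∪ B).card + 1) * eps σ (S ∪ B) = - ((-1 : ℤ) ^ (S.card + 1) * eps σ S) := by
    intro S hS hd
    rw [eps_union hS hB.1 hd, hB.eps hne, card_union_of_disjoint hd]
    have : (-1 : ℤ) ^ B.card * (-1) ^ B.card = 1 := by
      rw [← mul_pow]; simp
    calc _ = - ((-1 : ℤ) ^ (S.card + 1) * eps σ S) * ((-1 : ℤ) ^ B.card * (-1) ^ B.card) := by ring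
      _ = _ := by rw [this, mul_one]
  refine Finset.sum_involution (fun S _ => symmDiff S B) ?_ ?_ (fun _ _ => mem_univ _) ?_
  · intro S _
    have hxm : x ∈ symmDiff S B ↔ x ∈ S := by simp [mem_symmDiff, hx]
    simp only [hxm]
    split_ifs with hxS
    · by_cases hS : Stab σ S
      · by_cases hi : (B ∩ S).Nonempty
        · have h1 : B ∩ S = B := hB.2 _ inter_subset_left hi (hB.1.inter hS)
          have h2 : B ⊆ S := by rw [← h1]; exact inter_subset_right
          have h3 : symmDiff S B = S \ B := by
            ext z; simp only [mem_symmDiff, mem_sdiff]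
            have := @h2 z
            tauto
          have h4 := key (S \ B) (hS.sdiff hB.1) sdiff_disjoint
          rw [sdiff_union_of_subset h2] at h4
          rw [h3, h4]; ring
        · have h2 : Disjoint S B := by
            rw [disjoint_iff_inter_eq_empty, inter_comm]; simpa using hi
          have h3 : symmDiff S B = S ∪ B := h2.symmDiff_eq_sup
          rw [h3, key S hS h2]; ring
      · have hS' : ¬ Stab σ (symmDiff S B) := by
          intro h
          apply hS
          have h5 : S = symmDiff (symmDiff S B) B := by simp
          rw [h5, symmDiff_def]
          exact (h.sdiff hB.1).union (hB.1.sdiff h)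
        rw [eps_of_not hS, eps_of_not hS']; simp
    · simp
  · intro S _ _ h
    have : B = ∅ := by simpa using h
    exact hne.ne_empty this
  · intro S _
    simp

open Classical in
lemma sum_eps (σ : Perm α) :
    ∑ S : Finset α, (-1 : ℤ) ^ (S.card + 1) * S.card * eps σ S =
      if FullOn σ univ then (Fintype.card α : ℤ) else 0 := by
  split_ifs with h
  · rcases isEmpty_or_nonempty α with he | he
    · have h0 : ∀ S : Finset α, S = ∅ := fun S => Finset.eq_empty_of_isEmpty S
      simp [h0]
    rw [Finset.sum_eq_single univ]
    · rw [h.eps univ_nonempty, card_univ]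
      have : (-1 : ℤ) ^ (Fintype.card α + 1) * (-1) ^ (Fintype.card α + 1) = 1 := by
        rw [← mul_pow]; simp
      calc _ = (Fintype.card α : ℤ) * ((-1 : ℤ) ^ (Fintype.card α + 1) *
          (-1) ^ (Fintype.card α + 1)) := by ring
        _ = _ := by rw [this, mul_one]
    · intro S _ hS
      by_cases hst : Stab σ S
      · rcases S.eq_empty_or_nonempty with rfl | hn
        · simp
        · exact absurd (h.2 S (subset_univ _) hn hst) hS
      · rw [eps_of_not hst, mul_zero]
    · simp
  · have : ∃ A : Finset α, A.Nonempty ∧ Stab σ A ∧ A ≠ univ := by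
      by_contra hcon
      push Not at hcon
      exact h ⟨fun _ _ => mem_univ _, fun A _ h2 h3 => hcon A h2 h3⟩
    obtain ⟨A, h1, h2, h3⟩ := this
    have e : ∀ S : Finset α, (-1 : ℤ) ^ (S.card + 1) * S.card * eps σ S =
        ∑ x : α, (if x ∈ S then (-1 : ℤ) ^ (S.card + 1) * eps σ S else 0) := by
      intro S
      rw [Finset.sum_ite_mem, univ_inter, sum_const, nsmul_eq_mul]; ring
    rw [Finset.sum_congr rfl (fun S _ => e S), Finset.sum_comm]
    apply Finset.sum_eq_zero
    intro x _
    have : ∃ C : Finset α, C.Nonempty ∧ Stab σ C ∧ x ∉ C := by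
      by_cases hx : x ∈ A
      · refine ⟨Aᶜ, ?_, h2.compl, by simpa using hx⟩
        rw [Finset.nonempty_iff_ne_empty]
        simpa using h3
      · exact ⟨A, h1, h2, hx⟩
    obtain ⟨C, hC1, hC2, hC3⟩ := this
    obtain ⟨B, hB1, hB2, hB3⟩ := exists_fullOn C hC2 hC1
    exact sum_toggle hB3 hB2 x (fun h => hC3 (hB1 h))

lemma fullOn_subsingleton [Subsingleton α] (σ : Perm α) : FullOn σ univ := by
  refine ⟨fun _ _ => mem_univ _, fun A _ h2 h3 => ?_⟩
  obtain ⟨x, hx⟩ := h2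
  ext y
  simp [Subsingleton.elim y x, hx]

lemma fullOn_iff_cycleType [Nontrivial α] (σ : Perm α) :
    FullOn σ univ ↔ σ.cycleType = {Fintype.card α} := by
  constructor
  · intro h
    have hfix : ∀ y, σ y ≠ y := by
      intro y e
      obtain ⟨z, hz⟩ := exists_ne y
      have h2 := h.2 {y} (subset_univ _) ⟨y, by simp⟩ (by intro z hz; simp_all)
      have : z ∈ ({y} : Finset α) := by rw [h2]; simp
      simp at this
      exact hz this
    have hc : IsCycle σ := by
      obtain ⟨x, _⟩ := exists_pair_ne α
      exact ⟨x, hfix x, fun y _ => h.sameCycle (mem_univ _) (mem_univ _)⟩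
    have hs : σ.support = univ := by ext y; simp [hfix]
    rw [hc.cycleType, hs, card_univ]
  · intro h
    have hc : IsCycle σ := by rw [← card_cycleType_eq_one, h]; simp
    have hs : σ.support = univ := by
      rw [← Finset.card_eq_iff_eq_univ, ← sum_cycleType, h]; simp
    refine fullOn_of (fun _ _ => mem_univ _) (fun x _ y _ => hc.sameCycle ?_ ?_)
    · rw [← mem_support, hs]; simp
    · rw [← mem_support, hs]; simp

lemma fullOn_iff_parts [Nonempty α] (σ : Perm α) :
    FullOn σ univ ↔ σ.partition.parts = {Fintype.card α} := by
  rcases subsingleton_or_nontrivial α with hs | hs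
  · refine ⟨fun _ => ?_, fun _ => fullOn_subsingleton σ⟩
    have h1 : σ = 1 := Subsingleton.elim _ _
    have h2 : Fintype.card α = 1 := le_antisymm
      (Fintype.card_le_one_iff_subsingleton.2 hs) Fintype.card_pos
    subst h1
    rw [parts_partition, h2]
    simp
  · rw [fullOn_iff_cycleType]
    constructor
    · intro h
      rw [parts_partition, h, ← sum_cycleType, h]; simp
    · intro h
      rw [← filter_parts_partition_eq_cycleType, h, Multiset.filter_singleton, if_pos]
      exact Fintype.one_lt_card

open Classical in
lemma card_full [Nonempty α] :
    (univ.filter fun σ : Perm α => FullOn σ univ).card = (Fintype.card α - 1).factorial := by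
  rcases subsingleton_or_nontrivial α with hs | hs
  · have h2 : Fintype.card α = 1 := le_antisymm
      (Fintype.card_le_one_iff_subsingleton.2 hs) Fintype.card_pos
    rw [h2, Finset.filter_true_of_mem (fun σ _ => fullOn_subsingleton σ)]
    simp
  · have := card_of_cycleType_singleton (α := α) (n := Fintype.card α)
      Fintype.one_lt_card le_rfl
    rw [Nat.choose_self, mul_one] at this
    rw [← this]
    congr 1
    ext σ
    simp [fullOn_iff_cycleType]

lemma stab_mul_swap_of_mem {σ : Perm α} {A : Finset α} {i j : α} (hi : i ∈ A) (hj : j ∈ A) :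
    Stab (σ * swap i j) A ↔ Stab σ A := by
  have h : Stab (swap i j) A := by
    intro x hx
    rw [swap_apply_def]; split_ifs <;> assumption
  constructor
  · intro h1
    have := h1.mul h
    rwa [mul_assoc, swap_mul_self, mul_one] at this
  · intro h1
    exact h1.mul h

lemma stab_mul_swap_of_not_mem {σ : Perm α} {A : Finset α} {i j : α} (hi : i ∉ A) (hj : j ∉ A) :
    Stab (σ * swap i j) A ↔ Stab σ A := by
  apply stab_congr
  intro x hx
  rw [mul_apply, swap_apply_of_ne_of_ne]
  · rintro rfl; exact hi hx
  · rintro rfl; exact hj hx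

lemma swap_full_half {σ : Perm α} {S : Finset α} {i j : α} (hS : Stab σ S) (_ : i ∈ S)
    (hj : j ∉ S) (h : FullOn (σ * swap i j) univ) : FullOn σ S := by
  refine ⟨hS, fun A hA hne hst => ?_⟩
  have hjA : j ∉ A := fun h => hj (hA h)
  by_cases hiA : i ∈ A
  · have h1 : Stab (σ * swap i j) (A ∪ Sᶜ) := by
      rw [stab_mul_swap_of_mem (by simp [hiA]) (by simp [hj])]
      exact hst.union hS.compl
    have h2 := h.2 _ (subset_univ _) (hne.mono subset_union_left) h1
    refine Finset.Subset.antisymm hA fun x hx => ?_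
    have : x ∈ A ∪ Sᶜ := by rw [h2]; simp
    simpa [hx] using this
  · have h1 : Stab (σ * swap i j) A := by
      rw [stab_mul_swap_of_not_mem hiA hjA]; exact hst
    have h2 := h.2 _ (subset_univ _) hne h1
    rw [h2] at hjA
    simp at hjA

lemma swap_full_aux {σ : Perm α} {S A : Finset α} {i j : α} (hS : Stab σ S) (hi : i ∈ S)
    (hj : j ∉ S) (hf : FullOn σ Sᶜ) (hA : Stab (σ * swap i j) A) (hiA : i ∈ A) : j ∈ A := by
  by_contra hjA
  have h1 : Stab σ (A ∩ Sᶜ) := by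
    intro x hx
    rw [mem_inter] at hx ⊢
    refine ⟨?_, hS.compl x hx.2⟩
    have := hA x hx.1
    rwa [mul_apply, swap_apply_of_ne_of_ne] at this
    · rintro rfl
      exact (mem_compl.1 hx.2) hi
    · rintro rfl
      exact hjA hx.1
  have h2 : σ j ∈ A ∩ Sᶜ := by
    rw [mem_inter]
    refine ⟨?_, hS.compl j (by simpa using hj)⟩
    have := hA i hiA
    simpa using this
  have h3 := hf.2 _ inter_subset_right ⟨_, h2⟩ h1
  have h4 : j ∈ A ∩ Sᶜ := by rw [h3]; simpa using hj
  exact hjA (mem_inter.1 h4).1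

lemma swap_full {σ : Perm α} {S : Finset α} {i j : α} (hS : Stab σ S) (hi : i ∈ S)
    (hj : j ∉ S) : FullOn (σ * swap i j) univ ↔ FullOn σ S ∧ FullOn σ Sᶜ := by
  constructor
  · intro h
    refine ⟨swap_full_half hS hi hj h, ?_⟩
    rw [swap_comm] at h
    exact swap_full_half hS.compl (by simpa using hj) (by simpa using hi) h
  · rintro ⟨h1, h2⟩
    refine ⟨fun _ _ => mem_univ _, fun A _ hne hA => ?_⟩
    have hij : i ∈ A → j ∈ A := swap_full_aux hS hi hj h2 hA
    have hji : j ∈ A → i ∈ A := by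
      rw [swap_comm] at hA
      exact swap_full_aux hS.compl (by simpa using hj) (by simpa using hi) (by simpa using h1) hA
    have hsub : ∀ B : Finset α, FullOn σ B → Stab σ A → (A ∩ B).Nonempty → B ⊆ A := by
      intro B hB hs hn
      rw [← hB.2 _ inter_subset_right hn (hs.inter hB.1)]
      exact inter_subset_left
    by_cases hiA : i ∈ A
    · have hjA := hij hiA
      rw [stab_mul_swap_of_mem hiA hjA] at hA
      have a1 := hsub S h1 hA ⟨i, by simp [hi, hiA]⟩
      have a2 := hsub Sᶜ h2 hA ⟨j, by simp [hj, hjA]⟩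
      ext x
      have b1 := @a1 x
      have b2 := @a2 x
      rw [mem_compl] at b2
      simp only [mem_univ, iff_true]
      tauto
    · have hjA : j ∉ A := fun h => hiA (hji h)
      rw [stab_mul_swap_of_not_mem hiA hjA] at hA
      exfalso
      obtain ⟨x, hx⟩ := hne
      by_cases hxS : x ∈ S
      · exact hiA (hsub S h1 hA ⟨x, by simp [hx, hxS]⟩ hi)
      · exact hjA (hsub Sᶜ h2 hA ⟨x, by simp [hx, hxS]⟩ (by simpa using hj))

lemma fullOn_subtype {p : α → Prop} [Fintype {x // p x}] {S : Finset α} (hS : ∀ x, x ∈ S ↔ p x)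
    (σ : Perm α) (h : ∀ x, p (σ x) ↔ p x) :
    FullOn σ S ↔ FullOn (σ.subtypePerm h) univ := by
  constructor
  · intro hf
    refine fullOn_of (fun _ _ => mem_univ _) (fun x _ y _ => ?_)
    rw [sameCycle_subtypePerm]
    exact hf.sameCycle ((hS _).2 x.2) ((hS _).2 y.2)
  · intro hf
    refine fullOn_of (fun x hx => ?_) (fun x hx y hy => ?_)
    · rw [hS, h, ← hS]; exact hx
    · have := hf.sameCycle (mem_univ ⟨x, (hS x).1 hx⟩) (mem_univ ⟨y, (hS y).1 hy⟩)
      rwa [sameCycle_subtypePerm] at this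

open Classical in
lemma card_pairs {S : Finset α} (h1 : S.Nonempty) (h2 : Sᶜ.Nonempty) :
    (univ.filter fun σ : Perm α => FullOn σ S ∧ FullOn σ Sᶜ).card =
      (S.card - 1).factorial * (Fintype.card α - S.card - 1).factorial := by
  obtain ⟨i, hi⟩ := h1
  obtain ⟨j, hj⟩ := h2
  have hj' : j ∉ S := by simpa using hj
  have : Nonempty {x // x ∈ S} := ⟨⟨i, hi⟩⟩
  have : Nonempty {x // x ∉ S} := ⟨⟨j, hj'⟩⟩
  have e1 := card_full (α := {x // x ∈ S})
  have e2 := card_full (α := {x // x ∉ S})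
  rw [Fintype.card_coe] at e1
  rw [Fintype.card_subtype_compl, Fintype.card_coe] at e2
  rw [← e1, ← e2, ← Finset.card_product]
  symm
  have hl : ∀ (a : Perm {x // x ∈ S}) (b : Perm {x // x ∉ S}),
      ∃ h, (a.subtypeCongr b).subtypePerm (p := fun x => x ∈ S) h = a := by
    intro a b
    have hh : ∀ x, a.subtypeCongr b x ∈ S ↔ x ∈ S := by
      intro x
      by_cases hx : x ∈ S
      · simp [Perm.subtypeCongr.left_apply a b hx, hx]
      · simp only [Perm.subtypeCongr.right_apply a b hx, hx]
        simpa using (b ⟨x, hx⟩).2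
    refine ⟨hh, ?_⟩
    ext x
    simp
  have hr : ∀ (a : Perm {x // x ∈ S}) (b : Perm {x // x ∉ S}),
      ∃ h, (a.subtypeCongr b).subtypePerm (p := fun x => x ∉ S) h = b := by
    intro a b
    obtain ⟨h, _⟩ := hl a b
    refine ⟨fun x => not_congr (h x), ?_⟩
    ext x
    simp
  have key : ∀ (a : Perm {x // x ∈ S}) (b : Perm {x // x ∉ S}),
      (FullOn (a.subtypeCongr b) S ∧ FullOn (a.subtypeCongr b) Sᶜ) ↔
        (FullOn a univ ∧ FullOn b univ) := by
    intro a b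
    obtain ⟨h, e⟩ := hl a b
    obtain ⟨h', e'⟩ := hr a b
    rw [fullOn_subtype (p := fun x => x ∈ S) (fun _ => Iff.rfl) _ h, e,
      fullOn_subtype (p := fun x => x ∉ S) (fun _ => mem_compl) _ h', e']
  refine Finset.card_bij (fun ab _ => Perm.subtypeCongr ab.1 ab.2) ?_ ?_ ?_
  · rintro ⟨a, b⟩ hab
    simp only [mem_product, mem_filter, mem_univ, true_and] at hab ⊢
    exact (key a b).2 hab
  · rintro ⟨a, b⟩ _ ⟨a', b'⟩ _ e
    exact subtypeCongrHom_injective (fun x => x ∈ S) (a₁ := (a, b)) (a₂ := (a', b')) e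
  · intro σ hσ
    simp only [mem_filter, mem_univ, true_and] at hσ
    refine ⟨(σ.subtypePerm hσ.1.1.iff, σ.subtypePerm (fun x => not_congr (hσ.1.1.iff x))), ?_, ?_⟩
    · simp only [mem_product, mem_filter, mem_univ, true_and]
      refine ⟨(fullOn_subtype (p := fun x => x ∈ S) (fun _ => Iff.rfl) _ _).1 hσ.1,
        (fullOn_subtype (p := fun x => x ∉ S) (fun _ => mem_compl) _ _).1 hσ.2⟩
    · ext x
      by_cases hx : x ∈ S
      · rw [Perm.subtypeCongr.left_apply _ _ hx]; rfl
      · rw [Perm.subtypeCongr.right_apply _ _ hx]; rfl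

lemma fullOn_conj {c τ : Perm α} (h : FullOn c univ) : FullOn (τ * c * τ⁻¹) univ := by
  refine fullOn_of (fun _ _ => mem_univ _) (fun x _ y _ => ?_)
  rw [sameCycle_conj]
  exact h.sameCycle (mem_univ _) (mem_univ _)

open Classical in
/-- the set of full cycles -/
noncomputable def fulls (α : Type*) [Fintype α] [DecidableEq α] : Finset (Perm α) :=
  univ.filter fun c => FullOn c univ

lemma mem_fulls {c : Perm α} : c ∈ fulls α ↔ FullOn c univ := by simp [fulls]

/-- at least two broken points: cancellation -/
lemma sum_two {π : Perm α} {S : Finset α} {i j : α} (hi : i ∈ S) (hj : j ∈ S) (hij : i ≠ j)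
    (hi' : ∀ x ∈ S, π x ≠ i) (hj' : ∀ x ∈ S, π x ≠ j) :
    ∑ c ∈ fulls α, eps (c * π) S = 0 := by
  have hτ : Stab (swap i j) S := by
    intro x hx
    rw [swap_apply_def]; split_ifs <;> assumption
  have e : ∑ c ∈ fulls α, eps (c * π) S = ∑ c ∈ fulls α, - eps (c * π) S := by
    refine Finset.sum_bij' (fun c _ => swap i j * c * (swap i j)⁻¹)
      (fun c _ => swap i j * c * (swap i j)⁻¹) ?_ ?_ ?_ ?_ ?_
    · intro c hc; rw [mem_fulls] at hc ⊢; exact fullOn_conj hc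
    · intro c hc; rw [mem_fulls] at hc ⊢; exact fullOn_conj hc
    · intro c _; simp [mul_assoc]
    · intro c _; simp [mul_assoc]
    · intro c _
      have : eps (swap i j * c * (swap i j)⁻¹ * π) S = eps (swap i j * (c * π)) S := by
        apply eps_congr
        intro x hx
        simp only [mul_apply, swap_inv]
        rw [swap_apply_of_ne_of_ne (hi' x hx) (hj' x hx)]
      rw [this, eps_mul_left hτ, eps_swap hi hj hij]; ring
  rw [Finset.sum_neg_distrib] at e
  omega

/-- no broken point -/
lemma sum_zero {π : Perm α} {S : Finset α} (hS : Stab π S) (h1 : S.Nonempty) (h2 : S ≠ univ) :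
    ∑ c ∈ fulls α, eps (c * π) S = 0 := by
  apply Finset.sum_eq_zero
  intro c hc
  rw [mem_fulls] at hc
  by_contra h
  have := (stab_of_eps h).mul hS.inv
  rw [mul_inv_cancel_right] at this
  exact h2 (hc.2 S (subset_univ _) h1 this)

lemma sum_univ [Nonempty α] {π : Perm α} :
    ∑ c ∈ fulls α, eps (c * π) univ =
      (Fintype.card α - 1).factorial * ((-1) ^ (Fintype.card α + 1) * sign π) := by
  have : ∀ c ∈ fulls α, eps (c * π) univ = (-1) ^ (Fintype.card α + 1) * sign π := by
    intro c hc
    rw [mem_fulls] at hc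
    rw [eps_mul (fun _ _ => mem_univ _), hc.eps univ_nonempty, eps_univ, card_univ]
  rw [Finset.sum_congr rfl this, sum_const, nsmul_eq_mul, fulls, card_full]

/-- one broken point -/
lemma sum_one {π : Perm α} {S : Finset α} {i j : α} (hi : i ∈ S) (hj : j ∉ S)
    (h : Stab (swap i j * π) S) :
    ∑ c ∈ fulls α, eps (c * π) S = (-1) ^ (S.card + 1) * eps (swap i j * π) S *
      ((S.card - 1).factorial * (Fintype.card α - S.card - 1).factorial) := by
  classical
  have e : ∀ c ∈ fulls α, eps (c * π) S = (if Stab (c * swap i j) S then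
      (-1) ^ (S.card + 1) * eps (swap i j * π) S else 0) := by
    intro c hc
    rw [mem_fulls] at hc
    have e1 : c * π = (c * swap i j) * (swap i j * π) := by
      rw [mul_assoc, ← mul_assoc (swap i j), swap_mul_self, one_mul]
    rw [e1, eps_mul h]
    split_ifs with hs
    · have : FullOn (c * swap i j) S := by
        apply swap_full_half hs hi hj
        rwa [mul_assoc, swap_mul_self, mul_one]
      rw [this.eps ⟨i, hi⟩]
    · rw [eps_of_not hs, zero_mul]
  rw [Finset.sum_congr rfl e, ← Finset.sum_filter, sum_const, nsmul_eq_mul, mul_comm]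
  congr 1
  rw [← Nat.cast_mul, ← card_pairs ⟨i, hi⟩ ⟨j, by simpa using hj⟩]
  congr 1
  refine Finset.card_bij' (fun c _ => c * swap i j) (fun c _ => c * swap i j) ?_ ?_ ?_ ?_
  · intro c hc
    rw [mem_filter, mem_fulls] at hc
    rw [mem_filter, ← swap_full hc.2 hi hj, mul_assoc, swap_mul_self, mul_one]
    exact ⟨mem_univ _, hc.1⟩
  · intro c hc
    rw [mem_filter] at hc
    rw [mem_filter, mem_fulls, swap_full hc.2.1.1 hi hj, mul_assoc, swap_mul_self, mul_one]
    exact ⟨hc.2, hc.2.1.1⟩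
  · intro c _; simp [mul_assoc]
  · intro c _; simp [mul_assoc]

lemma term_eq [Nonempty α] {π : Perm α} (hπ : ∀ x, π (π x) = x) (S : Finset α) :
    (-1 : ℤ) ^ (S.card + 1) * S.card * ∑ c ∈ fulls α, eps (c * π) S =
      (if S = univ then ((Fintype.card α).factorial : ℤ) * sign π else 0) +
      ∑ i ∈ S.filter (fun i => π i ∉ S), eps (swap i (π i) * π) S *
        (S.card.factorial * (Fintype.card α - S.card - 1).factorial) := by
  have hsq : ∀ k : ℕ, (-1 : ℤ) ^ k * (-1) ^ k = 1 := by
    intro k; rw [← mul_pow]; simp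
  rcases Finset.eq_empty_or_nonempty (S.filter (fun i => π i ∉ S)) with hB | ⟨i, hiB⟩
  · rw [hB, sum_empty, add_zero]
    have hst : Stab π S := by
      intro x hx
      by_contra h
      have : x ∈ S.filter (fun i => π i ∉ S) := by simp [hx, h]
      rw [hB] at this
      simp at this
    split_ifs with hu
    · subst hu
      rw [sum_univ, card_univ]
      have hf : ((Fintype.card α).factorial : ℤ) =
          Fintype.card α * (Fintype.card α - 1).factorial := by
        rw [← Nat.cast_mul, Nat.mul_factorial_pred Fintype.card_ne_zero]
      rw [hf]
      linear_combination (Fintype.card α * (Fintype.card α - 1).factorial * (sign π : ℤ)) *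
        hsq (Fintype.card α + 1)
    · rcases S.eq_empty_or_nonempty with rfl | hn
      · simp
      · rw [sum_zero hst hn hu, mul_zero]
  · have hi := mem_filter.1 hiB
    have hu : S ≠ univ := by
      rintro rfl
      exact hi.2 (mem_univ _)
    rw [if_neg hu, zero_add]
    have hmv : ∀ k ∈ S.filter (fun i => π i ∉ S), ∀ x ∈ S, π x ≠ k := by
      intro k hk x hx e
      rw [mem_filter] at hk
      apply hk.2
      rw [← e, hπ]; exact hx
    by_cases h2 : ∃ j ∈ S.filter (fun i => π i ∉ S), j ≠ i
    · obtain ⟨j, hjB, hji⟩ := h2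
      have hj := mem_filter.1 hjB
      rw [sum_two hi.1 hj.1 hji.symm (hmv i hiB) (hmv j hjB), mul_zero]
      symm
      apply Finset.sum_eq_zero
      have key : ∀ k ∈ S.filter (fun i => π i ∉ S), ∀ l ∈ S.filter (fun i => π i ∉ S), l ≠ k →
          eps (swap k (π k) * π) S = 0 := by
        intro k hk l hl hlk
        apply eps_of_not
        intro hst
        have hl' := mem_filter.1 hl
        have h3 := hst l hl'.1
        rw [mul_apply, swap_apply_of_ne_of_ne (hmv k hk l hl'.1)
          (fun e => hlk (π.injective e))] at h3
        exact hl'.2 h3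
      intro k hk
      by_cases hki : k = i
      · rw [key k hk j hjB (hki ▸ hji), zero_mul]
      · rw [key k hk i hiB (Ne.symm hki), zero_mul]
    · push Not at h2
      have hB : S.filter (fun i => π i ∉ S) = {i} := by
        apply Finset.eq_singleton_iff_unique_mem.2 ⟨hiB, h2⟩
      rw [hB, sum_singleton]
      have hst : Stab (swap i (π i) * π) S := by
        intro x hx
        rw [mul_apply]
        by_cases hxi : x = i
        · subst hxi; simpa using hx
        · have hxS : π x ∈ S := by
            by_contra h
            exact hxi (h2 x (by simp [hx, h]))
          rw [swap_apply_of_ne_of_ne (hmv i hiB x hx) (fun e => hxi (π.injective e))]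
          exact hxS
      rw [sum_one hi.1 hi.2 hst]
      have hf : (S.card.factorial : ℤ) = S.card * (S.card - 1).factorial := by
        rw [← Nat.cast_mul, Nat.mul_factorial_pred (Finset.card_ne_zero_of_mem hi.1)]
      rw [hf]
      linear_combination (S.card * eps (swap i (π i) * π) S *
        ((S.card - 1).factorial * (Fintype.card α - S.card - 1).factorial)) * hsq (S.card + 1)

lemma gsum {ρ : Perm α} (hρ : ∀ x, ρ (ρ x) = x) (x : ℝ) (X : Finset α) (hX : Stab ρ X) :
    ∑ S ∈ X.powerset, (eps ρ S : ℝ) * (x ^ S.card * (1 - x) ^ (X.card - S.card)) =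
      (1 - 2 * x) ^ ((X.filter fun z => ρ z ≠ z).card / 2) := by
  induction X using Finset.strongInduction with
  | H X ih =>
    rcases X.eq_empty_or_nonempty with rfl | ⟨z, hz⟩
    · simp [eps_empty]
    by_cases hzz : ρ z = z
    · obtain ⟨Y, hzY, rfl⟩ : ∃ Y, z ∉ Y ∧ X = insert z Y :=
        ⟨X.erase z, by simp, by rw [insert_erase hz]⟩
      have hsz : Stab ρ {z} := by intro w hw; simp_all
      have hY : Stab ρ Y := by
        have := hX.sdiff hsz
        rwa [insert_sdiff_of_mem _ (by simp), sdiff_singleton_eq_erase, erase_eq_of_notMem hzY]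
          at this
      have ihY := ih Y (ssubset_insert hzY) hY
      rw [sum_powerset_insert hzY, filter_insert, if_neg (by simpa using hzz), ← ihY,
        ← sum_add_distrib]
      apply Finset.sum_congr rfl
      intro S hS
      rw [mem_powerset] at hS
      have hzS : z ∉ S := fun h => hzY (hS h)
      have hc := card_le_card hS
      have he : eps ρ (insert z S) = eps ρ S := by
        by_cases hs : Stab ρ S
        · rw [insert_eq, eps_union hsz hs (by simpa using hzS), eps_singleton hzz, one_mul]
        · rw [eps_of_not hs, eps_of_not]
          intro h
          apply hs
          have := h.sdiff hsz
          rwa [insert_sdiff_of_mem _ (by simp), sdiff_singleton_eq_erase, erase_eq_of_notMem hzS]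
            at this
      rw [he, card_insert_of_notMem hzS, card_insert_of_notMem hzY,
        show Y.card + 1 - S.card = (Y.card - S.card) + 1 by omega,
        show Y.card + 1 - (S.card + 1) = Y.card - S.card by omega]
      ring
    · set w := ρ z with hw
      have hwX : w ∈ X := hX z hz
      have hρw : ρ w = z := hρ z
      obtain ⟨Y, hzY, hwY, rfl⟩ : ∃ Y, z ∉ Y ∧ w ∉ Y ∧ X = insert z (insert w Y) := by
        refine ⟨(X.erase z).erase w, by simp, by simp, ?_⟩
        rw [insert_erase (by simp [hzz, hwX]), insert_erase hz]
      have hz2 : z ∉ insert w Y := by simp [hzY, Ne.symm hzz]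
      have hsz : Stab ρ {z, w} := by
        intro v hv
        simp only [mem_insert, mem_singleton] at hv ⊢
        rcases hv with rfl | rfl
        · right; rfl
        · left; exact hρw
      have hdiff : ∀ T : Finset α, z ∉ T → w ∉ T → insert z (insert w T) \ {z, w} = T := by
        intro T h1 h2
        ext v
        simp only [mem_sdiff, mem_insert, mem_singleton]
        constructor
        · tauto
        · intro hv
          refine ⟨by tauto, ?_⟩
          rintro (rfl | rfl)
          · exact h1 hv
          · exact h2 hv
      have hY : Stab ρ Y := by
        have := hX.sdiff hsz
        rwa [hdiff Y hzY hwY] at this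
      have ihY := ih Y ((ssubset_insert hwY).trans (ssubset_insert hz2)) hY
      have hcard : ((insert z (insert w Y)).filter fun z => ρ z ≠ z).card / 2 =
          (Y.filter fun z => ρ z ≠ z).card / 2 + 1 := by
        rw [filter_insert, if_pos hzz, filter_insert, if_pos (by rw [hρw]; exact Ne.symm hzz),
          card_insert_of_notMem (by simp [hzY, Ne.symm hzz]),
          card_insert_of_notMem (by simp [hwY])]
        omega
      rw [hcard, pow_succ, ← ihY, sum_powerset_insert hz2, sum_powerset_insert hwY,
        sum_powerset_insert hwY, ← sum_add_distrib, ← sum_add_distrib, ← sum_add_distrib, sum_mul]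
      apply Finset.sum_congr rfl
      intro S hS
      rw [mem_powerset] at hS
      have hzS : z ∉ S := fun h => hzY (hS h)
      have hwS : w ∉ S := fun h => hwY (hS h)
      have hzS2 : z ∉ insert w S := by simp [hzS, Ne.symm hzz]
      have hc := card_le_card hS
      have h1 : eps ρ (insert z S) = 0 := by
        apply eps_of_not
        intro h
        have := h z (by simp)
        rw [← hw, mem_insert] at this
        exact this.elim hzz hwS
      have h2 : eps ρ (insert w S) = 0 := by
        apply eps_of_not
        intro h
        have := h w (by simp)
        rw [hρw] at this
        exact hzS2 this
      have h3 : eps ρ {z, w} = -1 := by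
        rw [← eps_swap (S := {z, w}) (i := z) (j := w) (by simp) (by simp) (Ne.symm hzz)]
        apply eps_congr
        intro v hv
        simp only [mem_insert, mem_singleton] at hv
        rcases hv with rfl | rfl
        · rw [swap_apply_left]
        · rw [swap_apply_right]; exact hρw
      have he : eps ρ (insert z (insert w S)) = - eps ρ S := by
        by_cases hs : Stab ρ S
        · have hu : insert z (insert w S) = {z, w} ∪ S := by
            ext v; simp
          rw [hu, eps_union hsz hs (by simp [hzS, hwS]), h3]; ring
        · rw [eps_of_not hs, eps_of_not, neg_zero]
          intro h
          apply hs
          have := h.sdiff hsz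
          rwa [hdiff S hzS hwS] at this
      rw [h1, h2, he, card_insert_of_notMem hzS2, card_insert_of_notMem hwS,
        card_insert_of_notMem hz2, card_insert_of_notMem hwY,
        show Y.card + 1 + 1 - S.card = (Y.card - S.card) + 2 by omega,
        show Y.card + 1 + 1 - (S.card + 1 + 1) = Y.card - S.card by omega]
      push_cast
      ring

lemma beta_int (s : ℕ) : ∀ r : ℕ, ((r + s + 1).factorial : ℝ) *
    ∫ x in (0 : ℝ)..1, x ^ r * (1 - x) ^ s = r.factorial * s.factorial := by
  induction s with
  | zero =>
    intro r
    simp only [pow_zero, mul_one, integral_pow, add_zero, Nat.factorial_zero, Nat.factorial_succ]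
    push_cast
    have : (r : ℝ) + 1 ≠ 0 := by positivity
    field_simp
    simp
  | succ s ih =>
    intro r
    have h1 : ∫ x in (0 : ℝ)..1, ((r + 1 : ℝ) * (x ^ r * (1 - x) ^ (s + 1)) -
        (s + 1 : ℝ) * (x ^ (r + 1) * (1 - x) ^ s)) = 0 := by
      rw [intervalIntegral.integral_eq_sub_of_hasDerivAt
        (f := fun x : ℝ => x ^ (r + 1) * (1 - x) ^ (s + 1))]
      · simp
      · intro x _
        have ha := (hasDerivAt_id x).pow (r + 1)
        have hb := ((hasDerivAt_id x).const_sub 1).pow (s + 1)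
        have := ha.mul hb
        refine HasDerivAt.congr_deriv this ?_
        simp
        ring
      · apply Continuous.intervalIntegrable
        fun_prop
    rw [intervalIntegral.integral_sub, intervalIntegral.integral_const_mul,
      intervalIntegral.integral_const_mul] at h1
    · have h2 := ih (r + 1)
      rw [show r + 1 + s + 1 = r + (s + 1) + 1 by ring] at h2
      rw [Nat.factorial_succ r] at h2
      rw [Nat.factorial_succ s]
      push_cast at h2 ⊢
      have : (r : ℝ) + 1 ≠ 0 := by positivity
      apply mul_left_cancel₀ this
      linear_combination ((r + (s + 1) + 1).factorial : ℝ) * h1 + (s + 1 : ℝ) * h2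
    · apply Continuous.intervalIntegrable
      fun_prop
    · apply Continuous.intervalIntegrable
      fun_prop

lemma int_lin (m : ℕ) (hm : 1 ≤ m) (he : Even m) :
    ∫ x in (0 : ℝ)..1, x * (1 - 2 * x) ^ (m - 1) = - 1 / (2 * (m + 1)) := by
  obtain ⟨k, rfl⟩ : ∃ k, m = k + 1 := ⟨m - 1, by omega⟩
  have ho : Odd (k + 1 + 1) := he.add_one
  have h0 : (k : ℝ) + 1 ≠ 0 := by positivity
  have h0' : (k : ℝ) + 1 + 1 ≠ 0 := by positivity
  rw [intervalIntegral.integral_eq_sub_of_hasDerivAt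
        (f := fun x : ℝ => - (1 - 2 * x) ^ (k + 1) / (4 * (k + 1)) +
          (1 - 2 * x) ^ (k + 1 + 1) / (4 * (k + 1 + 1)))]
  · have e1 : (1 - 2 * 1 : ℝ) = -1 := by norm_num
    simp only [e1, he.neg_one_pow, ho.neg_one_pow]
    simp
    field_simp
    ring
  · intro x _
    have hb := (((hasDerivAt_id x).const_mul 2).const_sub 1)
    have h1 := ((hb.pow (k + 1)).neg.div_const (4 * (k + 1))).add
      ((hb.pow (k + 1 + 1)).div_const (4 * ((k : ℝ) + 1 + 1)))
    refine HasDerivAt.congr_deriv h1 ?_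
    simp
    field_simp
    ring
  · apply Continuous.intervalIntegrable
    fun_prop

lemma inner_sum {π : Perm α} (hπ : ∀ x, π (π x) = x) {m : ℕ} (hm : π.support.card = 2 * m)
    (he : Even m) {i : α} (hi : π i ≠ i) :
    ∑ S ∈ univ.filter (fun S : Finset α => i ∈ S ∧ π i ∉ S), (eps (swap i (π i) * π) S : ℝ) *
      (S.card.factorial * (Fintype.card α - S.card - 1).factorial) =
    (Fintype.card α).factorial * (-1 / (2 * (m + 1))) := by
  set ρ := swap i (π i) * π with hρdef
  set X := (univ.erase i).erase (π i) with hXdef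
  have memX : ∀ x, x ∈ X ↔ x ≠ i ∧ x ≠ π i := by
    intro x; simp [hXdef]; tauto
  have ρi : ρ i = i := by simp [hρdef]
  have ρj : ρ (π i) = π i := by simp [hρdef, hπ]
  have ρX : ∀ x, x ≠ i → x ≠ π i → ρ x = π x := by
    intro x h1 h2
    rw [hρdef, mul_apply, swap_apply_of_ne_of_ne]
    · intro e; apply h2; rw [← e, hπ]
    · intro e; exact h1 (π.injective e)
  have hX : Stab ρ X := by
    intro x hx
    rw [memX] at hx ⊢
    rw [ρX x hx.1 hx.2]
    refine ⟨?_, ?_⟩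
    · intro e; apply hx.2; rw [← e, hπ]
    · intro e; exact hx.1 (π.injective e)
  have hρ : ∀ x, ρ (ρ x) = x := by
    intro x
    by_cases h1 : x = i
    · rw [h1, ρi, ρi]
    by_cases h2 : x = π i
    · rw [h2, ρj, ρj]
    have := hX x ((memX x).2 ⟨h1, h2⟩)
    rw [memX] at this
    rw [ρX _ this.1 this.2, ρX x h1 h2, hπ]
  have hiX : i ∉ X := by simp [memX]
  have hjX : π i ∉ X := by simp [memX]
  have hXc : X.card + 2 = Fintype.card α := by
    rw [hXdef]
    have h1 := card_erase_add_one (s := univ.erase i) (a := π i) (by simp [hi])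
    have h2 := card_erase_add_one (s := univ) (a := i) (by simp)
    rw [card_univ] at h2
    omega
  have hmv : (X.filter fun z => ρ z ≠ z).card / 2 = m - 1 := by
    have h1 : (X.filter fun z => ρ z ≠ z) = (π.support.erase i).erase (π i) := by
      ext x
      simp only [mem_filter, memX, mem_erase, mem_support]
      constructor
      · rintro ⟨⟨a, b⟩, c⟩
        rw [ρX x a b] at c
        exact ⟨b, a, c⟩
      · rintro ⟨b, a, c⟩
        refine ⟨⟨a, b⟩, ?_⟩
        rw [ρX x a b]; exact c
    have h2 := card_erase_add_one (s := π.support.erase i) (a := π i) (by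
      simp [hi])
    have h3 := card_erase_add_one (s := π.support) (a := i) (by simp [hi])
    rw [h1]
    omega
  have hm1 : 1 ≤ m := by
    have : 0 < π.support.card := card_pos.2 ⟨i, by simp [hi]⟩
    omega
  have step : ∑ S ∈ univ.filter (fun S : Finset α => i ∈ S ∧ π i ∉ S), (eps ρ S : ℝ) *
      (S.card.factorial * (Fintype.card α - S.card - 1).factorial) =
      ∑ S ∈ X.powerset, (eps ρ S : ℝ) *
        ((S.card + 1).factorial * (X.card - S.card).factorial) := by
    symm
    refine Finset.sum_bij' (fun S _ => insert i S) (fun S _ => S.erase i) ?_ ?_ ?_ ?_ ?_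
    · intro S hS
      rw [mem_powerset] at hS
      simp only [mem_filter, mem_univ, true_and, mem_insert, true_or, not_or]
      exact ⟨hi, fun h => hjX (hS h)⟩
    · intro S hS
      simp only [mem_filter, mem_univ, true_and] at hS
      rw [mem_powerset]
      intro x hx
      rw [mem_erase] at hx
      rw [memX]
      refine ⟨hx.1, ?_⟩
      rintro rfl
      exact hS.2 hx.2
    · intro S hS
      rw [mem_powerset] at hS
      exact erase_insert (fun h => hiX (hS h))
    · intro S hS
      simp only [mem_filter, mem_univ, true_and] at hS
      exact insert_erase hS.1
    · intro S hS
      rw [mem_powerset] at hS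
      have hiS : i ∉ S := fun h => hiX (hS h)
      have hsz : Stab ρ {i} := by intro w hw; simp_all
      have he : eps ρ (insert i S) = eps ρ S := by
        by_cases hs : Stab ρ S
        · rw [insert_eq, eps_union hsz hs (by simpa using hiS), eps_singleton ρi, one_mul]
        · rw [eps_of_not hs, eps_of_not]
          intro h
          apply hs
          have := h.sdiff hsz
          rwa [insert_sdiff_of_mem _ (by simp), sdiff_singleton_eq_erase, erase_eq_of_notMem hiS]
            at this
      rw [he, card_insert_of_notMem hiS,
        show Fintype.card α - (S.card + 1) - 1 = X.card - S.card by omega]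
  rw [step]
  have step2 : ∀ S ∈ X.powerset, (eps ρ S : ℝ) *
        ((S.card + 1).factorial * (X.card - S.card).factorial) =
      (Fintype.card α).factorial * ∫ x in (0 : ℝ)..1,
        x * ((eps ρ S : ℝ) * (x ^ S.card * (1 - x) ^ (X.card - S.card))) := by
    intro S hS
    rw [mem_powerset] at hS
    have hc := card_le_card hS
    have := beta_int (X.card - S.card) (S.card + 1)
    rw [show S.card + 1 + (X.card - S.card) + 1 = Fintype.card α by omega] at this
    rw [← this]
    have e : ∀ x : ℝ, x * ((eps ρ S : ℝ) * (x ^ S.card * (1 - x) ^ (X.card - S.card))) =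
        (eps ρ S : ℝ) * (x ^ (S.card + 1) * (1 - x) ^ (X.card - S.card)) := by
      intro x; ring
    simp only [e]
    rw [intervalIntegral.integral_const_mul]
    ring
  rw [Finset.sum_congr rfl step2, ← Finset.mul_sum, ← intervalIntegral.integral_finsetSum]
  · congr 1
    rw [← int_lin m hm1 he]
    congr 1
    ext x
    rw [← Finset.mul_sum, gsum hρ x X hX, hmv]
  · intro S _
    apply Continuous.intervalIntegrable
    fun_prop

open Classical in
lemma main_K [Nonempty α] {π : Perm α} (hπ : ∀ x, π (π x) = x) {m : ℕ}
    (hm : π.support.card = 2 * m) (he : Even m) (hs : sign π = 1) :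
    ((m : ℝ) + 1) * ((fulls α).filter fun c => FullOn (c * π) univ).card =
      (Fintype.card α - 1).factorial := by
  have h1 : (Fintype.card α : ℤ) * ((fulls α).filter fun c => FullOn (c * π) univ).card =
      ∑ S : Finset α, (-1 : ℤ) ^ (S.card + 1) * S.card * ∑ c ∈ fulls α, eps (c * π) S := by
    simp only [Finset.mul_sum]
    rw [Finset.sum_comm]
    simp only [sum_eps]
    rw [← Finset.sum_filter, sum_const, nsmul_eq_mul, mul_comm]
  simp only [term_eq hπ, hs] at h1
  rw [Finset.sum_add_distrib, Finset.sum_ite_eq' univ univ, if_pos (mem_univ _)] at h1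
  have h2 := congrArg (fun z : ℤ => (z : ℝ)) h1
  push_cast at h2
  have h3 : ∑ S : Finset α, ∑ i ∈ S.filter (fun i => π i ∉ S),
      (eps (swap i (π i) * π) S : ℝ) *
        (S.card.factorial * (Fintype.card α - S.card - 1).factorial) =
      ∑ i ∈ π.support, ((Fintype.card α).factorial * (-1 / (2 * (m + 1))) : ℝ) := by
    rw [Finset.sum_comm' (t' := univ)
      (s' := fun i => univ.filter (fun S : Finset α => i ∈ S ∧ π i ∉ S)) (by intro S i; simp)]
    symm
    apply Finset.sum_subset_zero_on_sdiff (subset_univ _)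
    · intro i hi
      have hi' : π i = i := by simpa using hi
      apply Finset.sum_eq_zero
      intro S hS
      rw [mem_filter, hi'] at hS
      tauto
    · intro i hi
      rw [inner_sum hπ hm he (by simpa using hi)]
  rw [h3, sum_const, hm, nsmul_eq_mul] at h2
  have hf : ((Fintype.card α).factorial : ℝ) =
      Fintype.card α * (Fintype.card α - 1).factorial := by
    rw [← Nat.cast_mul, Nat.mul_factorial_pred Fintype.card_ne_zero]
  rw [hf] at h2
  have h0 : (Fintype.card α : ℝ) ≠ 0 := by exact_mod_cast Fintype.card_ne_zero
  have h0' : (m : ℝ) + 1 ≠ 0 := by positivity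
  apply mul_left_cancel₀ h0
  push_cast at h2
  rw [← mul_assoc, mul_comm (Fintype.card α : ℝ), mul_assoc, h2]
  field_simp
  ring

lemma FullOn.inv {c : Perm α} (h : FullOn c univ) : FullOn c⁻¹ univ :=
  fullOn_of (fun _ _ => mem_univ _) fun x _ y _ =>
    sameCycle_inv.2 (h.sameCycle (mem_univ x) (mem_univ y))

lemma parts_iff {N f k : ℕ} (h : f + 2 * k = N) (σ : Perm (Fin N)) :
    σ.partition.parts = Multiset.replicate f 1 + Multiset.replicate k 2 ↔
      σ.cycleType = Multiset.replicate k 2 := by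
  constructor
  · intro e
    rw [← filter_parts_partition_eq_cycleType, e, Multiset.filter_add,
      Multiset.filter_eq_nil.2, Multiset.filter_eq_self.2, zero_add]
    · intro a ha
      rw [Multiset.eq_of_mem_replicate ha]
    · intro a ha
      rw [Multiset.eq_of_mem_replicate ha]
      decide
  · intro e
    rw [parts_partition, ← sum_cycleType, e, add_comm]
    congr 2
    simp
    omega

lemma zNum_mul {N f k : ℕ} (h : f + 2 * k = N) :
    zNum N (Multiset.replicate f 1 + Multiset.replicate k 2) *
      (f.factorial * 2 ^ k * k.factorial) = N.factorial := by
  have h1 := card_of_cycleType_mul_eq (Fin N) (Multiset.replicate k 2)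
  rw [if_pos, Fintype.card_fin] at h1
  · rw [← h1]
    unfold zNum
    simp only [parts_iff h]
    congr 1
    have : N - k * 2 = f := by omega
    rcases Nat.eq_zero_or_pos k with rfl | hk
    · simp at this
      simp [this]
    · simp [this, Multiset.toFinset_replicate, hk.ne']
  · refine ⟨by simp; omega, ?_⟩
    intro a ha
    rw [Multiset.eq_of_mem_replicate ha]

lemma K_type {N k : ℕ} (hN : 1 ≤ N) (hk : Even k) (π : Perm (Fin N))
    (h : π.cycleType = Multiset.replicate k 2) :
    (k + 1) * (univ.filter fun c : Perm (Fin N) × Perm (Fin N) =>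
      (IsFullCycle c.1 ∧ IsFullCycle c.2) ∧ c.1 * c.2 = π).card = (N - 1).factorial := by
  classical
  have hne : Nonempty (Fin N) := ⟨⟨0, hN⟩⟩
  have hfull : ∀ c : Perm (Fin N), IsFullCycle c ↔ FullOn c univ := by
    intro c
    rw [fullOn_iff_parts]; simp only [IsFullCycle, Fintype.card_fin]
  have hπ : ∀ x, π (π x) = x := by
    have h2 : π ^ 2 = 1 := by
      rw [← orderOf_dvd_iff_pow_eq_one, ← lcm_cycleType, h]
      apply Multiset.lcm_dvd.2
      intro a ha
      rw [Multiset.eq_of_mem_replicate ha]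
    intro x
    have := congrArg (fun p : Perm (Fin N) => p x) h2
    simpa [pow_two] using this
  have hm : π.support.card = 2 * k := by
    rw [← sum_cycleType, h]; simp [mul_comm]
  have hs : sign π = 1 := by
    rw [sign_of_cycleType, h]
    simp only [Multiset.sum_replicate, Multiset.card_replicate]
    apply Even.neg_one_pow
    rw [Nat.even_add]
    simp [hk]
  have := main_K hπ hm hk hs
  rw [Fintype.card_fin] at this
  have h3 : (univ.filter fun c : Perm (Fin N) × Perm (Fin N) =>
      (IsFullCycle c.1 ∧ IsFullCycle c.2) ∧ c.1 * c.2 = π).card =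
      ((fulls (Fin N)).filter fun c => FullOn (c * π) univ).card := by
    refine Finset.card_bij' (fun c _ => c.1⁻¹) (fun c _ => (c⁻¹, c * π)) ?_ ?_ ?_ ?_
    · rintro ⟨c, d⟩ hc
      simp only [mem_filter, mem_univ, true_and, hfull] at hc
      obtain ⟨⟨h1, h2⟩, rfl⟩ := hc
      rw [mem_filter, mem_fulls]
      exact ⟨h1.inv, by simpa using h2⟩
    · intro c hc
      rw [mem_filter, mem_fulls] at hc
      simp only [mem_filter, mem_univ, true_and, hfull]
      exact ⟨⟨hc.1.inv, hc.2⟩, by simp⟩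
    · rintro ⟨c, d⟩ hc
      simp only [mem_filter, mem_univ, true_and] at hc
      simp [← hc.2]
    · intro c _; simp
  rw [h3]
  exact_mod_cast this

lemma pN_mul {N f k : ℕ} (hN : 1 ≤ N) (h : f + 2 * k = N) (hk : Even k) :
    (k + 1) * pN N (Multiset.replicate f 1 + Multiset.replicate k 2) =
      zNum N (Multiset.replicate f 1 + Multiset.replicate k 2) * (N - 1).factorial := by
  unfold pN zNum
  simp only [parts_iff h]
  rw [Finset.card_eq_sum_card_fiberwise (f := fun c : Perm (Fin N) × Perm (Fin N) => c.1 * c.2)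
    (t := univ.filter fun σ : Perm (Fin N) => σ.cycleType = Multiset.replicate k 2)
    (by intro c hc; simp at hc ⊢; exact hc.2.2), Finset.mul_sum, Finset.card_eq_sum_ones,
    Finset.sum_mul]
  apply Finset.sum_congr rfl
  intro π hπ
  rw [mem_filter] at hπ
  rw [one_mul, ← K_type hN hk π hπ.2, Finset.filter_filter]
  congr 2
  ext c
  simp only [mem_filter, mem_univ, true_and]
  constructor
  · rintro ⟨⟨a, b, _⟩, d⟩; exact ⟨⟨a, b⟩, d⟩
  · rintro ⟨⟨a, b⟩, d⟩; exact ⟨⟨a, b, d ▸ hπ.2⟩, d⟩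

end St15

/-- the initial case `λ = 1^a 2^b` of the main theorem. -/
theorem stmt15 (n a b : ℕ) (hn : 1 ≤ n) (hab : a + 2 * b = n + 1) (hb1 : 1 ≤ b)
    (hb : Odd b) :
    ((n : ℚ) + 1) / 2 * ((a : ℚ) + 1) *
        pN n (Multiset.replicate (a + 1) 1 + Multiset.replicate (b - 1) 2)
      = (Nat.factorial (n - 1) : ℚ) *
          zNum (n + 1) (Multiset.replicate a 1 + Multiset.replicate b 2) := by
  obtain ⟨k, rfl⟩ : ∃ k, b = k + 1 := ⟨b - 1, by omega⟩
  have hk : Even k := by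
    have := Nat.odd_add_one.1 hb
    simpa using this
  simp only [Nat.add_sub_cancel]
  have h1 := St15.pN_mul (N := n) (f := a + 1) (k := k) hn (by omega) hk
  have h2 := St15.zNum_mul (N := n) (f := a + 1) (k := k) (by omega)
  have h3 := St15.zNum_mul (N := n + 1) (f := a) (k := k + 1) hab
  generalize pN n (Multiset.replicate (a + 1) 1 + Multiset.replicate k 2) = P at *
  generalize zNum n (Multiset.replicate (a + 1) 1 + Multiset.replicate k 2) = Z at *
  generalize zNum (n + 1) (Multiset.replicate a 1 + Multiset.replicate (k + 1) 2) = Y at *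
  have h1' : ((k : ℚ) + 1) * P = Z * (n - 1).factorial := by exact_mod_cast h1
  rw [Nat.factorial_succ k, Nat.factorial_succ n, ← h2, Nat.factorial_succ a] at h3
  have h3' : (Y : ℚ) * (a.factorial * 2 ^ (k + 1) * ((k + 1) * k.factorial)) =
      (n + 1) * (Z * ((a + 1) * a.factorial * 2 ^ k * k.factorial)) := by exact_mod_cast h3
  have ha : (a.factorial : ℚ) ≠ 0 := by exact_mod_cast a.factorial_ne_zero
  have hkf : (k.factorial : ℚ) ≠ 0 := by exact_mod_cast k.factorial_ne_zero
  have h4 : (Y : ℚ) * (2 * (k + 1)) = (n + 1) * (a + 1) * Z := by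
    apply mul_left_cancel₀ (mul_ne_zero (mul_ne_zero ha hkf) (pow_ne_zero k (two_ne_zero' ℚ)))
    rw [pow_succ] at h3'
    linear_combination h3'
  have hk1 : (k : ℚ) + 1 ≠ 0 := by positivity
  apply mul_left_cancel₀ hk1
  linear_combination ((n : ℚ) + 1) / 2 * (a + 1) * h1' - ((n - 1).factorial : ℚ) / 2 * h4
end
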